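/- Let U ⊆ ℝⁿ be an open connected neighborhood of 0, α ∈ (0,1), and let φ: U → ℂ^N be of class C^{1,α} with φ(0) = 0 and φ not identically zero on U. Assume |Dφ(x)| ≤ C |φ(x)|^{σ̄} on U for some constants C ≥ 0 and σ̄ ≥ 1. Then there exist an integer k ≥ 1 and R ∈ (0,1) with B_R(0) ⊆ U, and maps P_k, Q_k: B_R(0) → ℂ^N with φ = P_k + Q_k on B_R(0), such that: (i) P_k ≠ 0, DP_k = 0, and each nonzero real component of P_k is a homogeneous harmonic polynomial of degree k; (ii) Q_k is continuous with Q_k(0) = 0, and for every δ ∈ (0,1) there is a constant C(δ) > 0 such that |Q_k(x)| ≤ C(δ)|x|^{k+δ} and |∇Q_k(x)| ≤ C(δ)|x|^{k+δ−1} for all x ∈ B_R(0). -/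

import Mathlib

open MeasureTheory

/-- The Euclidean Dirac operator `Dφ = Σ_j γ_j ∂_j φ`. -/
noncomputable def dirac {n N : ℕ} (γ : Fin n → Matrix (Fin N) (Fin N) ℂ)
    (φ : EuclideanSpace ℝ (Fin n) → EuclideanSpace ℂ (Fin N))
    (x : EuclideanSpace ℝ (Fin n)) : EuclideanSpace ℂ (Fin N) :=
  (WithLp.equiv 2 (Fin N → ℂ)).symm
    (∑ j, (γ j).mulVec
      (WithLp.equiv 2 (Fin N → ℂ) (fderiv ℝ φ x (EuclideanSpace.single j 1))))

/-- `φ` is of class `C^{1,α}` on `s`. -/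
def IsC1Holder {n N : ℕ} (α : ℝ)
    (φ : EuclideanSpace ℝ (Fin n) → EuclideanSpace ℂ (Fin N))
    (s : Set (EuclideanSpace ℝ (Fin n))) : Prop :=
  ContDiffOn ℝ 1 φ s ∧ ∃ C : NNReal, HolderOnWith C α.toNNReal (fun x => fderiv ℝ φ x) s

/-- The Euclidean Laplacian `Σ_j ∂_j² f` of a scalar function on `ℝⁿ`. -/
noncomputable def lapl {n : ℕ} (f : EuclideanSpace ℝ (Fin n) → ℝ)
    (x : EuclideanSpace ℝ (Fin n)) : ℝ :=
  ∑ j, fderiv ℝ (fun y => fderiv ℝ f y (EuclideanSpace.single j 1)) x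
    (EuclideanSpace.single j 1)

/-- `f` is a homogeneous harmonic polynomial of degree `k` on `ℝⁿ`. -/
def IsHomHarmonicPoly {n : ℕ} (k : ℕ) (f : EuclideanSpace ℝ (Fin n) → ℝ) : Prop :=
  (∃ p : MvPolynomial (Fin n) ℝ, ∀ x, f x = MvPolynomial.eval (fun l => x l) p) ∧
  (∀ t : ℝ, 0 < t → ∀ x, f (t • x) = t ^ k * f x) ∧
  (∀ x, lapl f x = 0)

lemma integrableOn_ball_norm_rpow {E : Type*} [NormedAddCommGroup E] [NormedSpace ℝ E]
    [FiniteDimensional ℝ E] [MeasurableSpace E] [BorelSpace E] [Nontrivial E] (μ : Measure E)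
    [μ.IsAddHaarMeasure] {a : ℝ} (ha : -(Module.finrank ℝ E : ℝ) < a) {r : ℝ} (hr : 0 < r) :
    IntegrableOn (fun x : E => ‖x‖ ^ a) (Metric.ball 0 r) μ := by
  rw [integrableOn_fun_norm_addHaar μ (f := fun t : ℝ => t ^ a)]
  have h := Module.finrank_pos (R := ℝ) (M := E)
  have h1 : IntegrableOn (fun y : ℝ => y ^ ((Module.finrank ℝ E : ℝ) - 1 + a)) (Set.Ioo 0 r) := by
    rw [intervalIntegral.integrableOn_Ioo_rpow_iff hr]; linarith
  refine h1.congr_fun (fun y hy => ?_) measurableSet_Ioo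
  have : ((Module.finrank ℝ E - 1 : ℕ) : ℝ) = (Module.finrank ℝ E : ℝ) - 1 := by
    push_cast [Nat.cast_sub h]; ring
  simp only [smul_eq_mul]
  rw [Real.rpow_add hy.1, ← this, Real.rpow_natCast]

lemma integrableOn_compl_ball_norm_rpow {E : Type*} [NormedAddCommGroup E] [NormedSpace ℝ E]
    [FiniteDimensional ℝ E] [MeasurableSpace E] [BorelSpace E] [Nontrivial E] (μ : Measure E)
    [μ.IsAddHaarMeasure] {a : ℝ} (ha : a < -(Module.finrank ℝ E : ℝ)) {r : ℝ} (hr : 0 < r) :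
    IntegrableOn (fun x : E => ‖x‖ ^ a) (Metric.ball 0 r)ᶜ μ := by
  have h := Module.finrank_pos (R := ℝ) (M := E)
  have h1 : IntegrableOn (fun y : ℝ => y ^ ((Module.finrank ℝ E : ℝ) - 1 + a)) (Set.Ici r) := by
    rw [integrableOn_Ici_iff_integrableOn_Ioi]
    exact integrableOn_Ioi_rpow_of_lt (by linarith) hr
  rw [← integrable_indicator_iff Metric.isOpen_ball.measurableSet.compl]
  have h2 : (Metric.ball (0 : E) r)ᶜ.indicator (fun x : E => ‖x‖ ^ a)
      = fun x => (Set.Ici r).indicator (fun t : ℝ => t ^ a) ‖x‖ := by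
    ext x
    by_cases hx : r ≤ ‖x‖ <;> simp [Set.indicator, hx]
  rw [h2, integrable_fun_norm_addHaar]
  have : ((Module.finrank ℝ E - 1 : ℕ) : ℝ) = (Module.finrank ℝ E : ℝ) - 1 := by
    push_cast [Nat.cast_sub h]; ring
  rw [← integrable_indicator_iff measurableSet_Ici] at h1
  refine h1.integrableOn.congr_fun (fun y hy => ?_) measurableSet_Ioi
  by_cases hyr : r ≤ y
  · simp only [Set.indicator, Set.mem_Ici, hyr, if_true, smul_eq_mul]
    rw [Real.rpow_add hy, ← this, Real.rpow_natCast]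
  · simp [Set.indicator, hyr]

section Kernel
variable {E G : Type*} [NormedAddCommGroup E] [NormedSpace ℝ E] [NormedAddCommGroup G]
  [NormedSpace ℝ G]

lemma hasDerivAt_iteratedFDeriv_line {f : E → G} {z v : E} {s : ℝ} (j : ℕ)
    (hf : ContDiffAt ℝ (j + 1 : ℕ) f (z + s • v)) :
    HasDerivAt (fun s : ℝ => iteratedFDeriv ℝ j f (z + s • v) (fun _ => v))
      (iteratedFDeriv ℝ (j + 1) f (z + s • v) (fun _ => v)) s := by
  have h1 : DifferentiableAt ℝ (iteratedFDeriv ℝ j f) (z + s • v) :=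
    hf.differentiableAt_iteratedFDeriv (by exact_mod_cast j.lt_succ_self)
  have h2 : HasDerivAt (fun s : ℝ => z + s • v) v s := by
    simpa using ((hasDerivAt_id s).smul_const v).const_add z
  have h3 := h1.hasFDerivAt.comp_hasDerivAt s h2
  have h4 := (ContinuousMultilinearMap.apply ℝ (fun _ : Fin j => E) G
    (fun _ => v)).hasFDerivAt.comp_hasDerivAt s h3
  convert h4 using 1
  · rfl
  · rw [iteratedFDeriv_succ_apply_left]; rfl

lemma iteratedDerivWithin_line {f : E → G} {z v : E} (j : ℕ)
    (hf : ∀ s ∈ Set.Icc (0 : ℝ) 1, ContDiffAt ℝ (j : ℕ) f (z + s • v)) :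
    ∀ s ∈ Set.Icc (0 : ℝ) 1, iteratedDerivWithin j (fun s : ℝ => f (z + s • v)) (Set.Icc 0 1) s
      = iteratedFDeriv ℝ j f (z + s • v) (fun _ => v) := by
  induction j with
  | zero => intro s _; simp
  | succ j ih =>
    intro s hs
    rw [iteratedDerivWithin_succ]
    rw [derivWithin_congr (f := fun s : ℝ => iteratedFDeriv ℝ j f (z + s • v) (fun _ => v))
      (fun t ht => ih (fun s hs => (hf s hs).of_le (by exact_mod_cast j.le_succ)) t ht)
      (ih (fun s hs => (hf s hs).of_le (by exact_mod_cast j.le_succ)) s hs)]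
    exact (hasDerivAt_iteratedFDeriv_line j (hf s hs)).hasDerivWithinAt.derivWithin
      (uniqueDiffOn_Icc zero_lt_one s hs)

/-- Taylor's formula along a segment, with a bound on the remainder. -/
lemma norm_sub_taylor_le {f : E → G} {z v : E} (m : ℕ) {M : ℝ}
    (hf : ∀ s ∈ Set.Icc (0 : ℝ) 1, ContDiffAt ℝ (m + 1 : ℕ) f (z + s • v))
    (hM : ∀ s ∈ Set.Icc (0 : ℝ) 1, ‖iteratedFDeriv ℝ (m + 1) f (z + s • v)‖ ≤ M) :
    ‖f (z + v) - ∑ j ∈ Finset.range (m + 1), ((j.factorial : ℝ)⁻¹) •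
      iteratedFDeriv ℝ j f z (fun _ => v)‖ ≤ M * ‖v‖ ^ (m + 1) := by
  have hcd : ContDiffOn ℝ (m + 1) (fun s : ℝ => f (z + s • v)) (Set.Icc 0 1) := by
    intro s hs
    have h1 : ContDiffAt ℝ (m + 1 : ℕ) (fun s : ℝ => z + s • v) s := by fun_prop
    exact_mod_cast ((hf s hs).comp s h1).contDiffWithinAt
  have hb : ∀ s ∈ Set.Icc (0 : ℝ) 1,
      ‖iteratedDerivWithin (m + 1) (fun s : ℝ => f (z + s • v)) (Set.Icc 0 1) s‖
        ≤ M * ‖v‖ ^ (m + 1) := by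
    intro s hs
    rw [iteratedDerivWithin_line (m + 1) hf s hs]
    refine (ContinuousMultilinearMap.le_opNorm _ _).trans ?_
    simp only [Finset.prod_const, Finset.card_univ, Fintype.card_fin]
    gcongr
    exact hM s hs
  have h := taylor_mean_remainder_bound zero_le_one hcd (Set.right_mem_Icc.2 zero_le_one) hb
  rw [taylor_within_apply] at h
  simp only [sub_zero, one_pow, mul_one, one_smul] at h
  have e : ∀ j ∈ Finset.range (m + 1), ((j.factorial : ℝ)⁻¹) •
      iteratedDerivWithin j (fun s : ℝ => f (z + s • v)) (Set.Icc 0 1) 0 =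
      ((j.factorial : ℝ)⁻¹) • iteratedFDeriv ℝ j f z (fun _ => v) := by
    intro j hj
    rw [iteratedDerivWithin_line j (fun s hs => (hf s hs).of_le (by
      exact_mod_cast (Finset.mem_range.1 hj).le)) 0 (by simp)]
    simp
  rw [Finset.sum_congr rfl e] at h
  refine h.trans (div_le_self ((norm_nonneg _).trans (hb 0 (by simp))) ?_)
  exact_mod_cast Nat.one_le_iff_ne_zero.2 m.factorial_ne_zero

lemma iteratedFDeriv_of_homogeneous {f : E → G} {a : ℕ}
    (hf : ∀ t : ℝ, 0 < t → ∀ z, f (t • z) = (t ^ a)⁻¹ • f z) (j : ℕ) :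
    ∀ t : ℝ, 0 < t → ∀ z, iteratedFDeriv ℝ j f (t • z)
      = (t ^ (a + j))⁻¹ • iteratedFDeriv ℝ j f z := by
  induction j with
  | zero => intro t ht z; ext; simp [hf t ht]
  | succ j ih =>
    intro t ht z
    have h1 : (fun z => iteratedFDeriv ℝ j f (t • z))
        = (t ^ (a + j))⁻¹ • iteratedFDeriv ℝ j f := by
      ext1 z; exact ih t ht z
    have h2 := fderiv_comp_smul (𝕜 := ℝ) (f := iteratedFDeriv ℝ j f) (c := t) (x := z)
    have h4 : fderiv ℝ ((t ^ (a + j))⁻¹ • iteratedFDeriv ℝ j f)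
        = (t ^ (a + j))⁻¹ • fderiv ℝ (iteratedFDeriv ℝ j f) := by
      have h5 := fderiv_const_smul_field (𝕜 := ℝ) (R := ℝ) (f := iteratedFDeriv ℝ j f)
        (t ^ (a + j))⁻¹
      convert h5
    rw [h1, h4, Pi.smul_apply] at h2
    have h3 : fderiv ℝ (iteratedFDeriv ℝ j f) (t • z) = (t ^ (a + (j + 1)))⁻¹ •
        fderiv ℝ (iteratedFDeriv ℝ j f) z := by
      rw [← add_assoc, pow_succ, mul_inv, mul_comm, mul_smul]
      rw [eq_inv_smul_iff₀ ht.ne']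
      exact h2.symm
    ext v
    rw [iteratedFDeriv_succ_apply_left, h3]
    rfl

lemma exists_norm_iteratedFDeriv_le [FiniteDimensional ℝ E] {f : E → G} {a : ℕ}
    (hf : ∀ t : ℝ, 0 < t → ∀ z, f (t • z) = (t ^ a)⁻¹ • f z)
    (hs : ContDiffOn ℝ (⊤ : ℕ∞) f {0}ᶜ) (j : ℕ) :
    ∃ C, 0 ≤ C ∧ ∀ z, z ≠ 0 → ‖iteratedFDeriv ℝ j f z‖ ≤ C * (‖z‖ ^ (a + j))⁻¹ := by
  have hc : ContinuousOn (iteratedFDeriv ℝ j f) {0}ᶜ := by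
    intro z hz
    have : ContDiffAt ℝ (⊤ : ℕ∞) f z := hs.contDiffAt (isOpen_compl_singleton.mem_nhds hz)
    exact (this.continuousAt_iteratedFDeriv (by exact_mod_cast le_top)).continuousWithinAt
  have hsub : Metric.sphere (0 : E) 1 ⊆ {0}ᶜ := by
    intro z hz h0
    rw [Set.mem_singleton_iff] at h0
    simp [h0] at hz
  obtain ⟨C, hC⟩ := (isCompact_sphere (0 : E) 1).exists_bound_of_continuousOn (hc.mono hsub)
  refine ⟨max C 0, le_max_right _ _, fun z hz => ?_⟩
  have hz' : 0 < ‖z‖ := norm_pos_iff.2 hz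
  have h1 : z = ‖z‖ • (‖z‖⁻¹ • z) := by rw [smul_inv_smul₀ hz'.ne']
  have h2 := iteratedFDeriv_of_homogeneous hf j ‖z‖ hz' (‖z‖⁻¹ • z)
  rw [← h1] at h2
  rw [h2, norm_smul, norm_inv, norm_pow, norm_norm, mul_comm]
  gcongr
  exact (hC _ (by simp [norm_smul, hz'.ne'])).trans (le_max_left _ _)

end Kernel

section TaylorRemainder
variable {E G : Type*} [NormedAddCommGroup E] [NormedSpace ℝ E] [NormedAddCommGroup G]
  [NormedSpace ℝ G]

/-- The degree `j` Taylor term of `x ↦ K (y - x)` at `x = 0`. -/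
noncomputable def taylorTerm (K : E → G) (j : ℕ) (x y : E) : G :=
  ((j.factorial : ℝ)⁻¹) • iteratedFDeriv ℝ j K y (fun _ => -x)

/-- The remainder of the degree `m` Taylor expansion of `x ↦ K (y - x)` at `x = 0`. -/
noncomputable def taylorRemainder (K : E → G) (m : ℕ) (x y : E) : G :=
  K (y - x) - ∑ j ∈ Finset.range (m + 1), taylorTerm K j x y

lemma taylorTerm_smul_smul {K : E → G} {a : ℕ}
    (hK : ∀ t : ℝ, 0 < t → ∀ z, K (t • z) = (t ^ a)⁻¹ • K z) (j : ℕ) {t : ℝ} (ht : 0 < t)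
    (x y : E) : taylorTerm K j (t • x) (t • y) = (t ^ a)⁻¹ • taylorTerm K j x y := by
  unfold taylorTerm
  rw [iteratedFDeriv_of_homogeneous hK j t ht]
  have : (fun _ : Fin j => -(t • x)) = fun i =>
      (fun _ : Fin j => t) i • (fun _ : Fin j => -x) i := by
    ext1 i; simp
  rw [this, ContinuousMultilinearMap.map_smul_univ]
  simp only [smul_apply, Finset.prod_const, Finset.card_univ, Fintype.card_fin,
    smul_smul]
  congr 1
  rw [pow_add]
  field_simp

lemma taylorRemainder_smul_smul {K : E → G} {a : ℕ}
    (hK : ∀ t : ℝ, 0 < t → ∀ z, K (t • z) = (t ^ a)⁻¹ • K z) (m : ℕ) {t : ℝ} (ht : 0 < t)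
    (x y : E) : taylorRemainder K m (t • x) (t • y) = (t ^ a)⁻¹ • taylorRemainder K m x y := by
  unfold taylorRemainder
  rw [← smul_sub, hK t ht, smul_sub, Finset.smul_sum]
  simp_rw [taylorTerm_smul_smul hK _ ht]

lemma taylorRemainder_zero (K : E → G) (m : ℕ) (y : E) : taylorRemainder K m 0 y = 0 := by
  unfold taylorRemainder taylorTerm
  rw [Finset.sum_range_succ', Finset.sum_eq_zero]
  · simp
  · intro j _
    have : iteratedFDeriv ℝ (j + 1) K y (fun _ => -(0 : E)) = 0 :=
      ContinuousMultilinearMap.map_coord_zero _ 0 (by simp)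
    rw [this, smul_zero]

lemma norm_taylorTerm_le {K : E → G} (j : ℕ) (x y : E) :
    ‖taylorTerm K j x y‖ ≤ ‖iteratedFDeriv ℝ j K y‖ * ‖x‖ ^ j := by
  unfold taylorTerm
  rw [norm_smul]
  have h1 : ‖((j.factorial : ℝ)⁻¹)‖ ≤ 1 := by
    rw [norm_inv, Real.norm_natCast]
    exact inv_le_one_of_one_le₀ (by exact_mod_cast Nat.one_le_iff_ne_zero.2 j.factorial_ne_zero)
  have h2 := ContinuousMultilinearMap.le_opNorm (iteratedFDeriv ℝ j K y) (fun _ => -x)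
  simp only [norm_neg, Finset.prod_const, Finset.card_univ, Fintype.card_fin] at h2
  calc _ ≤ 1 * _ := mul_le_mul_of_nonneg_right h1 (norm_nonneg _)
    _ ≤ _ := by rw [one_mul]; exact h2

lemma norm_taylorRemainder_le_of_far [FiniteDimensional ℝ E] {K : E → G} {a : ℕ}
    (hK : ∀ t : ℝ, 0 < t → ∀ z, K (t • z) = (t ^ a)⁻¹ • K z)
    (hs : ContDiffOn ℝ (⊤ : ℕ∞) K {0}ᶜ) (m : ℕ) : ∃ C, 0 ≤ C ∧ ∀ x y : E, ‖x‖ = 1 → 2 ≤ ‖y‖ →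
      ‖taylorRemainder K m x y‖ ≤ C * (‖y‖ ^ (a + (m + 1)))⁻¹ := by
  obtain ⟨C, hC0, hC⟩ := exists_norm_iteratedFDeriv_le hK hs (m + 1)
  refine ⟨C * 2 ^ (a + (m + 1)), by positivity, fun x y hx hy => ?_⟩
  have hlow : ∀ s ∈ Set.Icc (0 : ℝ) 1, ‖y‖ / 2 ≤ ‖y + s • (-x)‖ := by
    intro s hs
    have h1 : ‖s • (-x)‖ ≤ 1 := by
      rw [norm_smul, norm_neg, hx, mul_one, Real.norm_of_nonneg hs.1]; exact hs.2
    have h2 := norm_sub_le_norm_add y (s • (-x))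
    linarith
  have hne : ∀ s ∈ Set.Icc (0 : ℝ) 1, y + s • (-x) ≠ 0 := fun s hs =>
    norm_pos_iff.1 (lt_of_lt_of_le (by linarith) (hlow s hs))
  have h := norm_sub_taylor_le (f := K) (z := y) (v := -x) m
    (M := C * 2 ^ (a + (m + 1)) * (‖y‖ ^ (a + (m + 1)))⁻¹)
    (fun s hs' => (hs.contDiffAt (isOpen_compl_singleton.mem_nhds (hne s hs'))).of_le
      (by exact_mod_cast le_top)) (fun s hs' => by
      refine (hC _ (hne s hs')).trans ?_
      rw [mul_assoc]
      gcongr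
      rw [← div_eq_mul_inv, ← inv_div, ← div_pow]
      gcongr
      exact hlow s hs')
  simpa [taylorRemainder, taylorTerm, sub_eq_add_neg, hx] using h

lemma norm_taylorRemainder_le_of_near [FiniteDimensional ℝ E] {K : E → G} {a : ℕ}
    (hK : ∀ t : ℝ, 0 < t → ∀ z, K (t • z) = (t ^ a)⁻¹ • K z)
    (hs : ContDiffOn ℝ (⊤ : ℕ∞) K {0}ᶜ) (m : ℕ) : ∃ C, 0 ≤ C ∧ ∀ x y : E, ‖x‖ = 1 → ‖y‖ < 2 →
      y ≠ 0 → y ≠ x →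
      ‖taylorRemainder K m x y‖ ≤ C * (‖y - x‖ ^ a)⁻¹ + C * (‖y‖ ^ (a + m))⁻¹ := by
  choose C hC0 hC using exists_norm_iteratedFDeriv_le hK hs
  refine ⟨C 0 + ∑ j ∈ Finset.range (m + 1), C j * 2 ^ m, ?_, fun x y hx hy hy0 hyx => ?_⟩
  · exact add_nonneg (hC0 0) (Finset.sum_nonneg fun j _ => mul_nonneg (hC0 j) (by positivity))
  have hyp : 0 < ‖y‖ := norm_pos_iff.2 hy0
  have hnn : 0 ≤ ∑ j ∈ Finset.range (m + 1), C j * 2 ^ m :=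
    Finset.sum_nonneg fun j _ => mul_nonneg (hC0 j) (by positivity)
  unfold taylorRemainder
  refine (norm_sub_le _ _).trans (add_le_add ?_ ?_)
  · have h := hC 0 (y - x) (sub_ne_zero.2 hyx)
    rw [norm_iteratedFDeriv_zero, add_zero] at h
    refine h.trans ?_
    gcongr
    linarith
  · refine (norm_sum_le _ _).trans ?_
    have : ∀ j ∈ Finset.range (m + 1), ‖taylorTerm K j x y‖
        ≤ C j * 2 ^ m * (‖y‖ ^ (a + m))⁻¹ := by
      intro j hj
      have hjm : j ≤ m := Nat.lt_succ_iff.1 (Finset.mem_range.1 hj)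
      refine (norm_taylorTerm_le j x y).trans ?_
      rw [hx, one_pow, mul_one]
      refine (hC j y hy0).trans ?_
      rw [mul_assoc]
      refine mul_le_mul_of_nonneg_left ?_ (hC0 j)
      obtain ⟨i, rfl⟩ := Nat.exists_eq_add_of_le hjm
      have e : (‖y‖ ^ (a + j))⁻¹ = ‖y‖ ^ i * (‖y‖ ^ (a + (j + i)))⁻¹ := by
        rw [← add_assoc, pow_add _ (a + j)]; field_simp
      rw [e]
      gcongr
      calc ‖y‖ ^ i ≤ 2 ^ i := by gcongr
        _ ≤ 2 ^ (j + i) := pow_le_pow_right₀ (by norm_num) (by omega)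
    refine (Finset.sum_le_sum this).trans ?_
    rw [← Finset.sum_mul]
    gcongr
    linarith [hC0 0]

lemma continuousOn_iteratedFDeriv_apply {K : E → G}
    (hs : ContDiffOn ℝ (⊤ : ℕ∞) K {0}ᶜ) (j : ℕ) (v : Fin j → E) :
    ContinuousOn (fun y => iteratedFDeriv ℝ j K y v) {0}ᶜ := by
  intro z hz
  have : ContDiffAt ℝ (⊤ : ℕ∞) K z := hs.contDiffAt (isOpen_compl_singleton.mem_nhds hz)
  have h := (this.continuousAt_iteratedFDeriv (k := j) (by exact_mod_cast le_top))
  exact ((ContinuousMultilinearMap.apply ℝ (fun _ : Fin j => E) G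
    v).continuous.continuousAt.comp h).continuousWithinAt

lemma continuousOn_taylorTerm {K : E → G}
    (hs : ContDiffOn ℝ (⊤ : ℕ∞) K {0}ᶜ) (j : ℕ) (x : E) :
    ContinuousOn (taylorTerm K j x) {0}ᶜ :=
  (continuousOn_iteratedFDeriv_apply hs j fun _ => -x).const_smul ((j.factorial : ℝ)⁻¹)

variable [FiniteDimensional ℝ E] [MeasurableSpace E] [BorelSpace E] [Nontrivial E]
  (μ : Measure E) [μ.IsAddHaarMeasure]

omit [NormedSpace ℝ G] in
lemma aestronglyMeasurable_of_continuousOn_compl_zero {f : E → G} (hf : ContinuousOn f {0}ᶜ) :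
    AEStronglyMeasurable f μ := by
  have h := hf.aestronglyMeasurable (μ := μ) isOpen_compl_singleton.measurableSet
  rwa [restrict_compl_singleton] at h

lemma aestronglyMeasurable_taylorTerm {K : E → G}
    (hs : ContDiffOn ℝ (⊤ : ℕ∞) K {0}ᶜ) (j : ℕ) (x : E) :
    AEStronglyMeasurable (taylorTerm K j x) μ :=
  aestronglyMeasurable_of_continuousOn_compl_zero μ (continuousOn_taylorTerm hs j x)

lemma aestronglyMeasurable_taylorRemainder {K : E → G}
    (hs : ContDiffOn ℝ (⊤ : ℕ∞) K {0}ᶜ) (m : ℕ) (x : E) :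
    AEStronglyMeasurable (taylorRemainder K m x) μ := by
  have h1 : AEStronglyMeasurable (fun y => K (y - x)) μ :=
    (aestronglyMeasurable_of_continuousOn_compl_zero μ hs.continuousOn).comp_measurePreserving
      (measurePreserving_sub_right μ x)
  exact h1.sub (Finset.aestronglyMeasurable_fun_sum _
    fun j _ => aestronglyMeasurable_taylorTerm μ hs j x)

/-- The weighted integrability of the Taylor remainder of a kernel of degree `1 - n`, with a bound
that is uniform over the unit sphere. -/
lemma integral_taylorRemainder_unit_le {K : E → G} {a : ℕ} (ha : Module.finrank ℝ E = a + 1)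
    (hK : ∀ t : ℝ, 0 < t → ∀ z, K (t • z) = (t ^ a)⁻¹ • K z)
    (hs : ContDiffOn ℝ (⊤ : ℕ∞) K {0}ᶜ) (m : ℕ) {δ : ℝ} (hδ : δ ∈ Set.Ioo (0 : ℝ) 1) :
    ∃ C, 0 ≤ C ∧ ∀ x : E, ‖x‖ = 1 →
      Integrable (fun y => ‖taylorRemainder K m x y‖ * ‖y‖ ^ ((m : ℝ) - 1 + δ)) μ ∧
      ∫ y, ‖taylorRemainder K m x y‖ * ‖y‖ ^ ((m : ℝ) - 1 + δ) ∂μ ≤ C := by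
  obtain ⟨C₁, hC₁, h₁⟩ := norm_taylorRemainder_le_of_far hK hs m
  obtain ⟨C₂, hC₂, h₂⟩ := norm_taylorRemainder_le_of_near hK hs m
  obtain ⟨hδ0, hδ1⟩ := hδ
  have haR : (Module.finrank ℝ E : ℝ) = a + 1 := by rw [ha]; push_cast; ring
  set p1 : E → ℝ := (Metric.ball (0 : E) 3).indicator fun z => ‖z‖ ^ (-(a : ℝ)) with hp1
  set p2 : E → ℝ := (Metric.ball (0 : E) 2).indicator fun z => ‖z‖ ^ (-(a : ℝ) - 1 + δ) with hp2
  set p3 : E → ℝ := (Metric.ball (0 : E) 2)ᶜ.indicator fun z => ‖z‖ ^ (-(a : ℝ) - 2 + δ) with hp3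
  have i1 : Integrable p1 μ := (integrable_indicator_iff Metric.isOpen_ball.measurableSet).2
    (integrableOn_ball_norm_rpow μ (by rw [haR]; linarith) (by norm_num))
  have i2 : Integrable p2 μ := (integrable_indicator_iff Metric.isOpen_ball.measurableSet).2
    (integrableOn_ball_norm_rpow μ (by rw [haR]; linarith) (by norm_num))
  have i3 : Integrable p3 μ := (integrable_indicator_iff
    Metric.isOpen_ball.measurableSet.compl).2
    (integrableOn_compl_ball_norm_rpow μ (by rw [haR]; linarith) (by norm_num))
  have n1 : ∀ z, 0 ≤ p1 z := fun z => Set.indicator_nonneg (fun _ _ => by positivity) z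
  have n2 : ∀ z, 0 ≤ p2 z := fun z => Set.indicator_nonneg (fun _ _ => by positivity) z
  have n3 : ∀ z, 0 ≤ p3 z := fun z => Set.indicator_nonneg (fun _ _ => by positivity) z
  set A : ℝ := C₂ * 2 ^ (m + 2) with hA
  set B : ℝ := C₂ * (2 ^ a * 2 ^ (m + a)) + C₂ with hB
  have hA0 : 0 ≤ A := by positivity
  have hB0 : 0 ≤ B := by positivity
  have key : ∀ x y : E, ‖x‖ = 1 → y ≠ 0 → y ≠ x →
      ‖taylorRemainder K m x y‖ * ‖y‖ ^ ((m : ℝ) - 1 + δ)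
        ≤ A * p1 (y - x) + B * p2 y + C₁ * p3 y := by
    intro x y hx hy0 hyx
    have hyp : 0 < ‖y‖ := norm_pos_iff.2 hy0
    have hyxp : 0 < ‖y - x‖ := norm_pos_iff.2 (sub_ne_zero.2 hyx)
    rcases lt_or_ge ‖y‖ 2 with hy | hy
    · have e2 : p2 y = ‖y‖ ^ (-(a : ℝ) - 1 + δ) := by simp [hp2, hy]
      have e3 : p3 y = 0 := by simp [hp3, hy]
      have e1 : p1 (y - x) = (‖y - x‖ ^ a)⁻¹ := by
        have : ‖y - x‖ < 3 := (norm_sub_le y x).trans_lt (by rw [hx]; linarith)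
        simp only [hp1, Set.indicator, mem_ball_zero_iff, this, if_true]
        rw [Real.rpow_neg (norm_nonneg _), Real.rpow_natCast]
      have hb := h₂ x y hx hy hy0 hyx
      have s2 : (‖y‖ ^ (a + m))⁻¹ * ‖y‖ ^ ((m : ℝ) - 1 + δ) = p2 y := by
        rw [e2, ← Real.rpow_natCast, ← Real.rpow_neg hyp.le, ← Real.rpow_add hyp]
        congr 1; push_cast; ring
      have s1 : (‖y - x‖ ^ a)⁻¹ * ‖y‖ ^ ((m : ℝ) - 1 + δ)
          ≤ 2 ^ (m + 2) * p1 (y - x) + 2 ^ a * 2 ^ (m + a) * p2 y := by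
        rcases le_or_gt (1 / 2) ‖y‖ with hy2 | hy2
        · have : ‖y‖ ^ ((m : ℝ) - 1 + δ) ≤ 2 ^ (m + 2) := by
            have e : ‖y‖ ^ ((m : ℝ) - 1 + δ) = ‖y‖ ^ ((m : ℝ) + δ) * ‖y‖⁻¹ := by
              rw [← Real.rpow_neg_one, ← Real.rpow_add hyp]; congr 1; ring
            have b1 : ‖y‖ ^ ((m : ℝ) + δ) ≤ 2 ^ (m + 1) := by
              calc ‖y‖ ^ ((m : ℝ) + δ) ≤ 2 ^ ((m : ℝ) + δ) := by gcongr
                _ ≤ 2 ^ ((m : ℝ) + 1) := by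
                  apply Real.rpow_le_rpow_of_exponent_le <;> linarith
                _ = 2 ^ (m + 1) := by rw [← Real.rpow_natCast]; push_cast; rfl
            have b2 : ‖y‖⁻¹ ≤ 2 := by
              rw [inv_le_comm₀ hyp (by norm_num)]; linarith
            rw [e, pow_succ 2 (m + 1)]
            gcongr
          have h0 : 0 ≤ 2 ^ a * 2 ^ (m + a) * p2 y := mul_nonneg (by positivity) (n2 y)
          rw [e1, mul_comm]
          have := mul_le_mul_of_nonneg_right this (inv_nonneg.2 (pow_nonneg hyxp.le a))
          linarith
        · have b1 : (‖y - x‖ ^ a)⁻¹ ≤ 2 ^ a := by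
            rw [← inv_pow]
            gcongr
            rw [inv_le_comm₀ hyxp (by norm_num)]
            have := norm_sub_norm_le x y
            rw [hx, norm_sub_rev] at this
            linarith
          have b2 : ‖y‖ ^ ((m : ℝ) - 1 + δ) ≤ 2 ^ (m + a) * p2 y := by
            have e : ‖y‖ ^ ((m : ℝ) - 1 + δ) = ‖y‖ ^ (m + a) * p2 y := by
              rw [e2, ← Real.rpow_natCast, ← Real.rpow_add hyp]; congr 1; push_cast; ring
            rw [e]
            gcongr
            exact n2 y
          have h0 : 0 ≤ 2 ^ (m + 2) * p1 (y - x) := mul_nonneg (by positivity) (n1 _)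
          have := mul_le_mul b1 b2 (by positivity) (by positivity)
          linarith
      calc _ ≤ (C₂ * (‖y - x‖ ^ a)⁻¹ + C₂ * (‖y‖ ^ (a + m))⁻¹) * ‖y‖ ^ ((m : ℝ) - 1 + δ) := by
            gcongr
        _ = C₂ * ((‖y - x‖ ^ a)⁻¹ * ‖y‖ ^ ((m : ℝ) - 1 + δ)) +
            C₂ * ((‖y‖ ^ (a + m))⁻¹ * ‖y‖ ^ ((m : ℝ) - 1 + δ)) := by ring
        _ ≤ C₂ * (2 ^ (m + 2) * p1 (y - x) + 2 ^ a * 2 ^ (m + a) * p2 y) + C₂ * p2 y := by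
            rw [s2]; gcongr
        _ = _ := by rw [e3, hA, hB]; ring
    · have e3 : p3 y = ‖y‖ ^ (-(a : ℝ) - 2 + δ) := by simp [hp3, hy]
      have s : (‖y‖ ^ (a + (m + 1)))⁻¹ * ‖y‖ ^ ((m : ℝ) - 1 + δ) = p3 y := by
        rw [e3, ← Real.rpow_natCast, ← Real.rpow_neg hyp.le, ← Real.rpow_add hyp]
        congr 1; push_cast; ring
      have := mul_le_mul_of_nonneg_right (h₁ x y hx hy)
        (Real.rpow_nonneg hyp.le ((m : ℝ) - 1 + δ))
      rw [mul_assoc, s] at this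
      have h1 := mul_nonneg hA0 (n1 (y - x))
      have h2 := mul_nonneg hB0 (n2 y)
      linarith
  refine ⟨A * ∫ y, p1 y ∂μ + B * ∫ y, p2 y ∂μ + C₁ * ∫ y, p3 y ∂μ, ?_, fun x hx => ?_⟩
  · have := integral_nonneg (μ := μ) (f := p1) n1
    have := integral_nonneg (μ := μ) (f := p2) n2
    have := integral_nonneg (μ := μ) (f := p3) n3
    positivity
  have i1' : Integrable (fun y => p1 (y - x)) μ := i1.comp_sub_right x
  have iH : Integrable (fun y => A * p1 (y - x) + B * p2 y + C₁ * p3 y) μ :=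
    ((i1'.const_mul A).add (i2.const_mul B)).add (i3.const_mul C₁)
  have hae : ∀ᵐ y ∂μ, ‖taylorRemainder K m x y‖ * ‖y‖ ^ ((m : ℝ) - 1 + δ)
      ≤ A * p1 (y - x) + B * p2 y + C₁ * p3 y := by
    have h0 : ∀ᵐ y ∂μ, y ≠ 0 := by simp [ae_iff, measure_singleton]
    have hx' : ∀ᵐ y ∂μ, y ≠ x := by simp [ae_iff, measure_singleton]
    filter_upwards [h0, hx'] with y a1 a2 using key x y hx a1 a2
  have iL : Integrable (fun y => ‖taylorRemainder K m x y‖ * ‖y‖ ^ ((m : ℝ) - 1 + δ)) μ := by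
    refine iH.mono' ?_ ?_
    · refine (aestronglyMeasurable_taylorRemainder μ hs m x).norm.mul ?_
      exact (measurable_norm.pow_const _).aestronglyMeasurable
    · filter_upwards [hae] with y hy
      rwa [Real.norm_of_nonneg (by positivity)]
  refine ⟨iL, (integral_mono_ae iL iH hae).trans (le_of_eq ?_)⟩
  have j12 : Integrable (fun y => A * p1 (y - x) + B * p2 y) μ :=
    (i1'.const_mul A).add (i2.const_mul B)
  rw [integral_add j12 (i3.const_mul C₁),
    integral_add (i1'.const_mul A) (i2.const_mul B), integral_const_mul, integral_const_mul,
    integral_const_mul, integral_sub_right_eq_self p1 x]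

lemma integral_taylorRemainder_le {K : E → G} {a : ℕ} (ha : Module.finrank ℝ E = a + 1)
    (hK : ∀ t : ℝ, 0 < t → ∀ z, K (t • z) = (t ^ a)⁻¹ • K z)
    (hs : ContDiffOn ℝ (⊤ : ℕ∞) K {0}ᶜ) (m : ℕ) {δ : ℝ} (hδ : δ ∈ Set.Ioo (0 : ℝ) 1) :
    ∃ C, 0 ≤ C ∧ ∀ x : E,
      Integrable (fun y => ‖taylorRemainder K m x y‖ * ‖y‖ ^ ((m : ℝ) - 1 + δ)) μ ∧
      ∫ y, ‖taylorRemainder K m x y‖ * ‖y‖ ^ ((m : ℝ) - 1 + δ) ∂μ ≤ C * ‖x‖ ^ ((m : ℝ) + δ) := by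
  obtain ⟨C, hC0, hC⟩ := integral_taylorRemainder_unit_le μ ha hK hs m hδ
  refine ⟨C, hC0, fun x => ?_⟩
  rcases eq_or_ne x 0 with rfl | hx
  · simp only [taylorRemainder_zero, norm_zero, zero_mul, integral_zero]
    exact ⟨integrable_zero _ _ _, by positivity⟩
  have ht : 0 < ‖x‖ := norm_pos_iff.2 hx
  obtain ⟨h1, h2⟩ := hC (‖x‖⁻¹ • x) (by simp [norm_smul, ht.ne'])
  set f := fun y => ‖taylorRemainder K m x y‖ * ‖y‖ ^ ((m : ℝ) - 1 + δ) with hf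
  set g := fun y => ‖taylorRemainder K m (‖x‖⁻¹ • x) y‖ * ‖y‖ ^ ((m : ℝ) - 1 + δ) with hg
  have hfg : ∀ y, f (‖x‖ • y) = (‖x‖ ^ a)⁻¹ * ‖x‖ ^ ((m : ℝ) - 1 + δ) * g y := by
    intro y
    have : x = ‖x‖ • (‖x‖⁻¹ • x) := by rw [smul_inv_smul₀ ht.ne']
    have e := taylorRemainder_smul_smul hK m ht (‖x‖⁻¹ • x) y
    rw [← this] at e
    simp only [hf, hg]
    rw [e, norm_smul, norm_smul, norm_inv, norm_pow, norm_norm,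
      Real.mul_rpow (norm_nonneg _) (norm_nonneg _)]
    ring
  constructor
  · rw [← integrable_comp_smul_iff μ f ht.ne']
    simp_rw [hfg]
    exact h1.const_mul _
  · have h3 := Measure.integral_comp_smul_of_nonneg μ f ‖x‖ (hR := ht.le)
    simp_rw [hfg] at h3
    rw [integral_const_mul, ha, smul_eq_mul, eq_inv_mul_iff_mul_eq₀ (by positivity)] at h3
    rw [← h3]
    have e : ‖x‖ ^ (a + 1) * ((‖x‖ ^ a)⁻¹ * ‖x‖ ^ ((m : ℝ) - 1 + δ) * ∫ y, g y ∂μ)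
        = (∫ y, g y ∂μ) * ‖x‖ ^ ((m : ℝ) + δ) := by
      have e1 : ‖x‖ ^ ((m : ℝ) + δ) = ‖x‖ * ‖x‖ ^ ((m : ℝ) - 1 + δ) := by
        rw [← Real.rpow_one_add' ht.le]
        · congr 1; ring
        · have : (0 : ℝ) ≤ m := by positivity
          linarith [hδ.1]
      rw [e1, pow_succ]; field_simp
    rw [e]
    gcongr

end TaylorRemainder

section CliffordAction
variable {ι E F : Type*} [Fintype ι] [NormedAddCommGroup E] [InnerProductSpace ℝ E]
  [NormedAddCommGroup F] [NormedSpace ℝ F]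

/-- The contraction `L ↦ Σ_i e_i · L e_i` of a linear map with a Clifford action `c`. -/
noncomputable def cliffordContract (c : E →L[ℝ] F →L[ℝ] F) (b : OrthonormalBasis ι ℝ E)
    (L : E →L[ℝ] F) : F := ∑ i, c (b i) (L (b i))

/-- The Dirac operator of a Clifford action `c`. -/
noncomputable def diracOp (c : E →L[ℝ] F →L[ℝ] F) (b : OrthonormalBasis ι ℝ E) (u : E → F)
    (x : E) : F := cliffordContract c b (fderiv ℝ u x)

variable {c : E →L[ℝ] F →L[ℝ] F} {b : OrthonormalBasis ι ℝ E}

lemma cliffordContract_add (L M : E →L[ℝ] F) :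
    cliffordContract c b (L + M) = cliffordContract c b L + cliffordContract c b M := by
  simp [cliffordContract, Finset.sum_add_distrib]

lemma cliffordContract_smul (t : ℝ) (L : E →L[ℝ] F) :
    cliffordContract c b (t • L) = t • cliffordContract c b L := by
  simp [cliffordContract, Finset.smul_sum]

lemma cliffordContract_innerSL_smulRight (x : E) (v : F) :
    cliffordContract c b ((innerSL ℝ x).smulRight v) = c x v := by
  have : c x v = c (∑ i, inner ℝ (b i) x • b i) v := by rw [b.sum_repr']
  rw [this]
  simp [cliffordContract, real_inner_comm]

lemma continuous_cliffordContract : Continuous (cliffordContract c b) := by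
  unfold cliffordContract
  fun_prop

lemma exists_norm_cliffordContract_le (c : E →L[ℝ] F →L[ℝ] F) (b : OrthonormalBasis ι ℝ E) :
    ∃ C, 0 ≤ C ∧ ∀ L : E →L[ℝ] F, ‖cliffordContract c b L‖ ≤ C * ‖L‖ := by
  refine ⟨∑ _i : ι, ‖c‖, by positivity, fun L => ?_⟩
  unfold cliffordContract
  rw [Finset.sum_mul]
  refine (norm_sum_le _ _).trans (Finset.sum_le_sum fun i _ => ?_)
  calc _ ≤ ‖c‖ * ‖b i‖ * (‖L‖ * ‖b i‖) :=
        (c.le_opNorm₂ _ _).trans (by gcongr; exact L.le_opNorm _)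
    _ = _ := by rw [b.norm_eq_one]; ring

lemma diracOp_smul_of_hasFDerivAt {ρ : E → ℝ} {u : E → F} {s : ℝ} {x : E}
    (hρ : HasFDerivAt ρ (s • innerSL ℝ x) x) (hu : DifferentiableAt ℝ u x) :
    diracOp c b (fun y => ρ y • u y) x = ρ x • diracOp c b u x + s • c x (u x) := by
  have h := (hρ.smul hu.hasFDerivAt).fderiv
  have e : (s • innerSL ℝ x).smulRight (u x) = s • (innerSL ℝ x).smulRight (u x) := by
    ext; simp [smul_smul]
  unfold diracOp
  change cliffordContract c b (fderiv ℝ (ρ • u) x) = _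
  rw [h, cliffordContract_add, cliffordContract_smul, e, cliffordContract_smul,
    cliffordContract_innerSL_smulRight]

lemma clifford_anticomm (hc : ∀ x v, c x (c x v) = -(‖x‖ ^ 2) • v) (x y : E) (v : F) :
    c x (c y v) + c y (c x v) = -(2 * inner ℝ x y) • v := by
  have h := hc (x + y) v
  rw [norm_add_sq_real] at h
  simp only [map_add, add_apply, hc] at h
  have h2 : c x (c y v) + c y (c x v)
    = (-‖x‖ ^ 2 • v + c y (c x v) + (c x (c y v) + -‖y‖ ^ 2 • v)) + ‖x‖ ^ 2 • v + ‖y‖ ^ 2 • v := by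
    module
  rw [h2, h]
  module

lemma clifford_basis_sq (hc : ∀ x v, c x (c x v) = -(‖x‖ ^ 2) • v) (i : ι) (v : F) :
    c (b i) (c (b i) v) = -v := by
  rw [hc, b.norm_eq_one]; simp

lemma continuous_diracOp {u : E → F} (hu : ContDiff ℝ 1 u) : Continuous (diracOp c b u) :=
  continuous_cliffordContract.comp (hu.continuous_fderiv one_ne_zero)

lemma HasCompactSupport.diracOp {u : E → F} (hu : HasCompactSupport u) :
    HasCompactSupport (diracOp c b u) :=
  (hu.fderiv ℝ).comp_left (by simp [cliffordContract])

lemma diracOp_comp_add_left (a : E) (u : E → F) (x : E) :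
    diracOp c b (fun y => u (a + y)) x = diracOp c b u (a + x) := by
  unfold diracOp; rw [fderiv_comp_add_left]

end CliffordAction

section Pompeiu
variable {ι E F : Type*} [Fintype ι] [NormedAddCommGroup E] [InnerProductSpace ℝ E]
  [FiniteDimensional ℝ E] [MeasurableSpace E] [BorelSpace E]
  [NormedAddCommGroup F] [NormedSpace ℝ F]
  {c : E →L[ℝ] F →L[ℝ] F} {b : OrthonormalBasis ι ℝ E}
  (μ : Measure E) [μ.IsAddHaarMeasure]

lemma integral_clifford_diracOp (hc : ∀ x v, c x (c x v) = -(‖x‖ ^ 2) • v) {u : E → F}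
    (hu : ContDiff ℝ 1 u) (hs : HasCompactSupport u) :
    ∫ y, c y (diracOp c b u y) ∂μ = (Module.finrank ℝ E : ℝ) • ∫ y, u y ∂μ := by
  have hfd : Continuous (fderiv ℝ u) := hu.continuous_fderiv one_ne_zero
  have hi : ∀ i, Integrable (fun y => c y (c (b i) (fderiv ℝ u y (b i)))) μ := fun i =>
    Continuous.integrable_of_hasCompactSupport (by fun_prop)
      ((hs.fderiv ℝ).mono' (fun y hy => subset_tsupport _ (by
        contrapose! hy
        simp only [Function.mem_support, ne_eq, not_not] at hy ⊢
        simp [hy])))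
  have hu' : Continuous u := hu.continuous
  have key : ∀ i, ∫ y, c y (c (b i) (fderiv ℝ u y (b i))) ∂μ = ∫ y, u y ∂μ := by
    intro i
    set B : (F →L[ℝ] F) →L[ℝ] F →L[ℝ] F := ContinuousLinearMap.id ℝ _
    set f : E → F →L[ℝ] F := fun y => (c y).comp (c (b i)) with hf
    have hfd : ∀ y, HasFDerivAt f
        (((ContinuousLinearMap.compL ℝ F F F).flip (c (b i))).comp c) y := fun y => by
      exact (((ContinuousLinearMap.compL ℝ F F F).flip (c (b i))).comp c).hasFDerivAt
    have hfe : ∀ y, B (fderiv ℝ f y (b i)) (u y) = - u y := by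
      intro y
      rw [(hfd y).fderiv]
      simp [B, clifford_basis_sq hc]
    have h := integral_bilinear_fderiv_right_eq_neg_left_of_integrable (μ := μ) (f := f) (g := u)
      (v := b i) (B := B) ?_ ?_ ?_ ?_ ?_
    · simp_rw [hfe] at h
      rw [integral_neg, neg_neg] at h
      exact h
    · simp_rw [hfe]
      exact (hu'.integrable_of_hasCompactSupport hs).neg
    · exact hi i
    · refine Continuous.integrable_of_hasCompactSupport (by simp only [B, hf]; fun_prop)
        (hs.mono fun y hy => ?_)
      contrapose! hy
      simp only [Function.mem_support, ne_eq, not_not] at hy ⊢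
      simp [hy]
    · exact fun y _ => (hfd y).differentiableAt
    · exact fun y _ => hu.differentiable one_ne_zero y
  simp only [diracOp, cliffordContract, map_sum]
  rw [integral_finsetSum _ (fun i _ => hi i)]
  simp_rw [key]
  rw [Finset.sum_const, Finset.card_univ, Module.finrank_eq_card_basis b.toBasis,
    Nat.cast_smul_eq_nsmul]

/-- The weight `(1 + |z|²)^(-n/2-1)`, scaled to be an approximate identity. -/
lemma integral_regularized_pompeiu (hc : ∀ x v, c x (c x v) = -(‖x‖ ^ 2) • v) {u : E → F}
    (hu : ContDiff ℝ 1 u) (hs : HasCompactSupport u) {ε : ℝ} (hε : 0 < ε) :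
    ∫ y, (‖y‖ ^ 2 + ε ^ 2) ^ (-(Module.finrank ℝ E : ℝ) / 2) • c y (diracOp c b u y) ∂μ
      = ∫ z, ((Module.finrank ℝ E : ℝ) *
          (1 + ‖z‖ ^ 2) ^ (-((Module.finrank ℝ E : ℝ) + 2) / 2)) • u (ε • z) ∂μ := by
  set d : ℝ := (Module.finrank ℝ E : ℝ) with hd
  have hpos : ∀ y : E, 0 < ‖y‖ ^ 2 + ε ^ 2 := fun y => by positivity
  set ρ : E → ℝ := fun y => (‖y‖ ^ 2 + ε ^ 2) ^ (-d / 2) with hρ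
  set σ : E → ℝ := fun y => (‖y‖ ^ 2 + ε ^ 2) ^ (-(d + 2) / 2) with hσ
  have hσρ : ∀ y, ρ y = (‖y‖ ^ 2 + ε ^ 2) * σ y := by
    intro y
    simp only [hρ, hσ]
    rw [show -d / 2 = 1 + -(d + 2) / 2 by ring, Real.rpow_add (hpos y), Real.rpow_one]
  have hσc : Continuous σ := by
    simp only [hσ]
    exact Continuous.rpow_const (by fun_prop) (fun y => Or.inl (hpos y).ne')
  have hρs : ContDiff ℝ 1 ρ := by
    simp only [hρ]
    exact ContDiff.rpow_const_of_ne ((contDiff_norm_sq ℝ).add contDiff_const)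
      (fun y => (hpos y).ne')
  have hρd : ∀ y, HasFDerivAt ρ ((-d * σ y) • innerSL ℝ y) y := by
    intro y
    have h1 : HasFDerivAt (fun y : E => ‖y‖ ^ 2 + ε ^ 2) (2 • (innerSL ℝ) y) y :=
      (hasStrictFDerivAt_norm_sq y).hasFDerivAt.add_const _
    have h2 := h1.rpow_const (p := -d / 2) (Or.inl (hpos y).ne')
    convert h2 using 1
    rw [two_nsmul, ← two_smul ℝ, smul_smul]
    congr 1
    simp only [hσ]
    rw [show -(d + 2) / 2 = -d / 2 - 1 by ring]
    ring
  have hUs : HasCompactSupport (fun y => ρ y • u y) := hs.smul_left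
  have h0 := integral_clifford_diracOp (b := b) (u := fun y => ρ y • u y) μ hc (hρs.smul hu) hUs
  have huc := hu.continuous
  have hDc : Continuous (diracOp c b u) := continuous_diracOp hu
  have hDs : HasCompactSupport (diracOp c b u) := hs.diracOp
  have i1 : Integrable (fun y => ρ y • c y (diracOp c b u y)) μ := by
    refine Continuous.integrable_of_hasCompactSupport ?_ (hDs.mono fun y hy => ?_)
    · have := hρs.continuous
      fun_prop
    · contrapose! hy
      simp only [Function.mem_support, ne_eq, not_not] at hy ⊢
      simp [hy]
  have i2 : Integrable (fun y => (d * σ y * ‖y‖ ^ 2) • u y) μ :=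
    Continuous.integrable_of_hasCompactSupport (by fun_prop) hs.smul_left
  have i3 : Integrable (fun y => (d * ρ y) • u y) μ := by
    have := hρs.continuous
    exact Continuous.integrable_of_hasCompactSupport (by fun_prop) hs.smul_left
  have e1 : ∀ y, c y (diracOp c b (fun y => ρ y • u y) y)
      = ρ y • c y (diracOp c b u y) + (d * σ y * ‖y‖ ^ 2) • u y := by
    intro y
    rw [diracOp_smul_of_hasFDerivAt (hρd y) (hu.differentiable one_ne_zero y), map_add, map_smul,
      map_smul, hc, smul_smul]
    congr 2
    ring
  have e2 : ∫ y, ρ y • c y (diracOp c b u y) ∂μ = ∫ y, (d * ε ^ 2 * σ y) • u y ∂μ := by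
    simp_rw [e1] at h0
    rw [integral_add i1 i2] at h0
    have h1 : d • ∫ y, ρ y • u y ∂μ = ∫ y, (d * ρ y) • u y ∂μ := by
      simp_rw [mul_smul]; exact (integral_smul _ _).symm
    rw [h1] at h0
    rw [eq_sub_of_add_eq h0, ← integral_sub i3 i2]
    congr 1 with y
    rw [← sub_smul, hσρ]
    congr 1
    ring
  have e3 := Measure.integral_comp_smul_of_nonneg μ (fun y => (d * ε ^ 2 * σ y) • u y) ε
    (hR := hε.le)
  rw [e2]
  rw [eq_inv_smul_iff₀ (by positivity)] at e3
  rw [← e3, ← integral_smul]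
  congr 1 with z
  rw [smul_smul]
  congr 1
  simp only [hσ]
  have : ‖ε • z‖ ^ 2 + ε ^ 2 = ε ^ 2 * (1 + ‖z‖ ^ 2) := by
    rw [norm_smul, Real.norm_of_nonneg hε.le]; ring
  rw [this, Real.mul_rpow (by positivity) (by positivity)]
  have h4 : (ε ^ 2) ^ (-(d + 2) / 2) * (ε ^ Module.finrank ℝ E * ε ^ 2) = 1 := by
    rw [← pow_add, ← Real.rpow_natCast, ← Real.rpow_natCast, ← Real.rpow_mul hε.le,
      ← Real.rpow_add hε]
    rw [← Real.rpow_zero ε]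
    congr 1
    push_cast
    rw [← hd]
    ring
  linear_combination (d * (1 + ‖z‖ ^ 2) ^ (-(d + 2) / 2)) * h4

/-- The normalizing constant of the fundamental solution. -/
noncomputable def pompeiuConst : ℝ :=
  ∫ z, (Module.finrank ℝ E : ℝ) * (1 + ‖z‖ ^ 2) ^ (-((Module.finrank ℝ E : ℝ) + 2) / 2) ∂μ

lemma integrable_pompeiuConst : Integrable (fun z : E => (Module.finrank ℝ E : ℝ) *
    (1 + ‖z‖ ^ 2) ^ (-((Module.finrank ℝ E : ℝ) + 2) / 2)) μ :=
  (integrable_rpow_neg_one_add_norm_sq (by linarith)).const_mul _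

lemma pompeiuConst_pos [Nontrivial E] : 0 < pompeiuConst μ := by
  have hd : 0 < (Module.finrank ℝ E : ℝ) := by exact_mod_cast Module.finrank_pos
  refine (integral_pos_iff_support_of_nonneg (fun z => ?_) (integrable_pompeiuConst μ)).2 ?_
  · positivity
  · have : (Function.support fun z : E => (Module.finrank ℝ E : ℝ) *
      (1 + ‖z‖ ^ 2) ^ (-((Module.finrank ℝ E : ℝ) + 2) / 2)) = Set.univ := by
      ext z
      simp only [Function.mem_support, Set.mem_univ, iff_true]
      positivity
    rw [this]
    exact Measure.measure_univ_pos.2 (NeZero.ne μ)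

/-- The Dirac kernel `z ↦ z / |z|ⁿ`. -/
noncomputable def diracKernel (c : E →L[ℝ] F →L[ℝ] F) (z : E) : F →L[ℝ] F :=
  (‖z‖ ^ Module.finrank ℝ E)⁻¹ • c z

lemma pompeiu_zero [Nontrivial E] [CompleteSpace F]
    (hc : ∀ x v, c x (c x v) = -(‖x‖ ^ 2) • v) {u : E → F}
    (hu : ContDiff ℝ 1 u) (hs : HasCompactSupport u) :
    pompeiuConst μ • u 0 = ∫ y, diracKernel c y (diracOp c b u y) ∂μ := by
  set d : ℝ := (Module.finrank ℝ E : ℝ) with hd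
  have hd0 : 0 ≤ d := by positivity
  have huc := hu.continuous
  have hDc : Continuous (diracOp c b u) := continuous_diracOp hu
  have hDs : HasCompactSupport (diracOp c b u) := hs.diracOp
  obtain ⟨M, hM⟩ := hs.exists_bound_of_continuous huc
  obtain ⟨M', hM'⟩ := hDs.exists_bound_of_continuous hDc
  have hM0 : 0 ≤ M' := (norm_nonneg _).trans (hM' 0)
  obtain ⟨R, hR0, hR⟩ := hDs.isCompact.isBounded.subset_ball_lt 0 0
  have hε : ∀ k : ℕ, 0 < 1 / ((k : ℝ) + 1) := fun k => by positivity
  have hlim : Filter.Tendsto (fun k : ℕ => 1 / ((k : ℝ) + 1)) Filter.atTop (nhds 0) :=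
    tendsto_one_div_add_atTop_nhds_zero_nat
  have t1 : Filter.Tendsto (fun k : ℕ => ∫ z, (d * (1 + ‖z‖ ^ 2) ^ (-(d + 2) / 2)) •
      u ((1 / ((k : ℝ) + 1)) • z) ∂μ) Filter.atTop (nhds (pompeiuConst μ • u 0)) := by
    rw [pompeiuConst, ← integral_smul_const]
    refine tendsto_integral_filter_of_dominated_convergence
      (fun z => (d * (1 + ‖z‖ ^ 2) ^ (-(d + 2) / 2)) * M) ?_ ?_ ?_ ?_
    · refine Filter.Eventually.of_forall fun k => ?_
      refine (integrable_pompeiuConst μ).aestronglyMeasurable.smul ?_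
      exact Continuous.aestronglyMeasurable (by fun_prop)
    · refine Filter.Eventually.of_forall fun k => Filter.Eventually.of_forall fun z => ?_
      rw [norm_smul, Real.norm_of_nonneg (by positivity)]
      gcongr
      exact hM _
    · exact (integrable_pompeiuConst μ).mul_const M
    · refine Filter.Eventually.of_forall fun z => ?_
      refine Filter.Tendsto.const_smul ?_ _
      have := huc.continuousAt (x := (0 : E)).tendsto
      refine this.comp ?_
      simpa using hlim.smul_const z
  have t2 : Filter.Tendsto (fun k : ℕ => ∫ y, (‖y‖ ^ 2 + (1 / ((k : ℝ) + 1)) ^ 2) ^ (-d / 2) •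
      c y (diracOp c b u y) ∂μ) Filter.atTop
      (nhds (∫ y, diracKernel c y (diracOp c b u y) ∂μ)) := by
    refine tendsto_integral_filter_of_dominated_convergence
      ((Metric.ball (0 : E) R).indicator fun y => ‖c‖ * M' * ‖y‖ ^ (1 - d)) ?_ ?_ ?_ ?_
    · refine Filter.Eventually.of_forall fun k => Continuous.aestronglyMeasurable ?_
      refine Continuous.smul (Continuous.rpow_const (by fun_prop) fun y => Or.inl ?_) (by fun_prop)
      have := hε k
      positivity
    · refine Filter.Eventually.of_forall fun k => ?_
      filter_upwards [Measure.ae_ne μ (0 : E)] with y hy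
      have hy' : 0 < ‖y‖ := norm_pos_iff.2 hy
      by_cases hyR : y ∈ Metric.ball (0 : E) R
      · rw [Set.indicator_of_mem hyR, norm_smul, Real.norm_of_nonneg (by positivity)]
        have h1 : (‖y‖ ^ 2 + (1 / ((k : ℝ) + 1)) ^ 2) ^ (-d / 2) ≤ ‖y‖ ^ (-d) := by
          have : ‖y‖ ^ (-d) = (‖y‖ ^ 2) ^ (-d / 2) := by
            rw [← Real.rpow_natCast, ← Real.rpow_mul hy'.le]; congr 1; push_cast; ring
          rw [this]
          apply Real.rpow_le_rpow_of_nonpos (by positivity)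
          · have := hε k
            nlinarith
          · linarith
        calc _ ≤ ‖y‖ ^ (-d) * (‖c‖ * ‖y‖ * M') := by
              gcongr
              exact (c.le_opNorm₂ _ _).trans (by gcongr; exact hM' _)
          _ = _ := by
              rw [sub_eq_add_neg, Real.rpow_add hy', Real.rpow_one]; ring
      · rw [Set.indicator_of_notMem hyR, image_eq_zero_of_notMem_tsupport (fun h => hyR (hR h))]
        simp
    · rw [integrable_indicator_iff Metric.isOpen_ball.measurableSet]
      exact (integrableOn_ball_norm_rpow μ (by linarith) hR0).const_mul _
    · filter_upwards [Measure.ae_ne μ (0 : E)] with y hy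
      have hy' : 0 < ‖y‖ := norm_pos_iff.2 hy
      have e : diracKernel c y (diracOp c b u y)
          = (‖y‖ ^ 2 + (0 : ℝ) ^ 2) ^ (-d / 2) • c y (diracOp c b u y) := by
        rw [diracKernel, smul_apply]
        congr 1
        rw [zero_pow two_ne_zero, add_zero, ← Real.rpow_natCast, ← Real.rpow_natCast,
          ← Real.rpow_mul hy'.le, ← Real.rpow_neg hy'.le]
        congr 1; push_cast; rw [← hd]; ring
      rw [e]
      refine Filter.Tendsto.smul_const ?_ _
      refine Filter.Tendsto.rpow_const ((hlim.pow 2).const_add _) (Or.inl ?_)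
      positivity
  refine tendsto_nhds_unique t1 ?_
  refine t2.congr fun k => ?_
  exact integral_regularized_pompeiu μ hc hu hs (hε k)

/-- The Cauchy–Pompeiu formula for compactly supported functions. -/
lemma pompeiu [Nontrivial E] [CompleteSpace F]
    (hc : ∀ x v, c x (c x v) = -(‖x‖ ^ 2) • v) {u : E → F}
    (hu : ContDiff ℝ 1 u) (hs : HasCompactSupport u) (x : E) :
    pompeiuConst μ • u x = ∫ y, diracKernel c (y - x) (diracOp c b u y) ∂μ := by
  have h := pompeiu_zero (b := b) μ hc (u := fun y => u (x + y))
    (hu.comp (contDiff_const.add contDiff_id)) (hs.comp_homeomorph (Homeomorph.addLeft x))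
  simp only [add_zero, diracOp_comp_add_left] at h
  rw [h, ← integral_sub_right_eq_self _ x]
  simp

end Pompeiu

section Moments
variable {ι E F : Type*} [Fintype ι] [NormedAddCommGroup E] [InnerProductSpace ℝ E]
  [FiniteDimensional ℝ E] [MeasurableSpace E] [BorelSpace E] [Nontrivial E]
  [NormedAddCommGroup F] [NormedSpace ℝ F]
  (b : OrthonormalBasis ι ℝ E) (μ : Measure E) [μ.IsAddHaarMeasure]

/-- The degree `j` moment of `g` against the Taylor expansion of the kernel `K`. -/
noncomputable def kernelMoment (K : E → F →L[ℝ] F) (g : E → F) (j : ℕ) (x : E) : F :=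
  ∫ y, taylorTerm K j x y (g y) ∂μ

lemma integrable_iteratedFDeriv_apply {K : E → F →L[ℝ] F} {a : ℕ}
    (ha : Module.finrank ℝ E = a + 1)
    (hK : ∀ t : ℝ, 0 < t → ∀ z, K (t • z) = (t ^ a)⁻¹ • K z)
    (hs : ContDiffOn ℝ (⊤ : ℕ∞) K {0}ᶜ) {g : E → F} (hg : Continuous g)
    (hgs : HasCompactSupport g) {m : ℕ} {δ A : ℝ} (hδ : 0 < δ)
    (hA : ∀ y ≠ 0, ‖g y‖ ≤ A * ‖y‖ ^ ((m : ℝ) - 1 + δ)) {j : ℕ} (hj : j ≤ m) (v : Fin j → E) :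
    Integrable (fun y => iteratedFDeriv ℝ j K y v (g y)) μ := by
  obtain ⟨C, hC0, hC⟩ := exists_norm_iteratedFDeriv_le hK hs j
  obtain ⟨R, hR0, hR⟩ := hgs.isCompact.isBounded.subset_ball_lt 0 0
  have haR : (Module.finrank ℝ E : ℝ) = a + 1 := by rw [ha]; push_cast; ring
  have hjR : (j : ℝ) ≤ m := by exact_mod_cast hj
  have hi : Integrable ((Metric.ball (0 : E) R).indicator fun y =>
      (C * A * ∏ i, ‖v i‖) * ‖y‖ ^ (-(a + j : ℝ) + ((m : ℝ) - 1 + δ))) μ := by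
    rw [integrable_indicator_iff Metric.isOpen_ball.measurableSet]
    exact (integrableOn_ball_norm_rpow μ (by rw [haR]; linarith) hR0).const_mul _
  refine hi.mono' ?_ ?_
  · exact aestronglyMeasurable_of_continuousOn_compl_zero μ
      ((continuousOn_iteratedFDeriv_apply hs j v).clm_apply hg.continuousOn)
  · filter_upwards [Measure.ae_ne μ (0 : E)] with y hy
    have hy' : 0 < ‖y‖ := norm_pos_iff.2 hy
    by_cases hyR : y ∈ Metric.ball (0 : E) R
    · rw [Set.indicator_of_mem hyR, Real.rpow_add hy', Real.rpow_neg hy'.le]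
      have e : ‖y‖ ^ ((a : ℝ) + j) = ‖y‖ ^ (a + j) := by
        rw [← Real.rpow_natCast]; push_cast; rfl
      rw [e]
      calc _ ≤ ‖iteratedFDeriv ℝ j K y v‖ * ‖g y‖ := ContinuousLinearMap.le_opNorm _ _
        _ ≤ (C * (‖y‖ ^ (a + j))⁻¹ * ∏ i, ‖v i‖) * (A * ‖y‖ ^ ((m : ℝ) - 1 + δ)) := by
          gcongr
          · refine (ContinuousMultilinearMap.le_opNorm _ _).trans ?_
            gcongr
            exact hC y hy
          · exact hA y hy
        _ = _ := by ring
    · rw [Set.indicator_of_notMem hyR, image_eq_zero_of_notMem_tsupport (fun h => hyR (hR h))]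
      simp

lemma kernelMoment_eq_sum {K : E → F →L[ℝ] F} {a : ℕ}
    (ha : Module.finrank ℝ E = a + 1)
    (hK : ∀ t : ℝ, 0 < t → ∀ z, K (t • z) = (t ^ a)⁻¹ • K z)
    (hs : ContDiffOn ℝ (⊤ : ℕ∞) K {0}ᶜ) {g : E → F} (hg : Continuous g)
    (hgs : HasCompactSupport g) {m : ℕ} {δ A : ℝ} (hδ : 0 < δ)
    (hA : ∀ y ≠ 0, ‖g y‖ ≤ A * ‖y‖ ^ ((m : ℝ) - 1 + δ)) {j : ℕ} (hj : j ≤ m) :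
    ∃ w : (Fin j → ι) → F, ∀ x,
      kernelMoment μ K g j x = ∑ f, (∏ i, inner ℝ (b (f i)) x) • w f := by
  classical
  have hi := fun f : Fin j → ι => integrable_iteratedFDeriv_apply μ ha hK hs hg hgs hδ hA hj
    (fun i => b (f i))
  refine ⟨fun f => ((j.factorial : ℝ)⁻¹ * (-1) ^ j) •
    ∫ y, iteratedFDeriv ℝ j K y (fun i => b (f i)) (g y) ∂μ, fun x => ?_⟩
  have e : ∀ y, taylorTerm K j x y (g y) = ∑ f : Fin j → ι, ((j.factorial : ℝ)⁻¹ * (-1) ^ j *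
      ∏ i, inner ℝ (b (f i)) x) • iteratedFDeriv ℝ j K y (fun i => b (f i)) (g y) := by
    intro y
    have hx : (fun _ : Fin j => -x) = fun _ => ∑ l, (-inner ℝ (b l) x) • b l := by
      simp_rw [neg_smul, Finset.sum_neg_distrib]
      rw [b.sum_repr']
    rw [taylorTerm, hx, ContinuousMultilinearMap.map_sum]
    simp_rw [ContinuousMultilinearMap.map_smul_univ]
    simp only [smul_apply, sum_apply, Finset.smul_sum, smul_smul]
    refine Finset.sum_congr rfl fun f _ => ?_
    congr 1
    rw [mul_assoc, Finset.prod_neg]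
    simp
  rw [kernelMoment]
  simp_rw [e]
  have hi' : ∀ f ∈ (Finset.univ : Finset (Fin j → ι)), Integrable (fun y =>
      ((j.factorial : ℝ)⁻¹ * (-1) ^ j * ∏ i, inner ℝ (b (f i)) x) •
        iteratedFDeriv ℝ j K y (fun i => b (f i)) (g y)) μ := fun f _ => (hi f).smul _
  rw [integral_finsetSum _ hi']
  refine Finset.sum_congr rfl fun f _ => ?_
  rw [integral_smul, smul_smul]
  congr 1
  ring

variable {b} {c : E →L[ℝ] F →L[ℝ] F}

omit [FiniteDimensional ℝ E] [MeasurableSpace E] [BorelSpace E] [Nontrivial E] in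
lemma diracKernel_smul {a : ℕ} (ha : Module.finrank ℝ E = a + 1) (t : ℝ) (ht : 0 < t) (z : E) :
    diracKernel c (t • z) = (t ^ a)⁻¹ • diracKernel c z := by
  rw [diracKernel, diracKernel, map_smul, norm_smul, Real.norm_of_nonneg ht.le, smul_smul,
    smul_smul, ha]
  congr 1
  rw [mul_pow, pow_succ t]
  field_simp

omit [FiniteDimensional ℝ E] [MeasurableSpace E] [BorelSpace E] [Nontrivial E] in
lemma contDiffOn_diracKernel : ContDiffOn ℝ (⊤ : ℕ∞) (diracKernel c) {0}ᶜ := by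
  intro z hz
  have hz' : z ≠ 0 := hz
  unfold diracKernel
  have h1 : ContDiffAt ℝ (⊤ : ℕ∞) (fun z : E => (‖z‖ ^ Module.finrank ℝ E)⁻¹) z :=
    ((contDiffAt_norm ℝ hz').pow _).inv (pow_ne_zero _ (norm_ne_zero_iff.2 hz'))
  exact (h1.smul c.contDiff.contDiffAt).contDiffWithinAt

/-- Quantitative Taylor expansion at the origin of the Cauchy transform of a function that vanishes
to order `m - 1 + δ`. -/
lemma exists_norm_sub_sum_kernelMoment_le [CompleteSpace F]
    (hc : ∀ x v, c x (c x v) = -(‖x‖ ^ 2) • v) (m : ℕ) {δ : ℝ} (hδ : δ ∈ Set.Ioo (0 : ℝ) 1) :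
    ∃ C, 0 ≤ C ∧ ∀ (u : E → F) (A : ℝ), ContDiff ℝ 1 u → HasCompactSupport u →
      (∀ y ≠ 0, ‖diracOp c b u y‖ ≤ A * ‖y‖ ^ ((m : ℝ) - 1 + δ)) → ∀ x,
      ‖pompeiuConst μ • u x - ∑ j ∈ Finset.range (m + 1),
        kernelMoment μ (diracKernel c) (diracOp c b u) j x‖ ≤ C * A * ‖x‖ ^ ((m : ℝ) + δ) := by
  obtain ⟨a, ha⟩ : ∃ a, Module.finrank ℝ E = a + 1 :=
    Nat.exists_eq_succ_of_ne_zero Module.finrank_pos.ne'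
  have hK := diracKernel_smul (c := c) ha
  have hs := contDiffOn_diracKernel (c := c)
  obtain ⟨C, hC0, hC⟩ := integral_taylorRemainder_le μ ha hK hs m hδ
  refine ⟨C, hC0, fun u A hu hus hA x => ?_⟩
  obtain ⟨hi, hle⟩ := hC x
  set g := diracOp c b u with hg
  have hgc : Continuous g := continuous_diracOp hu
  have hgs : HasCompactSupport g := hus.diracOp
  have hA0 : 0 ≤ A := by
    obtain ⟨y, hy⟩ := exists_ne (0 : E)
    have hy' : 0 < ‖y‖ := norm_pos_iff.2 hy
    have := (norm_nonneg _).trans (hA y hy)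
    exact nonneg_of_mul_nonneg_left this (Real.rpow_pos_of_pos hy' _)
  have hT : ∀ j ∈ Finset.range (m + 1),
      Integrable (fun y => taylorTerm (diracKernel c) j x y (g y)) μ := fun j hj =>
    (integrable_iteratedFDeriv_apply μ ha hK hs hgc hgs hδ.1 hA
      (Nat.lt_succ_iff.1 (Finset.mem_range.1 hj)) _).smul _
  have hR : ∀ᵐ y ∂μ, ‖taylorRemainder (diracKernel c) m x y (g y)‖
      ≤ A * (‖taylorRemainder (diracKernel c) m x y‖ * ‖y‖ ^ ((m : ℝ) - 1 + δ)) := by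
    filter_upwards [Measure.ae_ne μ (0 : E)] with y hy
    refine (ContinuousLinearMap.le_opNorm _ _).trans ?_
    calc _ ≤ ‖taylorRemainder (diracKernel c) m x y‖ * (A * ‖y‖ ^ ((m : ℝ) - 1 + δ)) := by
          gcongr; exact hA y hy
      _ = _ := by ring
  have hRi : Integrable (fun y => taylorRemainder (diracKernel c) m x y (g y)) μ := by
    refine (hi.const_mul A).mono' ?_ hR
    exact (ContinuousLinearMap.id ℝ (F →L[ℝ] F)).aestronglyMeasurable_comp₂
      (aestronglyMeasurable_taylorRemainder μ hs m x) hgc.aestronglyMeasurable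
  have hKe : ∀ y, diracKernel c (y - x) (g y) = taylorRemainder (diracKernel c) m x y (g y)
      + ∑ j ∈ Finset.range (m + 1), taylorTerm (diracKernel c) j x y (g y) := by
    intro y
    rw [taylorRemainder, sub_apply, sum_apply, sub_add_cancel]
  rw [pompeiu (b := b) μ hc hu hus x]
  simp_rw [← hg, hKe]
  rw [integral_add hRi (integrable_finsetSum _ hT), integral_finsetSum _ hT]
  simp only [kernelMoment]
  rw [add_sub_cancel_right]
  calc _ ≤ ∫ y, A * (‖taylorRemainder (diracKernel c) m x y‖ * ‖y‖ ^ ((m : ℝ) - 1 + δ)) ∂μ :=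
        norm_integral_le_of_norm_le (hi.const_mul A) hR
    _ ≤ A * (C * ‖x‖ ^ ((m : ℝ) + δ)) := by
        rw [integral_const_mul]; gcongr
    _ = _ := by ring

end Moments

section GradientEstimate
variable {ι E F : Type*} [Fintype ι] [NormedAddCommGroup E] [InnerProductSpace ℝ E]
  [NormedAddCommGroup F] [NormedSpace ℝ F]
  {c : E →L[ℝ] F →L[ℝ] F} {b : OrthonormalBasis ι ℝ E}

lemma ContDiffOn.contDiff_smul_of_tsupport_subset {χ : E → ℝ} {w : E → F} {V : Set E}
    (hV : IsOpen V) (hw : ContDiffOn ℝ 1 w V) (hχ : ContDiff ℝ 1 χ) (hs : tsupport χ ⊆ V) :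
    ContDiff ℝ 1 (fun y => χ y • w y) := by
  refine contDiff_iff_contDiffAt.2 fun x => ?_
  by_cases hx : x ∈ V
  · exact hχ.contDiffAt.smul (hw.contDiffAt (hV.mem_nhds hx))
  · refine (contDiffAt_const (c := (0 : F))).congr_of_eventuallyEq ?_
    have h := notMem_tsupport_iff_eventuallyEq.1 fun h => hx (hs h)
    filter_upwards [h] with y hy
    simp [hy]

lemma diracOp_smul {χ : E → ℝ} {w : E → F} {x : E} (hχ : DifferentiableAt ℝ χ x)
    (hw : DifferentiableAt ℝ w x) : diracOp c b (fun y => χ y • w y) x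
      = χ x • diracOp c b w x + cliffordContract c b ((fderiv ℝ χ x).smulRight (w x)) := by
  have h := (hχ.hasFDerivAt.smul hw.hasFDerivAt).fderiv
  unfold diracOp
  change cliffordContract c b (fderiv ℝ (χ • w) x) = _
  rw [h, cliffordContract_add, cliffordContract_smul]

variable [FiniteDimensional ℝ E] [Nontrivial E] [CompleteSpace F]

/-- Interior Hölder estimate for a function with bounded Dirac derivative. -/
lemma exists_norm_sub_le_of_diracOp_bound (b : OrthonormalBasis ι ℝ E)
    (hc : ∀ x v, c x (c x v) = -(‖x‖ ^ 2) • v) {θ : ℝ} (hθ : θ ∈ Set.Ioo (0 : ℝ) 1) :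
    ∃ C, 0 ≤ C ∧ ∀ (w : E → F) (A : ℝ), ContDiffOn ℝ 1 w (Metric.ball 0 1) →
      (∀ y ∈ Metric.ball (0 : E) 1, ‖w y‖ ≤ A ∧ ‖diracOp c b w y‖ ≤ A) →
      ∀ h : E, ‖h‖ ≤ 1 / 2 → ‖w h - w 0‖ ≤ C * A * ‖h‖ ^ θ := by
  let _ : MeasurableSpace E := borel E
  have _ : BorelSpace E := ⟨rfl⟩
  set μ : Measure E := volume
  obtain ⟨C, hC0, hC⟩ := exists_norm_sub_sum_kernelMoment_le (b := b) μ hc 0 hθ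
  obtain ⟨C', hC'0, hC'⟩ := exists_norm_cliffordContract_le c b
  let χ : ContDiffBump (0 : E) := ⟨1 / 2, 3 / 4, by norm_num, by norm_num⟩
  have hχs : ContDiff ℝ 1 χ := χ.contDiff
  obtain ⟨D, hD⟩ := (χ.hasCompactSupport.fderiv ℝ).exists_bound_of_continuous
    (hχs.continuous_fderiv one_ne_zero)
  have hD0 : 0 ≤ D := (norm_nonneg _).trans (hD 0)
  have hκ := pompeiuConst_pos μ
  have hsub : tsupport χ ⊆ Metric.ball (0 : E) 1 := by
    rw [χ.tsupport_eq]
    exact Metric.closedBall_subset_ball (by norm_num)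
  refine ⟨(pompeiuConst μ)⁻¹ * C * (1 + C' * D), by positivity, fun w A hw hA h hh => ?_⟩
  have hA0 : 0 ≤ A := (norm_nonneg _).trans (hA 0 (by simp)).1
  set u : E → F := fun y => χ y • w y with hu
  have huc : ContDiff ℝ 1 u := hw.contDiff_smul_of_tsupport_subset Metric.isOpen_ball hχs hsub
  have hus : HasCompactSupport u := χ.hasCompactSupport.smul_right
  have hDu : ∀ y ≠ 0, ‖diracOp c b u y‖ ≤ ((1 + C' * D) * A) * ‖y‖ ^ (((0 : ℕ) : ℝ) - 1 + θ) := by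
    intro y hy
    have hy' : 0 < ‖y‖ := norm_pos_iff.2 hy
    by_cases hyV : y ∈ Metric.ball (0 : E) 1
    · have hd : DifferentiableAt ℝ w y :=
        (hw.contDiffAt (Metric.isOpen_ball.mem_nhds hyV)).differentiableAt one_ne_zero
      rw [diracOp_smul (hχs.differentiable one_ne_zero y) hd]
      obtain ⟨h1, h2⟩ := hA y hyV
      have e1 : ‖χ y • diracOp c b w y‖ ≤ A := by
        rw [norm_smul, Real.norm_of_nonneg χ.nonneg]
        calc _ ≤ 1 * A := by gcongr; exact χ.le_one
          _ = A := one_mul A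
      have e2 : ‖cliffordContract c b ((fderiv ℝ χ y).smulRight (w y))‖ ≤ C' * D * A := by
        refine (hC' _).trans ?_
        rw [ContinuousLinearMap.norm_smulRight_apply, mul_assoc]
        gcongr
        exact hD y
      have e3 : 1 ≤ ‖y‖ ^ (((0 : ℕ) : ℝ) - 1 + θ) := by
        apply Real.one_le_rpow_of_pos_of_le_one_of_nonpos hy' (mem_ball_zero_iff.1 hyV).le
        push_cast; linarith [hθ.2]
      calc _ ≤ A + C' * D * A := (norm_add_le _ _).trans (add_le_add e1 e2)
        _ = (1 + C' * D) * A * 1 := by ring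
        _ ≤ _ := by gcongr
    · have : y ∉ tsupport u := fun h' => hyV (hsub (tsupport_smul_subset_left _ _ h'))
      have h0 : fderiv ℝ u y = 0 := image_eq_zero_of_notMem_tsupport
        (fun h' => this (tsupport_fderiv_subset ℝ h'))
      rw [diracOp, h0]
      simp only [cliffordContract, zero_apply, map_zero, Finset.sum_const_zero, norm_zero]
      positivity
  have hM : ∀ x, ∑ j ∈ Finset.range (0 + 1),
      kernelMoment μ (diracKernel c) (diracOp c b u) j x
      = kernelMoment μ (diracKernel c) (diracOp c b u) 0 0 := by
    intro x
    rw [zero_add, Finset.sum_range_one]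
    unfold kernelMoment taylorTerm
    simp
  have k1 := hC u _ huc hus hDu h
  have k0 := hC u _ huc hus hDu 0
  rw [hM] at k1 k0
  rw [norm_zero, Real.zero_rpow (by push_cast; linarith [hθ.1]), mul_zero] at k0
  have k2 : pompeiuConst μ • u 0 = kernelMoment μ (diracKernel c) (diracOp c b u) 0 0 :=
    sub_eq_zero.1 (norm_le_zero_iff.1 k0)
  have hu1 : u h = w h := by
    simp only [hu]
    rw [χ.one_of_mem_closedBall (by rw [mem_closedBall_zero_iff]; exact hh), one_smul]
  have hu0 : u 0 = w 0 := by
    simp only [hu]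
    rw [χ.one_of_mem_closedBall (by simp [χ.rIn_pos.le]), one_smul]
  rw [← k2, ← smul_sub, norm_smul, Real.norm_of_nonneg hκ.le, hu1, hu0] at k1
  rw [← inv_mul_cancel_left₀ hκ.ne' ‖w h - w 0‖]
  calc _ ≤ (pompeiuConst μ)⁻¹ * (C * ((1 + C' * D) * A) * ‖h‖ ^ (((0 : ℕ) : ℝ) + θ)) := by gcongr
    _ = _ := by push_cast; rw [zero_add]; ring

lemma exists_norm_fderiv_le_of_diracOp_bound (b : OrthonormalBasis ι ℝ E)
    (hc : ∀ x v, c x (c x v) = -(‖x‖ ^ 2) • v) {θ : ℝ} (hθ : θ ∈ Set.Ioo (0 : ℝ) 1) :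
    ∃ C, 0 ≤ C ∧ ∀ (Q : E → F) (x : E) (r A H α : ℝ), 0 < r → 0 < α → 0 ≤ H →
      ContDiffOn ℝ 1 Q (Metric.ball x r) →
      (∀ y ∈ Metric.ball x r, ‖Q y‖ ≤ A ∧ r * ‖diracOp c b Q y‖ ≤ A) →
      (∀ y ∈ Metric.ball x r, ‖fderiv ℝ Q y - fderiv ℝ Q x‖ ≤ H * ‖y - x‖ ^ α) →
      ∀ s : ℝ, 0 < s → s ≤ 1 / 2 →
        ‖fderiv ℝ Q x‖ ≤ C * A * r⁻¹ * s ^ (θ - 1) + H * (r * s) ^ α := by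
  obtain ⟨C, hC0, hC⟩ := exists_norm_sub_le_of_diracOp_bound b hc hθ
  refine ⟨C, hC0, fun Q x r A H α hr hα hH hQ hA hHol s hs hs2 => ?_⟩
  have hA0 : 0 ≤ A := (norm_nonneg _).trans (hA x (Metric.mem_ball_self hr)).1
  have hmap : ∀ z ∈ Metric.ball (0 : E) 1, x + r • z ∈ Metric.ball x r := by
    intro z hz
    rw [mem_ball_zero_iff] at hz
    rw [mem_ball_iff_norm, add_sub_cancel_left, norm_smul, Real.norm_of_nonneg hr.le]
    exact mul_lt_of_lt_one_right hr hz
  have hdiff : ∀ y ∈ Metric.ball x r, DifferentiableAt ℝ Q y := fun y hy =>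
    (hQ.contDiffAt (Metric.isOpen_ball.mem_nhds hy)).differentiableAt one_ne_zero
  set w : E → F := fun z => Q (x + r • z) with hw
  have hwd : ∀ z ∈ Metric.ball (0 : E) 1, diracOp c b w z = r • diracOp c b Q (x + r • z) := by
    intro z hz
    have h1 : HasFDerivAt (fun z : E => x + r • z) (r • ContinuousLinearMap.id ℝ E) z :=
      ((hasFDerivAt_id z).const_smul r).const_add x
    have h2 := ((hdiff _ (hmap z hz)).hasFDerivAt.comp z h1).fderiv
    have h3 : fderiv ℝ w z = r • fderiv ℝ Q (x + r • z) := by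
      refine Eq.trans h2 ?_
      ext v; simp
    rw [diracOp, h3, cliffordContract_smul, diracOp]
  have hG := hC w A (hQ.comp (contDiff_const.add (contDiff_const.smul contDiff_id)).contDiffOn hmap)
    (fun z hz => by
      refine ⟨(hA _ (hmap z hz)).1, ?_⟩
      rw [hwd z hz, norm_smul, Real.norm_of_nonneg hr.le]
      exact (hA _ (hmap z hz)).2)
  refine ContinuousLinearMap.opNorm_le_of_unit_norm (by positivity) fun e he => ?_
  have hh : ‖s • e‖ = s := by rw [norm_smul, he, mul_one, Real.norm_of_nonneg hs.le]
  have h1 := hG (s • e) (by rw [hh]; exact hs2)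
  have hrs : ‖r • s • e‖ = r * s := by rw [norm_smul, hh, Real.norm_of_nonneg hr.le]
  have hsub : Metric.closedBall x (r * s) ⊆ Metric.ball x r :=
    Metric.closedBall_subset_ball (by nlinarith)
  have h2 := (convex_closedBall x (r * s)).norm_image_sub_le_of_norm_fderiv_le' (f := Q)
    (φ := fderiv ℝ Q x) (C := H * (r * s) ^ α) (x := x) (y := x + r • s • e)
    (fun y hy => hdiff y (hsub hy)) (fun y hy => by
      refine (hHol y (hsub hy)).trans ?_
      gcongr
      exact mem_closedBall_iff_norm.1 hy) (Metric.mem_closedBall_self (by positivity))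
    (by rw [mem_closedBall_iff_norm, add_sub_cancel_left, hrs])
  rw [add_sub_cancel_left, hrs] at h2
  simp only [hw, smul_zero, add_zero, hh] at h1
  have h3 : ‖fderiv ℝ Q x (r • s • e)‖ = r * s * ‖fderiv ℝ Q x e‖ := by
    rw [map_smul, map_smul, norm_smul, norm_smul, Real.norm_of_nonneg hr.le,
      Real.norm_of_nonneg hs.le, mul_assoc]
  have h4 : ‖fderiv ℝ Q x (r • s • e)‖ ≤ C * A * s ^ θ + H * (r * s) ^ α * (r * s) := by
    have e : fderiv ℝ Q x (r • s • e) = (Q (x + r • s • e) - Q x)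
      - (Q (x + r • s • e) - Q x - fderiv ℝ Q x (r • s • e)) := by abel
    rw [e]
    exact (norm_sub_le _ _).trans (add_le_add h1 h2)
  rw [h3] at h4
  have hrs0 : 0 < r * s := mul_pos hr hs
  refine le_of_mul_le_mul_left (h4.trans (le_of_eq ?_)) hrs0
  rw [Real.rpow_sub_one hs.ne']
  field_simp

/-- Decay of the gradient, from decay of a function and of its Dirac derivative together with
Hölder continuity of the gradient. -/
lemma exists_norm_fderiv_le_rpow (hc : ∀ x v, c x (c x v) = -(‖x‖ ^ 2) • v)
    {Q : E → F} {R α H : ℝ} (hR1 : R ≤ 1) (hα : 0 < α) (hα1 : α ≤ 1) (hH : 0 ≤ H)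
    (hQ : ContDiffOn ℝ 1 Q (Metric.ball 0 (2 * R)))
    (hHol : ∀ x ∈ Metric.ball (0 : E) (2 * R), ∀ y ∈ Metric.ball (0 : E) (2 * R),
      ‖fderiv ℝ Q y - fderiv ℝ Q x‖ ≤ H * ‖y - x‖ ^ α) {m : ℕ} (hm : 1 ≤ m)
    (hdecay : ∀ δ ∈ Set.Ioo (0 : ℝ) 1, ∃ A : ℝ, ∀ y ∈ Metric.ball (0 : E) (2 * R),
      ‖Q y‖ ≤ A * ‖y‖ ^ ((m : ℝ) + δ) ∧ ‖diracOp c b Q y‖ ≤ A * ‖y‖ ^ ((m : ℝ) - 1 + δ))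
    {δ : ℝ} (hδ : δ ∈ Set.Ioo (0 : ℝ) 1) :
    ∃ A, 0 ≤ A ∧ ∀ x ∈ Metric.ball (0 : E) R, ‖fderiv ℝ Q x‖ ≤ A * ‖x‖ ^ ((m : ℝ) + δ - 1) := by
  obtain ⟨hδ0, hδ1⟩ := hδ
  have hmR : (1 : ℝ) ≤ m := by exact_mod_cast hm
  set M : ℝ := m / α with hM
  have hM1 : 1 ≤ M := by rw [hM, le_div_iff₀ hα]; linarith
  have hMα : M * α = m := by rw [hM]; field_simp
  set δ₁ : ℝ := (1 + δ) / 2 with hδ₁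
  obtain ⟨A₀, hA₀⟩ := hdecay δ₁ ⟨by rw [hδ₁]; linarith, by rw [hδ₁]; linarith⟩
  set A₁ := |A₀| with hA₁
  have hA₁0 : 0 ≤ A₁ := abs_nonneg _
  set θ : ℝ := 1 - (δ₁ - δ) / M with hθ
  have hMθ : M * (θ - 1) = δ - δ₁ := by rw [hθ]; field_simp; ring
  have hθ1 : θ < 1 := by nlinarith
  have hθ0 : 0 < θ := by nlinarith
  obtain ⟨C, hC0, hC⟩ := exists_norm_fderiv_le_of_diracOp_bound b hc ⟨hθ0, hθ1⟩
  have hQb : ∀ y ∈ Metric.ball (0 : E) (2 * R), ‖Q y‖ ≤ A₁ * ‖y‖ ^ ((m : ℝ) + δ₁) := fun y hy =>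
    (hA₀ y hy).1.trans (by gcongr; exact le_abs_self _)
  have hDb : ∀ y ∈ Metric.ball (0 : E) (2 * R),
      ‖diracOp c b Q y‖ ≤ A₁ * ‖y‖ ^ ((m : ℝ) - 1 + δ₁) := fun y hy =>
    (hA₀ y hy).2.trans (by gcongr; exact le_abs_self _)
  refine ⟨C * A₁ * 2 ^ ((m : ℝ) + δ₁) * 2 * (1 / 2) ^ (θ - 1) + H, by positivity, fun x hx => ?_⟩
  rcases eq_or_ne x 0 with rfl | hx0
  · have hmem : Metric.ball (0 : E) (2 * R) ∈ nhds 0 :=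
      Metric.ball_mem_nhds _ (by have := Metric.pos_of_mem_ball hx; linarith)
    have hQ0 : Q 0 = 0 := by
      have := hQb 0 (mem_of_mem_nhds hmem)
      rw [norm_zero, Real.zero_rpow (by linarith), mul_zero] at this
      exact norm_le_zero_iff.1 this
    have h0 : HasFDerivAt Q (0 : E →L[ℝ] F) 0 := by
      rw [hasFDerivAt_iff_isLittleO_nhds_zero, Asymptotics.isLittleO_iff]
      intro ε hε
      have ht : Filter.Tendsto (fun h : E => A₁ * ‖h‖ ^ ((m : ℝ) + δ₁ - 1)) (nhds 0) (nhds 0) := by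
        have h1 : Continuous fun h : E => A₁ * ‖h‖ ^ ((m : ℝ) + δ₁ - 1) :=
          continuous_const.mul (continuous_norm.rpow_const fun _ => Or.inr (by linarith))
        have h2 := h1.tendsto 0
        rwa [norm_zero, Real.zero_rpow (by linarith), mul_zero] at h2
      filter_upwards [ht.eventually_lt_const hε, hmem] with h h1 h2
      rw [zero_add, hQ0, sub_zero, zero_apply, sub_zero]
      rcases eq_or_ne h 0 with rfl | hh
      · simp [hQ0]
      refine (hQb h h2).trans ?_
      rw [Real.rpow_sub_one (norm_ne_zero_iff.2 hh), ← mul_div_assoc,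
        div_lt_iff₀ (norm_pos_iff.2 hh)] at h1
      exact h1.le
    rw [h0.fderiv, norm_zero]
    positivity
  set t := ‖x‖ with ht
  have ht0 : 0 < t := norm_pos_iff.2 hx0
  have htR : t < R := mem_ball_zero_iff.1 hx
  have ht1 : t ≤ 1 := by linarith
  have hsub : ∀ y ∈ Metric.ball x (t / 2), ‖y‖ ≤ 2 * t ∧ y ∈ Metric.ball (0 : E) (2 * R) := by
    intro y hy
    rw [mem_ball_iff_norm] at hy
    have : ‖y‖ ≤ ‖y - x‖ + ‖x‖ := norm_le_norm_sub_add y x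
    exact ⟨by linarith, by rw [mem_ball_zero_iff]; linarith⟩
  have htM : t ^ M ≤ 1 := Real.rpow_le_one ht0.le ht1 (by linarith)
  have htM0 : 0 < t ^ M := Real.rpow_pos_of_pos ht0 _
  have key := hC Q x (t / 2) (A₁ * (2 * t) ^ ((m : ℝ) + δ₁)) H α (by linarith) hα hH
    (hQ.mono fun y hy => (hsub y hy).2) (fun y hy => ?_)
    (fun y hy => hHol x (Metric.ball_subset_ball (by linarith) hx) y (hsub y hy).2)
    (t ^ M / 2) (by linarith) (by linarith)
  · have e1 : C * (A₁ * (2 * t) ^ ((m : ℝ) + δ₁)) * (t / 2)⁻¹ * (t ^ M / 2) ^ (θ - 1)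
        = C * A₁ * 2 ^ ((m : ℝ) + δ₁) * 2 * (1 / 2) ^ (θ - 1) * t ^ ((m : ℝ) + δ - 1) := by
      have h1 : (t ^ M / 2) ^ (θ - 1) = t ^ (δ - δ₁) * (1 / 2) ^ (θ - 1) := by
        rw [div_eq_mul_one_div, Real.mul_rpow htM0.le (by norm_num), ← Real.rpow_mul ht0.le, hMθ]
      have h2 : t ^ ((m : ℝ) + δ - 1) = t ^ ((m : ℝ) + δ₁) * t⁻¹ * t ^ (δ - δ₁) := by
        rw [← Real.rpow_neg_one, ← Real.rpow_add ht0, ← Real.rpow_add ht0]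
        congr 1; ring
      rw [h1, h2, Real.mul_rpow (by norm_num) ht0.le, inv_div, div_eq_mul_inv]
      ring
    have e2 : (t / 2 * (t ^ M / 2)) ^ α ≤ t ^ ((m : ℝ) + δ - 1) := by
      calc _ ≤ (t ^ M) ^ α := by
            apply Real.rpow_le_rpow (by positivity) _ hα.le
            nlinarith
        _ = t ^ (m : ℝ) := by rw [← Real.rpow_mul ht0.le, hMα]
        _ ≤ _ := Real.rpow_le_rpow_of_exponent_ge ht0 ht1 (by linarith)
    rw [e1] at key
    calc _ ≤ _ := key
      _ ≤ C * A₁ * 2 ^ ((m : ℝ) + δ₁) * 2 * (1 / 2) ^ (θ - 1) * t ^ ((m : ℝ) + δ - 1)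
          + H * t ^ ((m : ℝ) + δ - 1) := by gcongr
      _ = _ := by ring
  · obtain ⟨h1, h2⟩ := hsub y hy
    constructor
    · refine (hQb y h2).trans ?_
      gcongr
    · calc t / 2 * ‖diracOp c b Q y‖ ≤ 2 * t * (A₁ * (2 * t) ^ ((m : ℝ) - 1 + δ₁)) := by
            gcongr
            · linarith
            · refine (hDb y h2).trans ?_
              gcongr
        _ = _ := by
            rw [show (m : ℝ) + δ₁ = 1 + ((m : ℝ) - 1 + δ₁) by ring,
              Real.rpow_add (by positivity) 1, Real.rpow_one]
            ring

end GradientEstimate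

section InvariantForm
variable {ι E F : Type*} [Fintype ι] [NormedAddCommGroup E] [InnerProductSpace ℝ E]
  [NormedAddCommGroup F] [InnerProductSpace ℝ F] {c : E →L[ℝ] F →L[ℝ] F}

lemma exists_form_of_finset (b : OrthonormalBasis ι ℝ E)
    (hc : ∀ x v, c x (c x v) = -(‖x‖ ^ 2) • v) (s : Finset ι) :
    ∃ B : F →L[ℝ] F →L[ℝ] ℝ, (∀ u v, B u v = B v u) ∧ (∀ v, ‖v‖ ^ 2 ≤ B v v) ∧
      ∀ i ∈ s, ∀ u v, B (c (b i) u) v = -B u (c (b i) v) := by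
  classical
  induction s using Finset.induction_on with
  | empty =>
    exact ⟨innerSL ℝ, fun u v => real_inner_comm v u, fun v => (real_inner_self_eq_norm_sq v).ge,
      fun i hi => absurd hi (Finset.notMem_empty i)⟩
  | insert k s hk ih =>
    obtain ⟨B, hs, hp, ha⟩ := ih
    refine ⟨B + B.bilinearComp (c (b k)) (c (b k)), fun u v => ?_, fun v => ?_,
      fun i hi u v => ?_⟩
    · simp [hs u v, hs (c (b k) u)]
    · have := (sq_nonneg _).trans (hp (c (b k) v))
      simpa using (hp v).trans (le_add_of_nonneg_right this)
    · simp only [add_apply, ContinuousLinearMap.bilinearComp_apply]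
      rcases eq_or_ne i k with rfl | hik
      · rw [clifford_basis_sq hc, clifford_basis_sq hc, map_neg, map_neg, neg_apply]
        ring
      · have hi' : i ∈ s := Finset.mem_of_mem_insert_of_ne hi hik
        have anti : ∀ w, c (b k) (c (b i) w) = -c (b i) (c (b k) w) := by
          intro w
          have h := clifford_anticomm hc (b k) (b i) w
          rw [b.orthonormal.2 (Ne.symm hik)] at h
          simp only [mul_zero, neg_zero, zero_smul] at h
          exact eq_neg_of_add_eq_zero_left h
        rw [anti, anti, map_neg, map_neg, neg_apply, ha i hi', ha i hi']
        ring

/-- A Clifford action on a real inner product space admits an equivalent inner product for which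
vectors act by skew-adjoint maps. -/
lemma exists_invariant_form (b : OrthonormalBasis ι ℝ E)
    (hc : ∀ x v, c x (c x v) = -(‖x‖ ^ 2) • v) :
    ∃ B : F →L[ℝ] F →L[ℝ] ℝ, (∀ u v, B u v = B v u) ∧ (∀ v, ‖v‖ ^ 2 ≤ B v v) ∧
      ∀ x u v, B (c x u) v = -B u (c x v) := by
  obtain ⟨B, hs, hp, ha⟩ := exists_form_of_finset b hc Finset.univ
  refine ⟨B, hs, hp, fun x u v => ?_⟩
  rw [← b.sum_repr' x]
  simp [ha, Finset.sum_neg_distrib]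

end InvariantForm

section Dilation
variable {E G : Type*} [NormedAddCommGroup E] [NormedSpace ℝ E] [FiniteDimensional ℝ E]
  [MeasurableSpace E] [BorelSpace E] (μ : Measure E) [μ.IsAddHaarMeasure]
  [NormedAddCommGroup G] [NormedSpace ℝ G]

lemma integral_dilation (f : E → ℝ) {t : ℝ} (ht : 0 < t) :
    ∫ x, (‖x‖ ^ Module.finrank ℝ E)⁻¹ * f (t • x) ∂μ
      = ∫ x, (‖x‖ ^ Module.finrank ℝ E)⁻¹ * f x ∂μ := by
  have h := Measure.integral_comp_smul_of_nonneg μ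
    (fun x => (‖x‖ ^ Module.finrank ℝ E)⁻¹ * f x) t (hR := ht.le)
  rw [eq_inv_smul_iff₀ (by positivity), ← integral_smul] at h
  rw [← h]
  congr 1 with x
  rw [norm_smul, Real.norm_of_nonneg ht.le, mul_pow, smul_eq_mul]
  field_simp

omit [BorelSpace E] [FiniteDimensional ℝ E] [MeasurableSpace E] [NormedSpace ℝ E]
  [NormedSpace ℝ G] in
lemma continuous_of_eventually_zero {f : E → G} (hf : ContinuousOn f {0}ᶜ)
    (h0 : f =ᶠ[nhds 0] 0) : Continuous f := by
  refine continuous_iff_continuousAt.2 fun x => ?_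
  rcases eq_or_ne x 0 with rfl | hx
  · exact (continuousAt_const (y := (0 : G))).congr h0.symm
  · exact hf.continuousAt (isOpen_compl_singleton.mem_nhds hx)

/-- Differentiation of dilations under the integral sign. -/
lemma hasDerivAt_integral_dilation {k : E → G →L[ℝ] ℝ} (hk : ContinuousOn k {0}ᶜ) {h : E → G}
    (hh : ContDiff ℝ 1 h) (hs : HasCompactSupport h) (h0 : (0 : E) ∉ tsupport h) :
    HasDerivAt (fun s : ℝ => ∫ x, k x (h (Real.exp s • x)) ∂μ)
      (∫ x, k x (fderiv ℝ h x x) ∂μ) 0 := by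
  obtain ⟨R, hR0, hR⟩ := hs.isCompact.isBounded.subset_ball_lt 0 0
  obtain ⟨r, hr0, hr⟩ := Metric.mem_nhds_iff.1 ((isClosed_tsupport h).isOpen_compl.mem_nhds h0)
  have hfd : Continuous (fderiv ℝ h) := hh.continuous_fderiv one_ne_zero
  set An : Set E := Metric.closedBall 0 (Real.exp 1 * R) \ Metric.ball 0 (Real.exp (-1) * r)
    with hAn
  have hAnc : IsCompact An := (isCompact_closedBall _ _).diff Metric.isOpen_ball
  have hAn0 : An ⊆ {0}ᶜ := by
    rintro x ⟨_, hx⟩ rfl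
    exact hx (Metric.mem_ball_self (by positivity))
  have hmem : ∀ s ∈ Set.Ioo (-1 : ℝ) 1, ∀ x : E, Real.exp s • x ∈ tsupport h → x ∈ An := by
    intro s hs' x hx
    have h1 := mem_ball_zero_iff.1 (hR hx)
    have h2 : r ≤ ‖Real.exp s • x‖ := by
      by_contra hlt
      exact hr (mem_ball_zero_iff.2 (not_le.1 hlt)) hx
    rw [norm_smul, Real.norm_of_nonneg (Real.exp_pos s).le] at h1 h2
    have e1 : ‖x‖ = Real.exp (-s) * (Real.exp s * ‖x‖) := by
      rw [← mul_assoc, ← Real.exp_add]; simp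
    have b1 : Real.exp (-s) ≤ Real.exp 1 := Real.exp_le_exp.2 (by linarith [hs'.1])
    have b2 : Real.exp (-1) ≤ Real.exp (-s) := Real.exp_le_exp.2 (by linarith [hs'.2])
    refine ⟨?_, ?_⟩
    · rw [mem_closedBall_zero_iff, e1]
      gcongr
    · rw [mem_ball_zero_iff, not_lt, e1]
      gcongr
  obtain ⟨M, hM⟩ := hAnc.exists_bound_of_continuousOn (hk.mono hAn0)
  obtain ⟨D, hD⟩ := (hs.fderiv ℝ).exists_bound_of_continuous hfd
  have hder : ∀ (x : E) (s : ℝ), HasDerivAt (fun s : ℝ => k x (h (Real.exp s • x)))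
      (k x (fderiv ℝ h (Real.exp s • x) (Real.exp s • x))) s := by
    intro x s
    have h1 : HasDerivAt (fun s : ℝ => Real.exp s • x) (Real.exp s • x) s :=
      (Real.hasDerivAt_exp s).smul_const x
    have h2 := ((hh.differentiable one_ne_zero) (Real.exp s • x)).hasFDerivAt.comp_hasDerivAt s h1
    exact (k x).hasFDerivAt.comp_hasDerivAt s h2
  have hzero : ∀ s ∈ Set.Ioo (-1 : ℝ) 1, ∀ x ∉ An, h (Real.exp s • x) = 0 ∧
      fderiv ℝ h (Real.exp s • x) = 0 := by
    intro s hs' x hx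
    have : Real.exp s • x ∉ tsupport h := fun h' => hx (hmem s hs' x h')
    exact ⟨image_eq_zero_of_notMem_tsupport this,
      image_eq_zero_of_notMem_tsupport fun h' => this (tsupport_fderiv_subset ℝ h')⟩
  have hind : ∀ s ∈ Set.Ioo (-1 : ℝ) 1, ∀ g : E → E → G,
      (∀ x ∉ An, g (Real.exp s • x) x = 0) →
      Continuous (fun x => g (Real.exp s • x) x) →
      Integrable (fun x => k x (g (Real.exp s • x) x)) μ := by
    intro s hs' g hg hgc
    have : ContinuousOn (fun x => k x (g (Real.exp s • x) x)) An :=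
      (hk.mono hAn0).clm_apply hgc.continuousOn
    refine (integrableOn_iff_integrable_of_support_subset fun x hx => ?_).1
      (this.integrableOn_compact hAnc)
    by_contra hxA
    exact hx (by simp [hg x hxA])
  have hm0 : (0 : ℝ) ∈ Set.Ioo (-1 : ℝ) 1 := by simp
  have := hasDerivAt_integral_of_dominated_loc_of_deriv_le (μ := μ)
    (F := fun (s : ℝ) x => k x (h (Real.exp s • x)))
    (F' := fun (s : ℝ) x => k x (fderiv ℝ h (Real.exp s • x) (Real.exp s • x)))
    (x₀ := 0) (s := Set.Ioo (-1) 1) (bound := An.indicator fun _ => M * (D * R))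
    (Ioo_mem_nhds (by norm_num) (by norm_num)) ?_ ?_ ?_ ?_ ?_ ?_
  · simpa using this.2
  · filter_upwards [Ioo_mem_nhds hm0.1 hm0.2] with s hs'
    exact (hind s hs' (fun y _ => h y) (fun x hx => (hzero s hs' x hx).1)
      (hh.continuous.comp (continuous_const_smul _))).aestronglyMeasurable
  · exact hind 0 hm0 (fun y _ => h y) (fun x hx => (hzero 0 hm0 x hx).1)
      (hh.continuous.comp (continuous_const_smul _))
  · refine (hind 0 hm0 (fun y _ => fderiv ℝ h y y)
      (fun x hx => by rw [(hzero 0 hm0 x hx).2, zero_apply]) ?_).aestronglyMeasurable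
    exact (hfd.comp (continuous_const_smul _)).clm_apply (continuous_const_smul _)
  · refine Filter.Eventually.of_forall fun x s hs' => ?_
    by_cases hx : x ∈ An
    · rw [Set.indicator_of_mem hx]
      by_cases hxt : Real.exp s • x ∈ tsupport h
      · have h1 := mem_ball_zero_iff.1 (hR hxt)
        have hM0 : 0 ≤ M := (norm_nonneg _).trans (hM x hx)
        have hD0 : 0 ≤ D := (norm_nonneg _).trans (hD 0)
        refine ((k x).le_opNorm _).trans ?_
        gcongr
        · exact hM x hx
        · refine (ContinuousLinearMap.le_opNorm _ _).trans ?_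
          gcongr
          exact hD _
      · have : fderiv ℝ h (Real.exp s • x) = 0 :=
          image_eq_zero_of_notMem_tsupport fun h' => hxt (tsupport_fderiv_subset ℝ h')
        rw [this]
        have hM0 : 0 ≤ M := (norm_nonneg _).trans (hM x hx)
        have hD0 : 0 ≤ D := (norm_nonneg _).trans (hD 0)
        simp only [zero_apply, map_zero, norm_zero]
        positivity
    · rw [Set.indicator_of_notMem hx, (hzero s hs' x hx).2]
      simp
  · rw [integrable_indicator_iff hAnc.measurableSet]
    exact integrableOn_const hAnc.measure_lt_top.ne
  · exact Filter.Eventually.of_forall fun x s _ => hder x s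

/-- The radial derivative has mean zero for the dilation invariant measure. -/
lemma integral_radial_fderiv_eq_zero {g : E → ℝ} (hg : ContDiff ℝ 1 g)
    (hs : HasCompactSupport g) (h0 : (0 : E) ∉ tsupport g) :
    ∫ x, (‖x‖ ^ Module.finrank ℝ E)⁻¹ * fderiv ℝ g x x ∂μ = 0 := by
  have hk : ContinuousOn (fun x : E => (‖x‖ ^ Module.finrank ℝ E)⁻¹ •
      ContinuousLinearMap.id ℝ ℝ) {0}ᶜ := by
    have : ContinuousOn (fun x : E => (‖x‖ ^ Module.finrank ℝ E)⁻¹) {0}ᶜ :=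
      ContinuousOn.inv₀ (f := fun x : E => ‖x‖ ^ Module.finrank ℝ E) (by fun_prop)
        fun x hx => pow_ne_zero _ (norm_ne_zero_iff.2 hx)
    exact this.smul continuousOn_const
  have h1 := hasDerivAt_integral_dilation μ hk hg hs h0
  simp only [smul_apply, ContinuousLinearMap.id_apply, smul_eq_mul] at h1
  have h2 : (fun s : ℝ => ∫ x, (‖x‖ ^ Module.finrank ℝ E)⁻¹ * g (Real.exp s • x) ∂μ)
      = fun _ => ∫ x, (‖x‖ ^ Module.finrank ℝ E)⁻¹ * g x ∂μ := by
    ext s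
    exact integral_dilation μ g (Real.exp_pos s)
  rw [h2] at h1
  exact h1.unique (hasDerivAt_const _ _)

end Dilation

section SphericalOperator
variable {ι E F : Type*} [Fintype ι] [NormedAddCommGroup E] [InnerProductSpace ℝ E]
  [NormedAddCommGroup F] [NormedSpace ℝ F]

/-- The spherical Dirac operator `x · Du + ∂_r u`, which only differentiates along spheres. -/
noncomputable def sphericalOp (c : E →L[ℝ] F →L[ℝ] F) (b : OrthonormalBasis ι ℝ E) (u : E → F)
    (x : E) : F :=
  c x (diracOp c b u x) + fderiv ℝ u x x

/-- The coefficient of the `v`-derivative in the spherical Dirac operator. -/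
noncomputable def sphericalCoeff (c : E →L[ℝ] F →L[ℝ] F) (v : E) : E →L[ℝ] F →L[ℝ] F :=
  ((ContinuousLinearMap.compL ℝ F F F).flip (c v)).comp c +
    (innerSL ℝ v).smulRight (ContinuousLinearMap.id ℝ F)

variable {c : E →L[ℝ] F →L[ℝ] F} {b : OrthonormalBasis ι ℝ E}

lemma sphericalCoeff_apply (v x : E) (w : F) :
    sphericalCoeff c v x w = c x (c v w) + inner ℝ v x • w := by
  simp [sphericalCoeff]

lemma sphericalOp_eq_sum (u : E → F) (x : E) :
    sphericalOp c b u x = ∑ i, sphericalCoeff c (b i) x (fderiv ℝ u x (b i)) := by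
  simp only [sphericalOp, diracOp, cliffordContract, sphericalCoeff_apply, map_sum,
    Finset.sum_add_distrib]
  congr 1
  conv_lhs => rw [← b.sum_repr' x, map_sum]
  rw [b.sum_repr' x]
  simp

lemma continuous_sphericalOp {u : E → F} (hu : ContDiff ℝ 1 u) :
    Continuous (sphericalOp c b u) := by
  have := continuous_diracOp (c := c) (b := b) hu
  have := hu.continuous_fderiv one_ne_zero
  unfold sphericalOp
  fun_prop

lemma sphericalOp_eq_zero_of_notMem_tsupport {u : E → F} {x : E} (hx : x ∉ tsupport u) :
    sphericalOp c b u x = 0 := by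
  have : fderiv ℝ u x = 0 :=
    image_eq_zero_of_notMem_tsupport fun h' => hx (tsupport_fderiv_subset ℝ h')
  simp [sphericalOp_eq_sum, this]

lemma sphericalOp_comp_smul (u : E → F) (t : ℝ) (x : E) :
    sphericalOp c b (fun y => u (t • y)) x = sphericalOp c b u (t • x) := by
  have : fderiv ℝ (fun y => u (t • y)) x = t • fderiv ℝ u (t • x) := fderiv_comp_smul t
  rw [sphericalOp_eq_sum, sphericalOp_eq_sum, this]
  simp

lemma sphericalOp_smul_of_hasFDerivAt (hc : ∀ x v, c x (c x v) = -(‖x‖ ^ 2) • v) {ρ : E → ℝ}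
    {u : E → F} {s : ℝ} {x : E} (hρ : HasFDerivAt ρ (s • innerSL ℝ x) x)
    (hu : DifferentiableAt ℝ u x) :
    sphericalOp c b (fun y => ρ y • u y) x = ρ x • sphericalOp c b u x := by
  have h : fderiv ℝ (fun y => ρ y • u y) x = _ := (hρ.smul hu.hasFDerivAt).fderiv
  rw [sphericalOp, diracOp_smul_of_hasFDerivAt hρ hu, h]
  simp only [sphericalOp, map_add, map_smul, hc, smul_add]
  simp [smul_smul]
  abel

variable [FiniteDimensional ℝ E] [MeasurableSpace E] [BorelSpace E] (μ : Measure E)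
  [μ.IsAddHaarMeasure] {B : F →L[ℝ] F →L[ℝ] ℝ}

/-- The spherical Dirac operator is symmetric. -/
lemma integral_sphericalOp_symm (hc : ∀ x v, c x (c x v) = -(‖x‖ ^ 2) • v)
    (hB : ∀ x u v, B (c x u) v = -B u (c x v)) {u v : E → F} (hu : ContDiff ℝ 1 u)
    (hv : ContDiff ℝ 1 v) (hs : HasCompactSupport v) :
    ∫ x, B (sphericalOp c b u x) (v x) ∂μ = ∫ x, B (u x) (sphericalOp c b v x) ∂μ := by
  have hu' := hu.continuous
  have hv' := hv.continuous
  have hfu : Continuous (fderiv ℝ u) := hu.continuous_fderiv one_ne_zero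
  have hfv : Continuous (fderiv ℝ v) := hv.continuous_fderiv one_ne_zero
  have hv0 : ∀ x ∉ tsupport v, v x = 0 ∧ fderiv ℝ v x = 0 := fun x hx =>
    ⟨image_eq_zero_of_notMem_tsupport hx,
      image_eq_zero_of_notMem_tsupport fun h' => hx (tsupport_fderiv_subset ℝ h')⟩
  have hint : ∀ f : E → ℝ, Continuous f → (∀ x ∉ tsupport v, f x = 0) → Integrable f μ :=
    fun f hf h0 => hf.integrable_of_hasCompactSupport (HasCompactSupport.intro hs h0)
  have hskew : ∀ i x w z, B (sphericalCoeff c (b i) x w) z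
      = -B w (sphericalCoeff c (b i) x z) := by
    intro i x w z
    have h := clifford_anticomm hc x (b i) z
    have h' : c (b i) (c x z) = -(2 * inner ℝ x (b i)) • z - c x (c (b i) z) :=
      eq_sub_of_add_eq' h
    simp only [sphericalCoeff_apply, map_add, add_apply, map_smul, smul_apply,
      smul_eq_mul, hB, h', map_sub, real_inner_comm]
    ring
  have key : ∀ i, ∫ x, B (sphericalCoeff c (b i) x (fderiv ℝ u x (b i))) (v x) ∂μ
      = ∫ x, B (u x) (sphericalCoeff c (b i) x (fderiv ℝ v x (b i))) ∂μ := by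
    intro i
    have hg : ∀ x, HasFDerivAt (fun y => sphericalCoeff c (b i) y (v y)) _ x := fun x =>
      (sphericalCoeff c (b i)).hasFDerivAt.clm_apply
        (hv.differentiable one_ne_zero x).hasFDerivAt
    have hg' : ∀ x, fderiv ℝ (fun y => sphericalCoeff c (b i) y (v y)) x (b i)
        = sphericalCoeff c (b i) x (fderiv ℝ v x (b i)) := by
      intro x
      rw [(hg x).fderiv]
      simp [sphericalCoeff_apply, clifford_basis_sq hc]
    have h := integral_bilinear_fderiv_right_eq_neg_left_of_integrable (μ := μ) (f := u)
      (g := fun y => sphericalCoeff c (b i) y (v y)) (v := b i) (B := B) ?_ ?_ ?_ ?_ ?_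
    · simp_rw [hg'] at h
      rw [h, ← integral_neg]
      simp_rw [hskew]
    · exact hint _ (by fun_prop) fun x hx => by simp [(hv0 x hx).1]
    · simp_rw [hg']
      exact hint _ (by fun_prop) fun x hx => by simp [(hv0 x hx).2]
    · exact hint _ (by fun_prop) fun x hx => by simp [(hv0 x hx).1]
    · exact fun x _ => hu.differentiable one_ne_zero x
    · exact fun x _ => (hg x).differentiableAt
  simp only [sphericalOp_eq_sum, map_sum, sum_apply]
  rw [integral_finsetSum, integral_finsetSum]
  · simp_rw [key]
  · exact fun i _ => hint _ (by fun_prop) fun x hx => by simp [(hv0 x hx).2]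
  · exact fun i _ => hint _ (by fun_prop) fun x hx => by simp [(hv0 x hx).1]

omit [MeasurableSpace E] [BorelSpace E] [FiniteDimensional ℝ E] in
lemma contDiff_smul_of_notMem_tsupport {ρ : E → ℝ} (hρ : ContDiffOn ℝ 1 ρ {0}ᶜ) {u : E → F}
    (hu : ContDiff ℝ 1 u) (h0 : (0 : E) ∉ tsupport u) :
    ContDiff ℝ 1 (fun x => ρ x • u x) := by
  refine contDiff_iff_contDiffAt.2 fun x => ?_
  rcases eq_or_ne x 0 with rfl | hx
  · refine (contDiffAt_const (c := (0 : F))).congr_of_eventuallyEq ?_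
    filter_upwards [notMem_tsupport_iff_eventuallyEq.1 h0] with y hy
    simp [hy]
  · exact (hρ.contDiffAt (isOpen_compl_singleton.mem_nhds hx)).smul hu.contDiffAt

omit [MeasurableSpace E] [BorelSpace E] [FiniteDimensional ℝ E] in
lemma hasFDerivAt_comp_norm {f : ℝ → ℝ} {f' : ℝ} {x : E} (hx : x ≠ 0)
    (hf : HasDerivAt f f' ‖x‖) :
    HasFDerivAt (fun y : E => f ‖y‖) ((f' / ‖x‖) • innerSL ℝ x) x := by
  have h1 : HasFDerivAt (fun y : E => ‖y‖) (‖x‖⁻¹ • innerSL ℝ x) x := by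
    have h := (Real.hasDerivAt_sqrt (pow_ne_zero 2 (norm_ne_zero_iff.2 hx))).comp_hasFDerivAt x
      (hasStrictFDerivAt_norm_sq x).hasFDerivAt
    simp only [Function.comp_def, Real.sqrt_sq (norm_nonneg _)] at h
    refine h.congr_fderiv ?_
    ext y
    simp
    ring
  have h2 := hf.comp_hasFDerivAt x h1
  rwa [smul_smul, ← div_eq_mul_inv] at h2

omit [MeasurableSpace E] [BorelSpace E] [FiniteDimensional ℝ E] in
lemma contDiffOn_comp_norm {f : ℝ → ℝ} (hf : ContDiffOn ℝ 1 f (Set.Ioi 0)) :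
    ContDiffOn ℝ 1 (fun x : E => f ‖x‖) {0}ᶜ :=
  hf.comp (fun _ hx => (contDiffAt_norm ℝ hx).contDiffWithinAt) fun _ hx => norm_pos_iff.2 hx

omit [MeasurableSpace E] [BorelSpace E] [FiniteDimensional ℝ E] in
lemma hasFDerivAt_inv_norm_pow {x : E} (hx : x ≠ 0) (n : ℕ) : ∃ s : ℝ,
    HasFDerivAt (fun y : E => (‖y‖ ^ n)⁻¹) (s • innerSL ℝ x) x :=
  ⟨_, hasFDerivAt_comp_norm hx ((hasDerivAt_pow n ‖x‖).inv
    (pow_ne_zero _ (norm_ne_zero_iff.2 hx)))⟩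

omit [MeasurableSpace E] [BorelSpace E] [FiniteDimensional ℝ E] in
lemma contDiffOn_inv_norm_pow (n : ℕ) : ContDiffOn ℝ 1 (fun y : E => (‖y‖ ^ n)⁻¹) {0}ᶜ :=
  contDiffOn_comp_norm (f := fun r => (r ^ n)⁻¹)
    ((contDiff_id.pow n).contDiffOn.inv fun _ hr => pow_ne_zero _ (ne_of_gt hr))

/-- The spherical Dirac operator is symmetric for the dilation invariant measure. -/
lemma integral_invariant_sphericalOp_symm (hc : ∀ x v, c x (c x v) = -(‖x‖ ^ 2) • v)
    (hB : ∀ x u v, B (c x u) v = -B u (c x v)) {u v : E → F} (hu : ContDiff ℝ 1 u)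
    (hv : ContDiff ℝ 1 v) (hs : HasCompactSupport v) (h0 : (0 : E) ∉ tsupport v) :
    ∫ x, (‖x‖ ^ Module.finrank ℝ E)⁻¹ * B (sphericalOp c b u x) (v x) ∂μ
      = ∫ x, (‖x‖ ^ Module.finrank ℝ E)⁻¹ * B (u x) (sphericalOp c b v x) ∂μ := by
  have h := integral_sphericalOp_symm μ (b := b) hc hB hu
    (contDiff_smul_of_notMem_tsupport (contDiffOn_inv_norm_pow (Module.finrank ℝ E)) hv h0)
    hs.smul_left
  refine Eq.trans (by simp) (h.trans ?_)
  congr 1 with x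
  rcases eq_or_ne x 0 with rfl | hx
  · have h1 : (0 : E) ∉ tsupport fun y : E => (‖y‖ ^ Module.finrank ℝ E)⁻¹ • v y :=
      fun h' => h0 (tsupport_smul_subset_right _ _ h')
    rw [sphericalOp_eq_zero_of_notMem_tsupport h1, sphericalOp_eq_zero_of_notMem_tsupport h0]
    simp
  · obtain ⟨s, hs'⟩ := hasFDerivAt_inv_norm_pow hx (Module.finrank ℝ E)
    rw [sphericalOp_smul_of_hasFDerivAt hc hs' (hv.differentiable one_ne_zero x)]
    simp

/-- The radial derivative and the spherical Dirac operator are orthogonal on average. -/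
lemma integral_radial_sphericalOp_eq_zero (hc : ∀ x v, c x (c x v) = -(‖x‖ ^ 2) • v)
    (hB : ∀ x u v, B (c x u) v = -B u (c x v)) (hBs : ∀ u v, B u v = B v u) {w : E → F}
    (hw : ContDiff ℝ 1 w) (hs : HasCompactSupport w) (h0 : (0 : E) ∉ tsupport w) :
    ∫ x, (‖x‖ ^ Module.finrank ℝ E)⁻¹ * B (fderiv ℝ w x x) (sphericalOp c b w x) ∂μ = 0 := by
  set Q : ℝ → ℝ := fun s => ∫ x, (‖x‖ ^ Module.finrank ℝ E)⁻¹ *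
    B (w (Real.exp s • x)) (sphericalOp c b w x) ∂μ with hQ
  have hΓ : Continuous (sphericalOp c b w) := continuous_sphericalOp hw
  have hk : ContinuousOn (fun x : E => (‖x‖ ^ Module.finrank ℝ E)⁻¹ •
      B.flip (sphericalOp c b w x)) {0}ᶜ :=
    (contDiffOn_inv_norm_pow (Module.finrank ℝ E)).continuousOn.smul (by fun_prop)
  have hd := hasDerivAt_integral_dilation μ hk hw hs h0
  simp only [smul_apply, ContinuousLinearMap.flip_apply, smul_eq_mul] at hd
  have heven : ∀ s, Q (-s) = Q s := by
    intro s
    have h1 := integral_invariant_sphericalOp_symm μ (b := b) hc hB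
      (u := fun x => w (Real.exp s • x)) (hw.comp (contDiff_const_smul _)) hw hs h0
    rw [hQ]
    simp only
    rw [← h1, ← integral_dilation μ (fun x => B (w (Real.exp (-s) • x)) (sphericalOp c b w x))
      (Real.exp_pos s)]
    congr 1 with x
    rw [sphericalOp_comp_smul, smul_smul, ← Real.exp_add, hBs]
    simp
  set d : ℝ := ∫ x, (‖x‖ ^ Module.finrank ℝ E)⁻¹ *
    B (fderiv ℝ w x x) (sphericalOp c b w x) ∂μ
  have hd0 : HasDerivAt Q d (-0) := by rwa [neg_zero]
  have hd' : HasDerivAt (fun s => Q (-s)) (d * -1) 0 := hd0.comp 0 (hasDerivAt_neg 0)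
  simp_rw [heven] at hd'
  have := hd.unique hd'
  linarith

end SphericalOperator

section Carleman
variable {ι E F : Type*} [Fintype ι] [NormedAddCommGroup E] [InnerProductSpace ℝ E]
  [NormedAddCommGroup F] [InnerProductSpace ℝ F] {c : E →L[ℝ] F →L[ℝ] F}
  {b : OrthonormalBasis ι ℝ E} [FiniteDimensional ℝ E] [MeasurableSpace E] [BorelSpace E]
  (μ : Measure E) [μ.IsAddHaarMeasure] {B : F →L[ℝ] F →L[ℝ] ℝ}

/-- The multiplier `exp(τ(r²/2 - log r))`. -/
noncomputable def carlemanMultiplier (τ r : ℝ) : ℝ := Real.exp (τ * (r ^ 2 / 2 - Real.log r))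

/-- The weight `r^(2-n) exp(2τ(r²/2 - log r))`. -/
noncomputable def carlemanWeight (n : ℕ) (τ r : ℝ) : ℝ :=
  (r ^ n)⁻¹ * (r * carlemanMultiplier τ r) ^ 2

lemma hasDerivAt_carlemanMultiplier (τ : ℝ) {r : ℝ} (hr : 0 < r) :
    HasDerivAt (carlemanMultiplier τ) (carlemanMultiplier τ r * (τ * (r - r⁻¹))) r := by
  have h := (((hasDerivAt_pow 2 r).div_const 2).sub (Real.hasDerivAt_log hr.ne')).const_mul τ
  refine h.exp.congr_deriv ?_
  simp [carlemanMultiplier]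

lemma contDiffOn_carlemanMultiplier (τ : ℝ) :
    ContDiffOn ℝ 1 (carlemanMultiplier τ) (Set.Ioi 0) := by
  refine (contDiffOn_const.mul (((contDiff_id.pow 2).div_const 2).contDiffOn.sub ?_)).exp
  exact contDiffOn_id.log fun r hr => ne_of_gt hr

omit [FiniteDimensional ℝ E] [MeasurableSpace E] [BorelSpace E] in
/-- Pointwise form of the Carleman estimate. -/
lemma carleman_pointwise (hc : ∀ x v, c x (c x v) = -(‖x‖ ^ 2) • v)
    (hB : ∀ x u v, B (c x u) v = -B u (c x v)) (hBs : ∀ u v, B u v = B v u)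
    (hBp : ∀ v, 0 ≤ B v v) (x : E) (v a d e : F) {η : ℝ} (h : η • c x v = a - d - e) :
    2 * B d e - 2 * B d a ≤ (‖x‖ * η) ^ 2 * B v v := by
  have h1 : B (η • c x v) (η • c x v) = (‖x‖ * η) ^ 2 * B v v := by
    simp only [map_smul, smul_apply, smul_eq_mul]
    rw [hB, hc]
    simp
    ring
  rw [← h1, h]
  have h2 := hBp (a - e)
  have h3 := hBp d
  simp only [map_sub, sub_apply] at h2 ⊢
  have := hBs a d
  have := hBs a e
  have := hBs d e
  linarith

/-- Carleman estimate for the Dirac operator, for functions supported away from the origin. -/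
lemma carleman (hc : ∀ x v, c x (c x v) = -(‖x‖ ^ 2) • v)
    (hB : ∀ x u v, B (c x u) v = -B u (c x v)) (hBs : ∀ u v, B u v = B v u)
    (hBp : ∀ v, 0 ≤ B v v) (τ : ℝ) {u : E → F} (hu : ContDiff ℝ 1 u)
    (hs : HasCompactSupport u) (h0 : (0 : E) ∉ tsupport u) :
    2 * τ * ∫ x, carlemanWeight (Module.finrank ℝ E) τ ‖x‖ * B (u x) (u x) ∂μ
      ≤ ∫ x, carlemanWeight (Module.finrank ℝ E) τ ‖x‖ *
          B (diracOp c b u x) (diracOp c b u x) ∂μ := by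
  set n := Module.finrank ℝ E
  set w : E → F := fun x => carlemanMultiplier τ ‖x‖ • u x with hw
  have hηc : ContDiffOn ℝ 1 (fun x : E => carlemanMultiplier τ ‖x‖) {0}ᶜ :=
    contDiffOn_comp_norm (contDiffOn_carlemanMultiplier τ)
  have hwc : ContDiff ℝ 1 w := contDiff_smul_of_notMem_tsupport hηc hu h0
  have hws : HasCompactSupport w := hs.smul_left
  have hsub : tsupport w ⊆ tsupport u := tsupport_smul_subset_right _ _
  have hw0 : (0 : E) ∉ tsupport w := fun h' => h0 (hsub h')
  set g : E → ℝ := fun x => (τ * (1 - ‖x‖ ^ 2)) * B (w x) (w x) with hg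
  have hgc : ContDiff ℝ 1 g := by
    refine ContDiff.mul ?_ ((B.contDiff.comp hwc).clm_apply hwc)
    exact contDiff_const.mul (contDiff_const.sub (contDiff_norm_sq ℝ))
  have hu0 : ∀ x ∉ tsupport u, u x = 0 ∧ fderiv ℝ u x = 0 := fun x hx =>
    ⟨image_eq_zero_of_notMem_tsupport hx,
      image_eq_zero_of_notMem_tsupport fun h' => hx (tsupport_fderiv_subset ℝ h')⟩
  have hww0 : ∀ x ∉ tsupport u, w x = 0 ∧ fderiv ℝ w x = 0 := fun x hx =>
    ⟨image_eq_zero_of_notMem_tsupport fun h' => hx (hsub h'),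
      image_eq_zero_of_notMem_tsupport fun h' => hx (hsub (tsupport_fderiv_subset ℝ h'))⟩
  have hgs : HasCompactSupport g := HasCompactSupport.intro hs fun x hx => by
    simp [hg, (hww0 x hx).1]
  have hg0 : (0 : E) ∉ tsupport g := by
    refine fun h' => h0 (closure_minimal (fun x hx => ?_) (isClosed_tsupport u) h')
    by_contra hxu
    exact hx (by simp [hg, (hww0 x hxu).1])
  have hint : ∀ f : E → ℝ, ContinuousOn f {0}ᶜ → (∀ x ∉ tsupport u, f x = 0) →
      Integrable f μ := by
    intro f hf hf0
    refine (continuous_of_eventually_zero hf ?_).integrable_of_hasCompactSupport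
      (HasCompactSupport.intro hs hf0)
    filter_upwards [(isClosed_tsupport u).isOpen_compl.mem_nhds h0] with x hx
    exact hf0 x hx
  have hρ : ContinuousOn (fun x : E => (‖x‖ ^ n)⁻¹) {0}ᶜ := (contDiffOn_inv_norm_pow n).continuousOn
  have hη : ContinuousOn (fun x : E => carlemanMultiplier τ ‖x‖) {0}ᶜ := hηc.continuousOn
  have hW : ContinuousOn (fun x : E => carlemanWeight n τ ‖x‖) {0}ᶜ :=
    hρ.mul ((continuous_norm.continuousOn.mul hη).pow 2)
  have hDu := continuous_diracOp (c := c) (b := b) hu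
  have hΓ := continuous_sphericalOp (c := c) (b := b) hwc
  have hu' := hu.continuous
  have hw' := hwc.continuous
  have hfw : Continuous (fderiv ℝ w) := hwc.continuous_fderiv one_ne_zero
  have hfg : Continuous (fderiv ℝ g) := hgc.continuous_fderiv one_ne_zero
  have I1 := integral_radial_fderiv_eq_zero μ hgc hgs hg0
  have I2 := integral_radial_sphericalOp_eq_zero μ (b := b) hc hB hBs hwc hws hw0
  have hgz : ∀ x ∉ tsupport u, fderiv ℝ g x = 0 := fun x hx => by
    refine image_eq_zero_of_notMem_tsupport fun h' => hx ?_
    refine closure_minimal (fun x hx => ?_) (isClosed_tsupport u) (tsupport_fderiv_subset ℝ h')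
    by_contra hxu
    exact hx (by simp [hg, (hww0 x hxu).1])
  have int1 : Integrable (fun x => carlemanWeight n τ ‖x‖ * B (u x) (u x)) μ :=
    hint _ (hW.mul (by fun_prop)) fun x hx => by simp [(hu0 x hx).1]
  have int2 : Integrable (fun x => (‖x‖ ^ n)⁻¹ * fderiv ℝ g x x) μ :=
    hint _ (hρ.mul (by fun_prop)) fun x hx => by simp [hgz x hx]
  have int3 : Integrable (fun x => (‖x‖ ^ n)⁻¹ * B (fderiv ℝ w x x) (sphericalOp c b w x)) μ :=
    hint _ (hρ.mul (by fun_prop)) fun x hx => by simp [(hww0 x hx).2]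
  have int4 : Integrable (fun x => carlemanWeight n τ ‖x‖ *
      B (diracOp c b u x) (diracOp c b u x)) μ :=
    hint _ (hW.mul (by fun_prop)) fun x hx => by
      simp [diracOp, (hu0 x hx).2, cliffordContract]
  have hpt : ∀ x, (‖x‖ ^ n)⁻¹ * fderiv ℝ g x x
      + 2 * τ * (carlemanWeight n τ ‖x‖ * B (u x) (u x))
      - 2 * ((‖x‖ ^ n)⁻¹ * B (fderiv ℝ w x x) (sphericalOp c b w x))
      ≤ carlemanWeight n τ ‖x‖ * B (diracOp c b u x) (diracOp c b u x) := by
    intro x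
    rcases eq_or_ne x 0 with rfl | hx
    · simp [(hu0 0 h0).1, sphericalOp_eq_zero_of_notMem_tsupport hw0, diracOp, (hu0 0 h0).2,
        cliffordContract]
    have hr : 0 < ‖x‖ := norm_pos_iff.2 hx
    have hηd := hasFDerivAt_comp_norm hx (hasDerivAt_carlemanMultiplier τ hr)
    have hud := hu.differentiable one_ne_zero x
    have hwd : HasFDerivAt w _ x := hηd.smul hud.hasFDerivAt
    have hXw : fderiv ℝ w x x = carlemanMultiplier τ ‖x‖ • fderiv ℝ u x x
        - (τ * (1 - ‖x‖ ^ 2)) • w x := by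
      rw [hwd.fderiv]
      simp only [add_apply, smul_apply, ContinuousLinearMap.smulRight_apply, innerSL_apply_apply,
        real_inner_self_eq_norm_sq, hw, smul_smul, smul_eq_mul, sub_eq_add_neg, ← neg_smul]
      congr 2
      field_simp
      ring
    have hΓw : sphericalOp c b w x = carlemanMultiplier τ ‖x‖ • sphericalOp c b u x :=
      sphericalOp_smul_of_hasFDerivAt hc hηd hud
    have hD : carlemanMultiplier τ ‖x‖ • c x (diracOp c b u x)
        = sphericalOp c b w x - fderiv ℝ w x x - (τ * (1 - ‖x‖ ^ 2)) • w x := by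
      rw [hΓw, hXw, sphericalOp, smul_add]
      abel
    have hXg : fderiv ℝ g x x = 2 * B (fderiv ℝ w x x) ((τ * (1 - ‖x‖ ^ 2)) • w x)
        - 2 * τ * ‖x‖ ^ 2 * B (w x) (w x) := by
      have h1 : HasFDerivAt (fun y : E => τ * (1 - ‖y‖ ^ 2)) _ x :=
        ((hasStrictFDerivAt_norm_sq x).hasFDerivAt.const_sub 1).const_mul τ
      have h2 : HasFDerivAt (fun y => B (w y) (w y)) _ x :=
        (B.hasFDerivAt.comp x hwd.differentiableAt.hasFDerivAt).clm_apply
          hwd.differentiableAt.hasFDerivAt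
      have h3 : HasFDerivAt g _ x := h1.mul h2
      rw [h3.fderiv]
      simp [hBs (w x) (fderiv ℝ w x x)]
      ring
    have hp := carleman_pointwise hc hB hBs hBp x _ _ _ _ hD
    have hBw : B (w x) (w x) = carlemanMultiplier τ ‖x‖ ^ 2 * B (u x) (u x) := by
      simp [hw]; ring
    have hρ0 : 0 ≤ (‖x‖ ^ n)⁻¹ := by positivity
    have hp' := mul_le_mul_of_nonneg_left hp hρ0
    rw [hXg, hBw]
    unfold carlemanWeight
    linarith
  have hmono := integral_mono ((int2.add (int1.const_mul (2 * τ))).sub (int3.const_mul 2)) int4 hpt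
  rw [integral_sub' (int2.add (int1.const_mul (2 * τ))) (int3.const_mul 2),
    integral_add' int2 (int1.const_mul (2 * τ)), integral_const_mul, integral_const_mul, I1, I2]
    at hmono
  simpa using hmono

end Carleman

section CarlemanWeight

lemma carlemanMultiplier_pos (τ r : ℝ) : 0 < carlemanMultiplier τ r := Real.exp_pos _

lemma carlemanWeight_nonneg (n : ℕ) (τ : ℝ) {r : ℝ} (hr : 0 ≤ r) : 0 ≤ carlemanWeight n τ r := by
  unfold carlemanWeight
  positivity

lemma carlemanWeight_pos (n : ℕ) (τ : ℝ) {r : ℝ} (hr : 0 < r) : 0 < carlemanWeight n τ r := by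
  have := carlemanMultiplier_pos τ r
  unfold carlemanWeight
  positivity

lemma measurable_carlemanWeight (n : ℕ) (τ : ℝ) : Measurable (carlemanWeight n τ) := by
  unfold carlemanWeight carlemanMultiplier
  fun_prop

lemma carlemanMultiplier_anti {τ : ℝ} (hτ : 0 ≤ τ) {r s : ℝ} (hs : 0 < s) (hsr : s ≤ r)
    (hr : r ≤ 1) : carlemanMultiplier τ r ≤ carlemanMultiplier τ s := by
  have hr0 : 0 < r := hs.trans_le hsr
  refine Real.exp_le_exp.2 (mul_le_mul_of_nonneg_left ?_ hτ)
  have h := Real.one_sub_inv_le_log_of_pos (div_pos hr0 hs)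
  rw [Real.log_div hr0.ne' hs.ne', inv_div] at h
  have h2 : (r - s) * ((r + s) / 2) ≤ (r - s) * (1 / r) := by
    refine mul_le_mul_of_nonneg_left ?_ (by linarith)
    have : 1 ≤ 1 / r := by rw [le_div_iff₀ hr0]; linarith
    linarith
  have h3 : (r - s) * (1 / r) = 1 - s / r := by field_simp
  nlinarith

lemma carlemanWeight_anti {n : ℕ} (hn : 2 ≤ n) {τ : ℝ} (hτ : 0 ≤ τ) {r s : ℝ} (hs : 0 < s)
    (hsr : s ≤ r) (hr : r ≤ 1) : carlemanWeight n τ r ≤ carlemanWeight n τ s := by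
  obtain ⟨k, rfl⟩ := Nat.exists_eq_add_of_le' hn
  have hr0 : 0 < r := hs.trans_le hsr
  have e : ∀ t : ℝ, 0 < t →
      carlemanWeight (k + 2) τ t = (t ^ k)⁻¹ * carlemanMultiplier τ t ^ 2 := by
    intro t ht
    unfold carlemanWeight
    field_simp
    ring
  rw [e r hr0, e s hs]
  have := (carlemanMultiplier_pos τ r).le
  have := carlemanMultiplier_anti hτ hs hsr hr
  gcongr

lemma exists_carlemanWeight_mul_pow_le (n : ℕ) {τ : ℝ} (hτ : 0 ≤ τ) (R : ℝ) :
    ∃ (m : ℕ) (M : ℝ), 0 ≤ M ∧ ∀ r, 0 ≤ r → r ≤ R → carlemanWeight n τ r * (r ^ m) ^ 2 ≤ M := by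
  rcases lt_or_ge R 0 with hR | hR
  · exact ⟨0, 0, le_rfl, fun r h1 h2 => absurd (h1.trans h2) (not_le.2 hR)⟩
  refine ⟨n + ⌈τ⌉₊, R ^ 2 * R ^ n * (Real.exp (τ * R ^ 2 / 2) * R ^ ((⌈τ⌉₊ : ℝ) - τ)) ^ 2,
    by positivity, fun r hr hrR => ?_⟩
  rcases hr.eq_or_lt with rfl | hr0
  · simp only [carlemanWeight, zero_mul, ne_eq, OfNat.ofNat_ne_zero, not_false_eq_true, zero_pow,
      mul_zero]
    positivity
  have h1 : carlemanMultiplier τ r * r ^ ⌈τ⌉₊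
      = Real.exp (τ * r ^ 2 / 2) * r ^ ((⌈τ⌉₊ : ℝ) - τ) := by
    rw [Real.rpow_sub hr0, Real.rpow_natCast, Real.rpow_def_of_pos hr0, carlemanMultiplier,
      show τ * (r ^ 2 / 2 - Real.log r) = τ * r ^ 2 / 2 - Real.log r * τ by ring, Real.exp_sub]
    ring
  have h2 : carlemanWeight n τ r * (r ^ (n + ⌈τ⌉₊)) ^ 2
      = r ^ 2 * r ^ n * (carlemanMultiplier τ r * r ^ ⌈τ⌉₊) ^ 2 := by
    unfold carlemanWeight
    field_simp
    ring
  have h3 : r ^ ((⌈τ⌉₊ : ℝ) - τ) ≤ R ^ ((⌈τ⌉₊ : ℝ) - τ) :=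
    Real.rpow_le_rpow hr hrR (sub_nonneg.2 (Nat.le_ceil τ))
  rw [h2, h1]
  gcongr

end CarlemanWeight

section FlatCarleman
variable {ι E F : Type*} [Fintype ι] [NormedAddCommGroup E] [InnerProductSpace ℝ E]
  [NormedAddCommGroup F] [InnerProductSpace ℝ F] {c : E →L[ℝ] F →L[ℝ] F}
  {b : OrthonormalBasis ι ℝ E} [FiniteDimensional ℝ E] [MeasurableSpace E] [BorelSpace E]
  (μ : Measure E) [μ.IsAddHaarMeasure] {B : F →L[ℝ] F →L[ℝ] ℝ}

omit [InnerProductSpace ℝ E] [FiniteDimensional ℝ E] in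
lemma integrable_of_norm_le_indicator {f : E → ℝ}
    (hf : AEStronglyMeasurable f μ) {K : Set E} (hK : IsCompact K) {M : ℝ}
    (h : ∀ x, ‖f x‖ ≤ K.indicator (fun _ => M) x) : Integrable f μ :=
  Integrable.mono' ((integrable_indicator_iff hK.measurableSet).2
    (integrableOn_const hK.measure_lt_top.ne)) hf (Filter.Eventually.of_forall h)

omit [InnerProductSpace ℝ E] [μ.IsAddHaarMeasure] [FiniteDimensional ℝ E] in
lemma aestronglyMeasurable_carlemanWeight_mul (n : ℕ) (τ : ℝ) {f : E → ℝ} (hf : Continuous f) :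
    AEStronglyMeasurable (fun x => carlemanWeight n τ ‖x‖ * f x) μ :=
  (((measurable_carlemanWeight n τ).comp measurable_norm).mul
    hf.measurable).aestronglyMeasurable

omit [MeasurableSpace E] [BorelSpace E] in
/-- A family of cutoffs vanishing near the origin with scale invariant gradient bounds. -/
lemma exists_cutoff_seq : ∃ (ζ : ℕ → E → ℝ) (D : ℝ), 0 ≤ D ∧ (∀ k, ContDiff ℝ 1 (ζ k)) ∧
    (∀ k, ζ k =ᶠ[nhds 0] 0) ∧ (∀ k x, 0 ≤ ζ k x ∧ ζ k x ≤ 1) ∧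
    (∀ k x, ‖fderiv ℝ (ζ k) x‖ * ‖x‖ ≤ D) ∧
    ∀ x ≠ 0, ∀ᶠ k in Filter.atTop, ζ k x = 1 ∧ fderiv ℝ (ζ k) x = 0 := by
  let χ : ContDiffBump (0 : E) := ⟨1, 2, by norm_num, by norm_num⟩
  have hχs : ContDiff ℝ 1 χ := χ.contDiff
  obtain ⟨D, hD⟩ := (χ.hasCompactSupport.fderiv ℝ).exists_bound_of_continuous
    (hχs.continuous_fderiv one_ne_zero)
  have hD0 : 0 ≤ D := (norm_nonneg _).trans (hD 0)
  have hfd0 : ∀ y : E, 2 < ‖y‖ → fderiv ℝ χ y = 0 := by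
    intro y hy
    refine image_eq_zero_of_notMem_tsupport fun h => ?_
    have := tsupport_fderiv_subset ℝ h
    rw [χ.tsupport_eq, mem_closedBall_zero_iff] at this
    exact absurd this (not_le.2 hy)
  have hfd : ∀ (k : ℕ) (x : E), fderiv ℝ (fun x => 1 - χ (((k : ℝ) + 1) • x)) x
      = -(((k : ℝ) + 1) • fderiv ℝ χ (((k : ℝ) + 1) • x)) := by
    intro k x
    rw [fderiv_const_sub]
    congr 1
    exact fderiv_comp_smul (f := χ) ((k : ℝ) + 1)
  have hn : ∀ (k : ℕ) (x : E), ‖((k : ℝ) + 1) • x‖ = ((k : ℝ) + 1) * ‖x‖ := fun k x => by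
    rw [norm_smul, Real.norm_of_nonneg (by positivity)]
  refine ⟨fun k x => 1 - χ (((k : ℝ) + 1) • x), D * 2, by positivity, fun k => ?_, fun k => ?_,
    fun k x => ⟨by linarith [χ.le_one (x := ((k : ℝ) + 1) • x)],
      by linarith [χ.nonneg (x := ((k : ℝ) + 1) • x)]⟩, fun k x => ?_, fun x hx => ?_⟩
  · exact contDiff_const.sub (hχs.comp (contDiff_const_smul _))
  · have : Filter.Tendsto (fun x : E => ((k : ℝ) + 1) • x) (nhds 0) (nhds 0) := by
      simpa using (continuous_const_smul ((k : ℝ) + 1)).tendsto (0 : E)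
    filter_upwards [this.eventually χ.eventuallyEq_one] with x hx
    simp [hx]
  · rw [hfd, norm_neg]
    rcases lt_or_ge 2 ‖((k : ℝ) + 1) • x‖ with h | h
    · rw [hfd0 _ h]
      simp [hD0]
    · rw [hn] at h
      rw [norm_smul, Real.norm_of_nonneg (by positivity),
        show ((k : ℝ) + 1) * ‖fderiv ℝ χ (((k : ℝ) + 1) • x)‖ * ‖x‖
          = ‖fderiv ℝ χ (((k : ℝ) + 1) • x)‖ * (((k : ℝ) + 1) * ‖x‖) by ring]
      gcongr
      exact hD _
  · have hx0 : 0 < ‖x‖ := norm_pos_iff.2 hx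
    filter_upwards [Filter.eventually_gt_atTop ⌈2 / ‖x‖⌉₊] with k hk
    have h2 : 2 < ‖((k : ℝ) + 1) • x‖ := by
      have := (Nat.le_ceil (2 / ‖x‖)).trans_lt (Nat.cast_lt.2 hk)
      rw [div_lt_iff₀ hx0] at this
      rw [hn]
      nlinarith
    refine ⟨?_, by rw [hfd, hfd0 _ h2]; simp⟩
    rw [χ.zero_of_le_dist (by rw [dist_zero_right]; exact h2.le), sub_zero]

/-- Carleman estimate for functions vanishing to infinite order at the origin. -/
lemma carleman_of_flat (hc : ∀ x v, c x (c x v) = -(‖x‖ ^ 2) • v)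
    (hB : ∀ x u v, B (c x u) v = -B u (c x v)) (hBs : ∀ u v, B u v = B v u)
    (hBp : ∀ v, 0 ≤ B v v) {τ : ℝ} (hτ : 0 ≤ τ) {u : E → F} (hu : ContDiff ℝ 1 u)
    (hs : HasCompactSupport u)
    (hflat : ∀ k : ℕ, ∃ A, ∀ x, ‖u x‖ ≤ A * ‖x‖ ^ k ∧ ‖diracOp c b u x‖ ≤ A * ‖x‖ ^ k) :
    Integrable (fun x => carlemanWeight (Module.finrank ℝ E) τ ‖x‖ * B (u x) (u x)) μ ∧
    Integrable (fun x => carlemanWeight (Module.finrank ℝ E) τ ‖x‖ *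
      B (diracOp c b u x) (diracOp c b u x)) μ ∧
    2 * τ * ∫ x, carlemanWeight (Module.finrank ℝ E) τ ‖x‖ * B (u x) (u x) ∂μ
      ≤ ∫ x, carlemanWeight (Module.finrank ℝ E) τ ‖x‖ *
          B (diracOp c b u x) (diracOp c b u x) ∂μ := by
  set n := Module.finrank ℝ E
  obtain ⟨R, hR0, hR⟩ := hs.isCompact.isBounded.subset_closedBall_lt 0 0
  obtain ⟨m, M, hM0, hM⟩ := exists_carlemanWeight_mul_pow_le n hτ R
  obtain ⟨A₀, hA₀⟩ := hflat m
  obtain ⟨A₁, hA₁⟩ := hflat (m + 1)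
  obtain ⟨C', hC'0, hC'⟩ := exists_norm_cliffordContract_le c b
  obtain ⟨ζ, D, hD0, hζs, hζ0, hζ1, hζD, hζe⟩ := exists_cutoff_seq (E := E)
  set T : ℝ := |A₀| + C' * (D * |A₁|) with hT
  have hu' := hu.continuous
  have hDu := continuous_diracOp (c := c) (b := b) hu
  have hu0 : ∀ x ∉ tsupport u, u x = 0 ∧ fderiv ℝ u x = 0 := fun x hx =>
    ⟨image_eq_zero_of_notMem_tsupport hx,
      image_eq_zero_of_notMem_tsupport fun h' => hx (tsupport_fderiv_subset ℝ h')⟩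
  have hDu0 : ∀ x ∉ tsupport u, diracOp c b u x = 0 := fun x hx => by
    simp [diracOp, (hu0 x hx).2, cliffordContract]
  have hu1 : ∀ x, ‖u x‖ ≤ |A₀| * ‖x‖ ^ m := fun x =>
    (hA₀ x).1.trans (by gcongr; exact le_abs_self _)
  have hDu1 : ∀ x, ‖diracOp c b u x‖ ≤ |A₀| * ‖x‖ ^ m := fun x =>
    (hA₀ x).2.trans (by gcongr; exact le_abs_self _)
  have hT0 : |A₀| ≤ T := le_add_of_nonneg_right (by positivity)
  have hbound : ∀ (x : E) (v : F), ‖v‖ ≤ T * ‖x‖ ^ m → (x ∉ tsupport u → v = 0) →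
      ‖carlemanWeight n τ ‖x‖ * B v v‖ ≤ (tsupport u).indicator (fun _ => ‖B‖ * T ^ 2 * M) x := by
    intro x v hv hv0
    by_cases hx : x ∈ tsupport u
    · rw [Set.indicator_of_mem hx, norm_mul,
        Real.norm_of_nonneg (carlemanWeight_nonneg n τ (norm_nonneg x))]
      have h1 : ‖B v v‖ ≤ ‖B‖ * (T * ‖x‖ ^ m) ^ 2 := by
        refine (B.le_opNorm₂ v v).trans ?_
        rw [mul_assoc, ← sq]
        gcongr
      have h2 := hM ‖x‖ (norm_nonneg x) (mem_closedBall_zero_iff.1 (hR hx))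
      calc carlemanWeight n τ ‖x‖ * ‖B v v‖
          ≤ carlemanWeight n τ ‖x‖ * (‖B‖ * (T * ‖x‖ ^ m) ^ 2) :=
            mul_le_mul_of_nonneg_left h1 (carlemanWeight_nonneg n τ (norm_nonneg x))
        _ = ‖B‖ * T ^ 2 * (carlemanWeight n τ ‖x‖ * (‖x‖ ^ m) ^ 2) := by ring
        _ ≤ ‖B‖ * T ^ 2 * M := by gcongr
    · rw [Set.indicator_of_notMem hx, hv0 hx]
      simp
  have hle : ∀ {x : E} {v : F}, ‖v‖ ≤ |A₀| * ‖x‖ ^ m → ‖v‖ ≤ T * ‖x‖ ^ m := fun h =>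
    h.trans (by gcongr)
  have i1 : Integrable (fun x => carlemanWeight n τ ‖x‖ * B (u x) (u x)) μ :=
    integrable_of_norm_le_indicator μ
      (aestronglyMeasurable_carlemanWeight_mul μ n τ (by fun_prop)) hs
      fun x => hbound x _ (hle (hu1 x)) fun hx => (hu0 x hx).1
  have i2 : Integrable (fun x => carlemanWeight n τ ‖x‖ *
      B (diracOp c b u x) (diracOp c b u x)) μ :=
    integrable_of_norm_le_indicator μ
      (aestronglyMeasurable_carlemanWeight_mul μ n τ (by fun_prop)) hs
      fun x => hbound x _ (hle (hDu1 x)) (hDu0 x)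
  refine ⟨i1, i2, ?_⟩
  have hcut : ∀ k, ContDiff ℝ 1 (fun x => ζ k x • u x) := fun k => (hζs k).smul hu
  have hcar : ∀ k, 2 * τ * ∫ x, carlemanWeight n τ ‖x‖ * B (ζ k x • u x) (ζ k x • u x) ∂μ
      ≤ ∫ x, carlemanWeight n τ ‖x‖ * B (diracOp c b (fun x => ζ k x • u x) x)
          (diracOp c b (fun x => ζ k x • u x) x) ∂μ := by
    intro k
    refine carleman μ hc hB hBs hBp τ (hcut k) hs.smul_left ?_
    exact fun h' => notMem_tsupport_iff_eventuallyEq.2 (hζ0 k) (tsupport_smul_subset_left _ _ h')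
  have hDk : ∀ k x, diracOp c b (fun x => ζ k x • u x) x = ζ k x • diracOp c b u x
      + cliffordContract c b ((fderiv ℝ (ζ k) x).smulRight (u x)) := fun k x =>
    diracOp_smul ((hζs k).differentiable one_ne_zero x) (hu.differentiable one_ne_zero x)
  have dom : Integrable ((tsupport u).indicator (fun _ => ‖B‖ * T ^ 2 * M)) μ :=
    (integrable_indicator_iff hs.isCompact.measurableSet).2
      (integrableOn_const hs.isCompact.measure_lt_top.ne)
  have L1 : Filter.Tendsto (fun k => ∫ x, carlemanWeight n τ ‖x‖ *
      B (ζ k x • u x) (ζ k x • u x) ∂μ) Filter.atTop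
      (nhds (∫ x, carlemanWeight n τ ‖x‖ * B (u x) (u x) ∂μ)) := by
    refine tendsto_integral_of_dominated_convergence _ (fun k => ?_) dom (fun k => ?_) ?_
    · have := (hcut k).continuous
      exact aestronglyMeasurable_carlemanWeight_mul μ n τ (by fun_prop)
    · refine Filter.Eventually.of_forall fun x => hbound x _ (hle ?_) fun hx => by
        rw [(hu0 x hx).1, smul_zero]
      rw [norm_smul, Real.norm_of_nonneg (hζ1 k x).1]
      exact (mul_le_of_le_one_left (norm_nonneg _) (hζ1 k x).2).trans (hu1 x)
    · refine Filter.Eventually.of_forall fun x => ?_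
      rcases eq_or_ne x 0 with rfl | hx
      · simp [carlemanWeight]
      · refine tendsto_const_nhds.congr' ?_
        filter_upwards [hζe x hx] with k hk
        rw [hk.1, one_smul]
  have L2 : Filter.Tendsto (fun k => ∫ x, carlemanWeight n τ ‖x‖ *
      B (diracOp c b (fun x => ζ k x • u x) x) (diracOp c b (fun x => ζ k x • u x) x) ∂μ)
      Filter.atTop (nhds (∫ x, carlemanWeight n τ ‖x‖ *
        B (diracOp c b u x) (diracOp c b u x) ∂μ)) := by
    refine tendsto_integral_of_dominated_convergence _ (fun k => ?_) dom (fun k => ?_) ?_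
    · have := continuous_diracOp (c := c) (b := b) (hcut k)
      exact aestronglyMeasurable_carlemanWeight_mul μ n τ (by fun_prop)
    · refine Filter.Eventually.of_forall fun x => hbound x _ ?_ fun hx => by
        rw [hDk, hDu0 x hx, (hu0 x hx).1]
        simp [cliffordContract]
      rw [hDk, hT, add_mul]
      refine (norm_add_le _ _).trans (add_le_add ?_ ((hC' _).trans ?_))
      · rw [norm_smul, Real.norm_of_nonneg (hζ1 k x).1]
        exact (mul_le_of_le_one_left (norm_nonneg _) (hζ1 k x).2).trans (hDu1 x)
      · rw [ContinuousLinearMap.norm_smulRight_apply, mul_assoc, mul_assoc]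
        have h1 : ‖u x‖ ≤ |A₁| * ‖x‖ ^ (m + 1) :=
          (hA₁ x).1.trans (by gcongr; exact le_abs_self _)
        refine mul_le_mul_of_nonneg_left ?_ hC'0
        calc ‖fderiv ℝ (ζ k) x‖ * ‖u x‖ ≤ ‖fderiv ℝ (ζ k) x‖ * (|A₁| * ‖x‖ ^ (m + 1)) := by gcongr
          _ = (‖fderiv ℝ (ζ k) x‖ * ‖x‖) * (|A₁| * ‖x‖ ^ m) := by ring
          _ ≤ D * (|A₁| * ‖x‖ ^ m) := by gcongr; exact hζD k x
    · refine Filter.Eventually.of_forall fun x => ?_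
      rcases eq_or_ne x 0 with rfl | hx
      · simp [carlemanWeight]
      · refine tendsto_const_nhds.congr' ?_
        filter_upwards [hζe x hx] with k hk
        rw [hDk, hk.1, hk.2]
        simp [cliffordContract]
  exact le_of_tendsto_of_tendsto' (L1.const_mul _) L2 hcar

end FlatCarleman

section UniqueContinuation
variable {ι E F : Type*} [Fintype ι] [NormedAddCommGroup E] [InnerProductSpace ℝ E]
  [NormedAddCommGroup F] [InnerProductSpace ℝ F] {c : E →L[ℝ] F →L[ℝ] F}
  {b : OrthonormalBasis ι ℝ E} [FiniteDimensional ℝ E]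

/-- A family of bounds forcing the vanishing of a nonnegative quantity. -/
lemma eq_zero_of_forall_mul_le {I a K : ℝ} (hI : 0 ≤ I)
    (h : ∀ τ : ℝ, 0 ≤ τ → (2 * τ - a) * I ≤ K) : I = 0 := by
  by_contra hne
  have hpos : 0 < I := lt_of_le_of_ne hI (Ne.symm hne)
  have h1 := h ((|a| + (|K| + 1) / I) / 2) (by positivity)
  have h2 : (|K| + 1) / I * I = |K| + 1 := by field_simp
  have h3 : (2 * ((|a| + (|K| + 1) / I) / 2) - a) * I = (|a| - a) * I + (|K| + 1) := by
    rw [sub_mul, sub_mul, mul_div_cancel₀ _ two_ne_zero, add_mul, h2]; ring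
  have h4 : 0 ≤ (|a| - a) * I := mul_nonneg (by linarith [le_abs_self a]) hI
  linarith [le_abs_self K]

/-- A compactly supported flat function whose Dirac derivative is controlled by the function near
the origin vanishes there. -/
lemma eq_zero_of_flat (hn : 2 ≤ Module.finrank ℝ E)
    (hc : ∀ x v, c x (c x v) = -(‖x‖ ^ 2) • v) {u : E → F} (hu : ContDiff ℝ 1 u)
    (hs1 : tsupport u ⊆ Metric.closedBall 0 1)
    (hflat : ∀ k : ℕ, ∃ A, ∀ x, ‖u x‖ ≤ A * ‖x‖ ^ k ∧ ‖diracOp c b u x‖ ≤ A * ‖x‖ ^ k)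
    {ρ L : ℝ} (hρ : 0 < ρ) (hρ1 : ρ ≤ 1)
    (hDu : ∀ x ∈ Metric.ball (0 : E) ρ, ‖diracOp c b u x‖ ≤ L * ‖u x‖) :
    ∀ x ∈ Metric.ball (0 : E) ρ, u x = 0 := by
  let _ : MeasurableSpace E := borel E
  have _ : BorelSpace E := ⟨rfl⟩
  set μ : Measure E := volume
  have hs : HasCompactSupport u :=
    (isCompact_closedBall (0 : E) 1).of_isClosed_subset (isClosed_tsupport u) hs1
  obtain ⟨B, hBs, hBp, hB⟩ := exists_invariant_form b hc
  have hBp0 : ∀ v, 0 ≤ B v v := fun v => (sq_nonneg _).trans (hBp v)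
  have hBle : ∀ v, B v v ≤ ‖B‖ * ‖v‖ ^ 2 := fun v => by
    rw [sq, ← mul_assoc]
    exact (le_abs_self _).trans (B.le_opNorm₂ v v)
  have hu' := hu.continuous
  have hDuc := continuous_diracOp (c := c) (b := b) hu
  set n := Module.finrank ℝ E
  set S : Set E := Metric.ball (0 : E) ρ
  have hS : MeasurableSet S := measurableSet_ball
  obtain ⟨M, hM⟩ := hs.diracOp.exists_bound_of_continuous hDuc
  have hM0 : 0 ≤ M := (norm_nonneg _).trans (hM 0)
  set K := tsupport u
  have hK : IsCompact K := hs
  have hu0 : ∀ x ∉ K, u x = 0 ∧ diracOp c b u x = 0 := fun x hx => by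
    have : fderiv ℝ u x = 0 :=
      image_eq_zero_of_notMem_tsupport fun h' => hx (tsupport_fderiv_subset ℝ h')
    exact ⟨image_eq_zero_of_notMem_tsupport hx, by simp [diracOp, this, cliffordContract]⟩
  have hIS : Integrable (S.indicator fun x => ‖u x‖ ^ 2) μ := by
    rw [integrable_indicator_iff hS]
    exact ((hu'.norm.pow 2).integrable_of_hasCompactSupport
      (HasCompactSupport.intro hs fun x hx => by
        simp [image_eq_zero_of_notMem_tsupport hx])).integrableOn
  have hIK : Integrable (K.indicator fun _ => ‖B‖ * M ^ 2) μ :=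
    (integrable_indicator_iff hK.measurableSet).2 (integrableOn_const hK.measure_lt_top.ne)
  have key : ∀ τ : ℝ, 0 ≤ τ → (2 * τ - ‖B‖ * L ^ 2) * ∫ x, S.indicator (fun x => ‖u x‖ ^ 2) x ∂μ
      ≤ ∫ x, K.indicator (fun _ => ‖B‖ * M ^ 2) x ∂μ := by
    intro τ hτ
    obtain ⟨i1, i2, h⟩ := carleman_of_flat μ hc hB hBs hBp0 hτ hu hs hflat
    have hW0 : 0 < carlemanWeight n τ ρ := carlemanWeight_pos n τ hρ
    rcases le_total (2 * τ - ‖B‖ * L ^ 2) 0 with hneg | hpos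
    · refine (mul_nonpos_of_nonpos_of_nonneg hneg ?_).trans ?_
      · exact integral_nonneg fun x => Set.indicator_nonneg (fun _ _ => sq_nonneg _) x
      · exact integral_nonneg fun x => Set.indicator_nonneg (fun _ _ => by positivity) x
    have hpt : ∀ x, (2 * τ - ‖B‖ * L ^ 2) * S.indicator (fun x => ‖u x‖ ^ 2) x
        ≤ K.indicator (fun _ => ‖B‖ * M ^ 2) x + (carlemanWeight n τ ρ)⁻¹ *
        (2 * τ * (carlemanWeight n τ ‖x‖ * B (u x) (u x)) -
          carlemanWeight n τ ‖x‖ * B (diracOp c b u x) (diracOp c b u x)) := by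
      intro x
      have hK0 : 0 ≤ K.indicator (fun _ => ‖B‖ * M ^ 2) x :=
        Set.indicator_nonneg (fun _ _ => by positivity) x
      have hW := carlemanWeight_nonneg n τ (norm_nonneg x)
      rw [inv_mul_eq_div]
      by_cases hxS : x ∈ S
      · rw [Set.indicator_of_mem hxS]
        rcases eq_or_ne x 0 with rfl | hx
        · obtain ⟨A, hA⟩ := hflat 1
          have : u 0 = 0 := by simpa using (hA 0).1
          simpa [this, carlemanWeight] using hK0
        have hxρ : ‖x‖ < ρ := mem_ball_zero_iff.1 hxS
        have hanti := carlemanWeight_anti hn hτ (norm_pos_iff.2 hx) hxρ.le hρ1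
        have hD : B (diracOp c b u x) (diracOp c b u x) ≤ ‖B‖ * L ^ 2 * ‖u x‖ ^ 2 := by
          refine (hBle _).trans ?_
          rw [mul_assoc, ← mul_pow]
          gcongr
          exact hDu x hxS
        have h1 : 2 * τ * ‖u x‖ ^ 2 ≤ 2 * τ * B (u x) (u x) := by
          gcongr
          exact hBp _
        refine le_add_of_nonneg_of_le hK0 ((le_div_iff₀ hW0).2 ?_)
        calc (2 * τ - ‖B‖ * L ^ 2) * ‖u x‖ ^ 2 * carlemanWeight n τ ρ
            ≤ (2 * τ - ‖B‖ * L ^ 2) * ‖u x‖ ^ 2 * carlemanWeight n τ ‖x‖ := by gcongr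
          _ = carlemanWeight n τ ‖x‖ * (2 * τ * ‖u x‖ ^ 2 - ‖B‖ * L ^ 2 * ‖u x‖ ^ 2) := by ring
          _ ≤ carlemanWeight n τ ‖x‖ * (2 * τ * B (u x) (u x) -
              B (diracOp c b u x) (diracOp c b u x)) := by gcongr
          _ = _ := by ring
      · rw [Set.indicator_of_notMem hxS, mul_zero]
        by_cases hxK : x ∈ K
        · rw [Set.indicator_of_mem hxK]
          have hanti := carlemanWeight_anti hn hτ hρ
            (not_lt.1 fun h => hxS (mem_ball_zero_iff.2 h)) (mem_closedBall_zero_iff.1 (hs1 hxK))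
          have hD : B (diracOp c b u x) (diracOp c b u x) ≤ ‖B‖ * M ^ 2 := by
            refine (hBle _).trans ?_
            gcongr
            exact hM x
          have h1 : carlemanWeight n τ ‖x‖ * B (diracOp c b u x) (diracOp c b u x)
              ≤ carlemanWeight n τ ρ * (‖B‖ * M ^ 2) := by
            have := hBp0 (diracOp c b u x)
            gcongr
          have h2 : 0 ≤ 2 * τ * (carlemanWeight n τ ‖x‖ * B (u x) (u x)) := by
            have := hBp0 (u x)
            positivity
          rw [← sub_le_iff_le_add', le_div_iff₀ hW0]
          linarith
        · rw [(hu0 x hxK).1, (hu0 x hxK).2]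
          simpa using hK0
    have i3 := ((i1.const_mul (2 * τ)).sub i2).const_mul (carlemanWeight n τ ρ)⁻¹
    have hmono := integral_mono (hIS.const_mul (2 * τ - ‖B‖ * L ^ 2)) (hIK.add i3) hpt
    rw [integral_const_mul, integral_add' hIK i3] at hmono
    refine hmono.trans (add_le_of_nonpos_right ?_)
    simp only [Pi.sub_apply]
    rw [integral_const_mul, integral_sub (i1.const_mul (2 * τ)) i2, integral_const_mul]
    exact mul_nonpos_of_nonneg_of_nonpos (by positivity) (by linarith)
  have hI := eq_zero_of_forall_mul_le
    (integral_nonneg fun x => Set.indicator_nonneg (fun _ _ => sq_nonneg _) x) key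
  rw [integral_eq_zero_iff_of_nonneg
    (fun x => Set.indicator_nonneg (fun _ _ => sq_nonneg _) x) hIS] at hI
  have hres : (fun x => ‖u x‖ ^ 2) =ᵐ[μ.restrict S] fun _ => 0 := by
    filter_upwards [ae_restrict_of_ae hI, ae_restrict_mem hS] with x hx hxS
    simpa [Set.indicator_of_mem hxS] using hx
  have heq := Measure.eqOn_open_of_ae_eq hres Metric.isOpen_ball
    (hu'.norm.pow 2).continuousOn continuousOn_const
  intro x hx
  simpa using heq hx

end UniqueContinuation

section UniqueContinuation
variable {ι E F : Type*} [Fintype ι] [NormedAddCommGroup E] [InnerProductSpace ℝ E]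
  [NormedAddCommGroup F] [NormedSpace ℝ F] {c : E →L[ℝ] F →L[ℝ] F}
  {b : OrthonormalBasis ι ℝ E} [FiniteDimensional ℝ E]

/-- Localisation of a solution of a Dirac inequality to a ball. -/
lemma exists_localization {φ : E → F} {V : Set E} (hV : IsOpen V) (hφ : ContDiffOn ℝ 1 φ V)
    {ρ L : ℝ} (hρ : 0 < ρ) (hsub : Metric.closedBall 0 ρ ⊆ V)
    (hD : ∀ x ∈ Metric.closedBall (0 : E) ρ, ‖diracOp c b φ x‖ ≤ L * ‖φ x‖) :
    ∃ (u : E → F) (K : ℝ), 0 ≤ K ∧ ContDiff ℝ 1 u ∧ tsupport u ⊆ Metric.closedBall 0 ρ ∧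
      (∀ x ∈ Metric.ball (0 : E) (ρ / 2), u x = φ x ∧ diracOp c b u x = diracOp c b φ x) ∧
      ∀ x ∈ Metric.closedBall (0 : E) ρ, ‖u x‖ ≤ K * ‖φ x‖ ∧ ‖diracOp c b u x‖ ≤ K * ‖φ x‖ := by
  let χ : ContDiffBump (0 : E) := ⟨ρ / 2, ρ, by positivity, by linarith⟩
  have hχs : ContDiff ℝ 1 χ := χ.contDiff
  obtain ⟨C', hC'0, hC'⟩ := exists_norm_cliffordContract_le c b
  obtain ⟨D, hDχ⟩ := (χ.hasCompactSupport.fderiv ℝ).exists_bound_of_continuous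
    (hχs.continuous_fderiv one_ne_zero)
  have hD0 : 0 ≤ D := (norm_nonneg _).trans (hDχ 0)
  have hχt : tsupport χ = Metric.closedBall 0 ρ := χ.tsupport_eq
  refine ⟨fun x => χ x • φ x, 1 + |L| + C' * D, by positivity,
    hφ.contDiff_smul_of_tsupport_subset hV hχs (hχt.le.trans hsub),
    (tsupport_smul_subset_left _ _).trans hχt.le, fun x hx => ?_, fun x hx => ⟨?_, ?_⟩⟩
  · have h1 : (fun x => χ x • φ x) =ᶠ[nhds x] φ := by
      filter_upwards [χ.eventuallyEq_one_of_mem_ball hx] with y hy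
      simp [hy]
    exact ⟨h1.eq_of_nhds, by rw [diracOp, h1.fderiv_eq, diracOp]⟩
  · rw [norm_smul, Real.norm_of_nonneg χ.nonneg]
    gcongr
    have : 0 ≤ |L| + C' * D := by positivity
    linarith [χ.le_one (x := x)]
  · rw [diracOp_smul (hχs.differentiable one_ne_zero x)
      ((hφ.contDiffAt (hV.mem_nhds (hsub hx))).differentiableAt one_ne_zero)]
    have h1 : ‖χ x • diracOp c b φ x‖ ≤ |L| * ‖φ x‖ := by
      rw [norm_smul, Real.norm_of_nonneg χ.nonneg]
      refine (mul_le_of_le_one_left (norm_nonneg _) χ.le_one).trans ((hD x hx).trans ?_)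
      gcongr
      exact le_abs_self L
    have h2 : ‖cliffordContract c b ((fderiv ℝ χ x).smulRight (φ x))‖ ≤ C' * D * ‖φ x‖ := by
      refine (hC' _).trans ?_
      rw [ContinuousLinearMap.norm_smulRight_apply, mul_assoc]
      gcongr
      exact hDχ x
    have h3 := (norm_add_le _ _).trans (add_le_add h1 h2)
    linarith [norm_nonneg (φ x)]

end UniqueContinuation

section StrongUniqueContinuation
variable {ι E F : Type*} [Fintype ι] [NormedAddCommGroup E] [InnerProductSpace ℝ E]
  [NormedAddCommGroup F] [InnerProductSpace ℝ F] {c : E →L[ℝ] F →L[ℝ] F}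
  {b : OrthonormalBasis ι ℝ E} [FiniteDimensional ℝ E]

lemma eq_zero_on_ball_of_flat (hn : 2 ≤ Module.finrank ℝ E)
    (hc : ∀ x v, c x (c x v) = -(‖x‖ ^ 2) • v) {φ : E → F} {V : Set E} (hV : IsOpen V)
    (hφ : ContDiffOn ℝ 1 φ V) {a : E} {ρ L : ℝ} (hρ : 0 < ρ) (hρ1 : ρ ≤ 1)
    (hsub : Metric.closedBall a ρ ⊆ V)
    (hD : ∀ x ∈ Metric.closedBall a ρ, ‖diracOp c b φ x‖ ≤ L * ‖φ x‖)
    (hflat : ∀ k : ℕ, ∃ A, ∀ x ∈ Metric.closedBall (0 : E) ρ, ‖φ (a + x)‖ ≤ A * ‖x‖ ^ k) :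
    ∀ x ∈ Metric.ball a (ρ / 2), φ x = 0 := by
  have hmem : ∀ {x : E} {r : ℝ}, x ∈ Metric.closedBall (0 : E) r → a + x ∈ Metric.closedBall a r :=
    fun hx => by simpa [dist_eq_norm] using hx
  obtain ⟨u, K, hK0, hu, hut, heq, hle⟩ := exists_localization (c := c) (b := b)
    (φ := fun x => φ (a + x)) (V := (fun x => a + x) ⁻¹' V) (L := L)
    (hV.preimage (by fun_prop)) (hφ.comp (by fun_prop) fun x hx => hx) hρ
    (fun x hx => hsub (hmem hx)) (fun x hx => by
      rw [diracOp_comp_add_left]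
      exact hD _ (hmem hx))
  have hz := eq_zero_of_flat (b := b) hn hc hu
    (hut.trans (Metric.closedBall_subset_closedBall hρ1)) (fun k => ?_) (half_pos hρ)
    (by linarith) (L := L) (fun x hx => ?_)
  · intro x hx
    have hx' : x - a ∈ Metric.ball (0 : E) (ρ / 2) := by simpa [dist_eq_norm] using hx
    have := (heq _ hx').1.symm.trans (hz _ hx')
    simpa using this
  · obtain ⟨A, hA⟩ := hflat k
    refine ⟨K * |A|, fun x => ?_⟩
    by_cases hx : x ∈ Metric.closedBall (0 : E) ρ
    · have h1 : K * ‖φ (a + x)‖ ≤ K * |A| * ‖x‖ ^ k := by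
        rw [mul_assoc]
        refine mul_le_mul_of_nonneg_left ((hA x hx).trans ?_) hK0
        gcongr
        exact le_abs_self A
      exact ⟨(hle x hx).1.trans h1, (hle x hx).2.trans h1⟩
    · have hxt : x ∉ tsupport u := fun h => hx (hut h)
      have h1 : fderiv ℝ u x = 0 :=
        image_eq_zero_of_notMem_tsupport fun h' => hxt (tsupport_fderiv_subset ℝ h')
      simp only [image_eq_zero_of_notMem_tsupport hxt, diracOp, h1, cliffordContract,
        zero_apply, map_zero, Finset.sum_const_zero, norm_zero, and_self]
      positivity
  · rw [(heq x hx).1, (heq x hx).2, diracOp_comp_add_left]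
    exact hD _ (hmem (Metric.ball_subset_closedBall
      (Metric.ball_subset_ball (by linarith) hx)))

/-- Strong unique continuation for the Dirac inequality `|Dφ| ≤ L |φ|`. -/
theorem strong_unique_continuation (hn : 2 ≤ Module.finrank ℝ E)
    (hc : ∀ x v, c x (c x v) = -(‖x‖ ^ 2) • v) {φ : E → F} {U : Set E} (hU : IsOpen U)
    (hUc : IsConnected U) (hφ : ContDiffOn ℝ 1 φ U)
    (hD : ∀ K ⊆ U, IsCompact K → ∃ L, ∀ x ∈ K, ‖diracOp c b φ x‖ ≤ L * ‖φ x‖)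
    (h0 : (0 : E) ∈ U) {ρ : ℝ} (hρ : 0 < ρ)
    (hflat : ∀ k : ℕ, ∃ A, ∀ x ∈ Metric.ball (0 : E) ρ, ‖φ x‖ ≤ A * ‖x‖ ^ k) :
    ∀ x ∈ U, φ x = 0 := by
  set Z : Set E := {a | φ =ᶠ[nhds a] 0} with hZ
  have hZo : IsOpen Z := isOpen_setOfPred_eventually_nhds
  have hball : ∀ a r, 0 < r → r ≤ 1 → Metric.closedBall a r ⊆ U →
      (∀ k : ℕ, ∃ A, ∀ x ∈ Metric.closedBall (0 : E) r, ‖φ (a + x)‖ ≤ A * ‖x‖ ^ k) →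
      Metric.ball a (r / 2) ⊆ Z := by
    intro a r hr hr1 hsub hf x hx
    obtain ⟨L, hL⟩ := hD _ hsub (isCompact_closedBall a r)
    have h := eq_zero_on_ball_of_flat hn hc hU hφ hr hr1 hsub hL hf
    filter_upwards [Metric.isOpen_ball.mem_nhds hx] with y hy
    exact h y hy
  have hZU : U ⊆ Z := by
    refine hUc.isPreconnected.subset_of_closure_inter_subset hZo ⟨0, h0, ?_⟩ ?_
    · obtain ⟨r, hr, hrU⟩ := Metric.nhds_basis_closedBall.mem_iff.1 (hU.mem_nhds h0)
      set s := min (min r 1) (ρ / 2)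
      have hs : 0 < s := by positivity
      refine hball 0 s hs ((min_le_left _ _).trans (min_le_right _ _))
        ((Metric.closedBall_subset_closedBall ((min_le_left _ _).trans (min_le_left _ _))).trans
          hrU) (fun k => ?_) (Metric.mem_ball_self (half_pos hs))
      obtain ⟨A, hA⟩ := hflat k
      refine ⟨A, fun x hx => ?_⟩
      rw [zero_add]
      refine hA x (Metric.closedBall_subset_ball ?_ hx)
      exact (min_le_right _ _).trans_lt (half_lt_self hρ)
    · rintro a ⟨haZ, haU⟩
      obtain ⟨r, hr, hrU⟩ := Metric.nhds_basis_closedBall.mem_iff.1 (hU.mem_nhds haU)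
      set s := min (r / 2) 1
      have hs : 0 < s := by positivity
      obtain ⟨z, hz, hza⟩ := Metric.mem_closure_iff.1 haZ (s / 2) (half_pos hs)
      have hsr : s ≤ r / 2 := min_le_left _ _
      refine hball z s hs (min_le_right _ _) ((Metric.closedBall_subset_closedBall' ?_).trans hrU)
        (fun k => ?_) hza
      · rw [dist_comm]
        linarith
      · obtain ⟨ε, hε, hεz⟩ := Metric.eventually_nhds_iff_ball.1 hz
        have hzs : Metric.closedBall z s ⊆ U :=
          (Metric.closedBall_subset_closedBall' (by rw [dist_comm]; linarith)).trans hrU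
        obtain ⟨M, hM⟩ := (isCompact_closedBall z s).exists_bound_of_continuousOn
          (hφ.continuousOn.mono hzs)
        refine ⟨M / ε ^ k, fun x hx => ?_⟩
        have hM' := hM (z + x) (by simpa [dist_eq_norm] using hx)
        rcases lt_or_ge ‖x‖ ε with hxε | hxε
        · rw [hεz (z + x) (by simpa [dist_eq_norm] using hxε)]
          have : 0 ≤ M := (norm_nonneg _).trans hM'
          simp only [Pi.zero_apply, norm_zero]
          positivity
        · have : 0 ≤ M := (norm_nonneg _).trans hM'
          refine hM'.trans ?_
          rw [div_mul_eq_mul_div, le_div_iff₀ (by positivity)]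
          gcongr
  exact fun x hx => (hZU hx).eq_of_nhds

end StrongUniqueContinuation

section HomogeneousForm
variable {ι E F : Type*} [Fintype ι] [NormedAddCommGroup E] [InnerProductSpace ℝ E]
  [NormedAddCommGroup F] [NormedSpace ℝ F]

/-- The homogeneous polynomial map of degree `m` with coefficients `w` in the basis `b`. -/
noncomputable def homForm (b : OrthonormalBasis ι ℝ E) {m : ℕ} (w : (Fin m → ι) → F) (x : E) : F :=
  ∑ f, (∏ i, inner ℝ (b (f i)) x) • w f

variable {b : OrthonormalBasis ι ℝ E} {m : ℕ} {w : (Fin m → ι) → F}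

lemma homForm_smul (t : ℝ) (x : E) : homForm b w (t • x) = t ^ m • homForm b w x := by
  simp only [homForm, inner_smul_right, Finset.prod_mul_distrib, Finset.prod_const,
    Finset.card_univ, Fintype.card_fin, mul_smul, Finset.smul_sum]

lemma contDiff_homForm {n : WithTop ℕ∞} : ContDiff ℝ n (homForm b w) := by
  unfold homForm
  exact ContDiff.sum fun f _ =>
    (contDiff_prod fun i _ => contDiff_const.inner ℝ contDiff_id).smul contDiff_const

lemma exists_norm_homForm_le (b : OrthonormalBasis ι ℝ E) (w : (Fin m → ι) → F) :
    ∃ A, 0 ≤ A ∧ ∀ x, ‖homForm b w x‖ ≤ A * ‖x‖ ^ m := by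
  refine ⟨∑ f, ‖w f‖, by positivity, fun x => ?_⟩
  rw [Finset.sum_mul]
  refine (norm_sum_le _ _).trans (Finset.sum_le_sum fun f _ => ?_)
  rw [norm_smul, norm_prod, mul_comm]
  gcongr
  refine (Finset.prod_le_prod (fun i _ => norm_nonneg _) fun i _ =>
    (norm_inner_le_norm (b (f i)) x)).trans ?_
  simp

lemma eq_zero_of_norm_sum_pow_smul_le {A θ : ℝ} (hθ : 0 < θ) {k : ℕ} {v : ℕ → F}
    (h : ∀ t ∈ Set.Ioc (0 : ℝ) 1,
      ‖∑ j ∈ Finset.range k, t ^ j • v j‖ ≤ A * t ^ ((k : ℝ) - 1 + θ)) :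
    ∀ j < k, v j = 0 := by
  induction k generalizing v with
  | zero => simp
  | succ k ih =>
    have hv0 : v 0 = 0 := by
      have h1 : Filter.Tendsto (fun t : ℝ => ‖∑ j ∈ Finset.range (k + 1), t ^ j • v j‖)
          (nhdsWithin 0 (Set.Ioi 0)) (nhds ‖v 0‖) := by
        have : Continuous fun t : ℝ => ‖∑ j ∈ Finset.range (k + 1), t ^ j • v j‖ := by fun_prop
        have h2 := this.tendsto 0
        rw [Finset.sum_range_succ'] at h2
        simp only [ne_eq, Nat.add_eq_zero_iff, one_ne_zero, and_false, not_false_eq_true,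
          zero_pow, zero_smul, Finset.sum_const_zero, pow_zero, one_smul, zero_add] at h2
        exact h2.mono_left nhdsWithin_le_nhds
      have h2 : Filter.Tendsto (fun t : ℝ => A * t ^ (((k + 1 : ℕ) : ℝ) - 1 + θ))
          (nhdsWithin 0 (Set.Ioi 0)) (nhds 0) := by
        have hp : 0 < ((k + 1 : ℕ) : ℝ) - 1 + θ := by push_cast; linarith [k.cast_nonneg (α := ℝ)]
        have := ((Real.continuousAt_rpow_const 0 _ (Or.inr hp.le)).tendsto.const_mul A)
        rw [Real.zero_rpow hp.ne', mul_zero] at this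
        exact this.mono_left nhdsWithin_le_nhds
      refine norm_le_zero_iff.1 (le_of_tendsto_of_tendsto h1 h2 ?_)
      filter_upwards [Ioc_mem_nhdsGT (zero_lt_one (α := ℝ))] with t ht using h t ht
    have hS : ∀ j < k, v (j + 1) = 0 := by
      refine ih (v := fun j => v (j + 1)) fun t ht => ?_
      have h1 := h t ht
      rw [Finset.sum_range_succ', hv0, smul_zero, add_zero] at h1
      have e1 : ∑ j ∈ Finset.range k, t ^ (j + 1) • v (j + 1)
          = t • ∑ j ∈ Finset.range k, t ^ j • v (j + 1) := by
        rw [Finset.smul_sum]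
        exact Finset.sum_congr rfl fun j _ => by rw [smul_smul, pow_succ']
      have e2 : t ^ (((k + 1 : ℕ) : ℝ) - 1 + θ) = t * t ^ ((k : ℝ) - 1 + θ) := by
        rw [← Real.rpow_one_add' ht.1.le (by linarith [k.cast_nonneg (α := ℝ)])]
        congr 1
        push_cast
        ring
      rw [e1, norm_smul, Real.norm_of_nonneg ht.1.le, e2, mul_left_comm] at h1
      exact le_of_mul_le_mul_left h1 ht.1
    intro j hj
    cases j with
    | zero => exact hv0
    | succ j => exact hS j (by omega)

variable [FiniteDimensional ℝ E] [Nontrivial E] [CompleteSpace F] {c : E →L[ℝ] F →L[ℝ] F}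

/-- A function vanishing, with its Dirac derivative, to order `m - 1 + δ` for all `δ < 1` is
approximated to order `m + δ` by a homogeneous polynomial of degree `m`. -/
lemma exists_homForm_approx (hc : ∀ x v, c x (c x v) = -(‖x‖ ^ 2) • v) {u : E → F}
    (hu : ContDiff ℝ 1 u) (hus : HasCompactSupport u) (m : ℕ)
    (hdec : ∀ δ ∈ Set.Ioo (0 : ℝ) 1, ∃ A, ∀ x, ‖u x‖ ≤ A * ‖x‖ ^ ((m : ℝ) - 1 + δ) ∧
      ‖diracOp c b u x‖ ≤ A * ‖x‖ ^ ((m : ℝ) - 1 + δ)) :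
    ∃ w : (Fin m → ι) → F, ∀ δ ∈ Set.Ioo (0 : ℝ) 1, ∃ A, ∀ x,
      ‖u x - homForm b w x‖ ≤ A * ‖x‖ ^ ((m : ℝ) + δ) := by
  let _ : MeasurableSpace E := borel E
  have _ : BorelSpace E := ⟨rfl⟩
  set μ : Measure E := volume
  set κ := pompeiuConst μ
  have hκ : 0 < κ := pompeiuConst_pos μ
  set g := diracOp c b u with hg
  have hgc : Continuous g := continuous_diracOp hu
  have hgs : HasCompactSupport g := hus.diracOp
  obtain ⟨a, ha⟩ : ∃ a, Module.finrank ℝ E = a + 1 :=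
    Nat.exists_eq_succ_of_ne_zero Module.finrank_pos.ne'
  have hhalf : (1 / 2 : ℝ) ∈ Set.Ioo (0 : ℝ) 1 := by norm_num
  obtain ⟨A₀, hA₀⟩ := hdec _ hhalf
  have hform : ∀ j, ∃ w : (Fin j → ι) → F, j ≤ m → ∀ x,
      kernelMoment μ (diracKernel c) g j x = homForm b w x := by
    intro j
    by_cases hj : j ≤ m
    · obtain ⟨w, hw⟩ := kernelMoment_eq_sum b μ ha (diracKernel_smul ha) contDiffOn_diracKernel
        hgc hgs hhalf.1 (fun y _ => (hA₀ y).2) hj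
      exact ⟨w, fun _ => hw⟩
    · exact ⟨0, fun h => absurd h hj⟩
  choose w hw using hform
  have hT : ∀ δ ∈ Set.Ioo (0 : ℝ) 1, ∃ A, 0 ≤ A ∧ ∀ x, ‖κ • u x - ∑ j ∈ Finset.range (m + 1),
      homForm b (w j) x‖ ≤ A * ‖x‖ ^ ((m : ℝ) + δ) := by
    intro δ hδ
    obtain ⟨A, hA⟩ := hdec δ hδ
    obtain ⟨C, hC0, hC⟩ := exists_norm_sub_sum_kernelMoment_le (b := b) μ hc m hδ
    refine ⟨C * |A|, by positivity, fun x => ?_⟩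
    have h := hC u A hu hus (fun y _ => (hA y).2) x
    rw [Finset.sum_congr rfl fun j hj =>
      hw j (Nat.lt_succ_iff.1 (Finset.mem_range.1 hj)) x] at h
    refine h.trans ?_
    gcongr
    exact le_abs_self A
  have hlow : ∀ x, ∀ j < m, homForm b (w j) x = 0 := by
    intro x
    obtain ⟨A₁, hA₁0, hA₁⟩ := hT _ hhalf
    obtain ⟨A₂, hA₂0, hA₂⟩ := exists_norm_homForm_le b (w m)
    set p : ℝ := (m : ℝ) - 1 + 1 / 2
    refine eq_zero_of_norm_sum_pow_smul_le (A := κ * |A₀| * ‖x‖ ^ p +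
      A₁ * ‖x‖ ^ ((m : ℝ) + 1 / 2) + A₂ * ‖x‖ ^ m) hhalf.1 fun t ht => ?_
    have e1 : ∑ j ∈ Finset.range m, t ^ j • homForm b (w j) x
        = κ • u (t • x) - (κ • u (t • x) - ∑ j ∈ Finset.range (m + 1), homForm b (w j) (t • x))
          - homForm b (w m) (t • x) := by
      rw [Finset.sum_range_succ, sub_sub_cancel]
      simp only [homForm_smul, add_sub_cancel_right]
    have hn : ‖t • x‖ = t * ‖x‖ := by rw [norm_smul, Real.norm_of_nonneg ht.1.le]
    have b1 : ‖κ • u (t • x)‖ ≤ κ * |A₀| * ‖x‖ ^ p * t ^ p := by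
      rw [norm_smul, Real.norm_of_nonneg hκ.le, mul_assoc, mul_assoc]
      refine mul_le_mul_of_nonneg_left ((hA₀ _).1.trans ?_) hκ.le
      rw [hn, Real.mul_rpow ht.1.le (norm_nonneg x), mul_comm (t ^ _)]
      exact mul_le_mul_of_nonneg_right (le_abs_self _)
        (mul_nonneg (Real.rpow_nonneg (norm_nonneg x) _) (Real.rpow_nonneg ht.1.le _))
    have b2 := hA₁ (t • x)
    rw [hn, Real.mul_rpow ht.1.le (norm_nonneg x)] at b2
    have b3 := hA₂ (t • x)
    rw [hn, mul_pow] at b3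
    have t1 : t ^ ((m : ℝ) + 1 / 2) ≤ t ^ p :=
      Real.rpow_le_rpow_of_exponent_ge ht.1 ht.2 (by simp only [p]; linarith)
    have t2 : t ^ m ≤ t ^ p := by
      rw [← Real.rpow_natCast]
      exact Real.rpow_le_rpow_of_exponent_ge ht.1 ht.2 (by simp only [p]; linarith)
    rw [e1]
    calc _ ≤ κ * |A₀| * ‖x‖ ^ p * t ^ p + A₁ * (t ^ ((m : ℝ) + 1 / 2) * ‖x‖ ^ ((m : ℝ) + 1 / 2))
          + A₂ * (t ^ m * ‖x‖ ^ m) :=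
          norm_sub_le_of_le (norm_sub_le_of_le b1 b2) b3
      _ ≤ κ * |A₀| * ‖x‖ ^ p * t ^ p + A₁ * (t ^ p * ‖x‖ ^ ((m : ℝ) + 1 / 2))
          + A₂ * (t ^ p * ‖x‖ ^ m) := by gcongr
      _ = _ := by ring
  refine ⟨fun f => κ⁻¹ • w m f, fun δ hδ => ?_⟩
  obtain ⟨A, hA0, hA⟩ := hT δ hδ
  refine ⟨κ⁻¹ * A, fun x => ?_⟩
  have e : u x - homForm b (fun f => κ⁻¹ • w m f) x
      = κ⁻¹ • (κ • u x - ∑ j ∈ Finset.range (m + 1), homForm b (w j) x) := by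
    rw [Finset.sum_range_succ, Finset.sum_eq_zero fun j hj => hlow x j (Finset.mem_range.1 hj),
      zero_add, smul_sub, inv_smul_smul₀ hκ.ne']
    simp only [homForm, Finset.smul_sum, smul_smul, mul_comm]
  rw [e, norm_smul, Real.norm_of_nonneg (inv_nonneg.2 hκ.le), mul_assoc]
  exact mul_le_mul_of_nonneg_left (hA x) (inv_nonneg.2 hκ.le)

end HomogeneousForm

section LeadingTerm
variable {ι E F : Type*} [Fintype ι] [NormedAddCommGroup E] [InnerProductSpace ℝ E]
  [NormedAddCommGroup F] [InnerProductSpace ℝ F] [CompleteSpace F] {c : E →L[ℝ] F →L[ℝ] F}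
  {b : OrthonormalBasis ι ℝ E} [FiniteDimensional ℝ E]

/-- A nontrivial solution of a Dirac inequality has a nonzero homogeneous leading term. -/
theorem exists_leading_term (hn : 2 ≤ Module.finrank ℝ E)
    (hc : ∀ x v, c x (c x v) = -(‖x‖ ^ 2) • v) {φ : E → F} {U : Set E} (hU : IsOpen U)
    (hUc : IsConnected U) (hφ : ContDiffOn ℝ 1 φ U)
    (hD : ∀ K ⊆ U, IsCompact K → ∃ L, ∀ x ∈ K, ‖diracOp c b φ x‖ ≤ L * ‖φ x‖)
    (h0 : (0 : E) ∈ U) (hφ0 : φ 0 = 0) (hne : ∃ x ∈ U, φ x ≠ 0) :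
    ∃ m : ℕ, 1 ≤ m ∧ ∃ r > 0, Metric.ball (0 : E) r ⊆ U ∧ ∃ w : (Fin m → ι) → F,
      homForm b w ≠ 0 ∧ ∀ δ ∈ Set.Ioo (0 : ℝ) 1, ∃ A, ∀ x ∈ Metric.ball (0 : E) r,
        ‖φ x - homForm b w x‖ ≤ A * ‖x‖ ^ ((m : ℝ) + δ) := by
  have _ : Nontrivial E := Module.nontrivial_of_finrank_pos (R := ℝ) (by omega)
  obtain ⟨s, hs, hsU⟩ := Metric.nhds_basis_closedBall.mem_iff.1 (hU.mem_nhds h0)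
  set ρ := min s 1
  have hρ : 0 < ρ := by positivity
  have hρ1 : ρ ≤ 1 := min_le_right _ _
  have hρU : Metric.closedBall (0 : E) ρ ⊆ U :=
    (Metric.closedBall_subset_closedBall (min_le_left _ _)).trans hsU
  have hsubU : Metric.ball (0 : E) (ρ / 2) ⊆ U :=
    (Metric.ball_subset_closedBall.trans
      (Metric.closedBall_subset_closedBall (by linarith))).trans hρU
  obtain ⟨L, hL⟩ := hD _ hρU (isCompact_closedBall _ _)
  obtain ⟨u, K, hK0, hu, hut, heq, hle⟩ := exists_localization hU hφ hρ hρU hL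
  have hus : HasCompactSupport u :=
    (isCompact_closedBall (0 : E) ρ).of_isClosed_subset (isClosed_tsupport u) hut
  obtain ⟨M, hM⟩ := (isCompact_closedBall (0 : E) ρ).exists_bound_of_continuousOn
    (hφ.continuousOn.mono hρU)
  have hM0 : 0 ≤ M := (norm_nonneg _).trans (hM 0 (by simp [hρ.le]))
  have hext : ∀ p : ℝ, 0 ≤ p →
      (∃ A, ∀ x ∈ Metric.ball (0 : E) (ρ / 2), ‖φ x‖ ≤ A * ‖x‖ ^ p) →
      ∃ A, ∀ x, ‖u x‖ ≤ A * ‖x‖ ^ p ∧ ‖diracOp c b u x‖ ≤ A * ‖x‖ ^ p := by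
    rintro p hp ⟨A, hA⟩
    refine ⟨K * (|A| + M / (ρ / 2) ^ p), fun x => ?_⟩
    by_cases hx : x ∈ Metric.closedBall (0 : E) ρ
    · have hφx : ‖φ x‖ ≤ (|A| + M / (ρ / 2) ^ p) * ‖x‖ ^ p := by
        rw [add_mul]
        by_cases hx2 : x ∈ Metric.ball (0 : E) (ρ / 2)
        · refine (hA x hx2).trans (le_add_of_le_of_nonneg ?_ (by positivity))
          gcongr
          exact le_abs_self A
        · have h1 : ρ / 2 ≤ ‖x‖ := not_lt.1 fun h => hx2 (mem_ball_zero_iff.2 h)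
          refine (hM x hx).trans (le_add_of_nonneg_of_le (by positivity) ?_)
          rw [div_mul_eq_mul_div, le_div_iff₀ (by positivity)]
          gcongr
      have h2 := mul_le_mul_of_nonneg_left hφx hK0
      rw [← mul_assoc] at h2
      exact ⟨(hle x hx).1.trans h2, (hle x hx).2.trans h2⟩
    · have hxt : x ∉ tsupport u := fun h => hx (hut h)
      have h1 : fderiv ℝ u x = 0 :=
        image_eq_zero_of_notMem_tsupport fun h' => hxt (tsupport_fderiv_subset ℝ h')
      simp only [image_eq_zero_of_notMem_tsupport hxt, diracOp, h1, cliffordContract,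
        zero_apply, map_zero, Finset.sum_const_zero, norm_zero, and_self]
      positivity
  by_contra hcon
  have hall : ∀ m : ℕ, ∀ δ ∈ Set.Ioo (0 : ℝ) 1, ∃ A, ∀ x ∈ Metric.ball (0 : E) (ρ / 2),
      ‖φ x‖ ≤ A * ‖x‖ ^ ((m : ℝ) + δ) := by
    intro m
    induction m with
    | zero =>
      intro δ hδ
      obtain ⟨C, hC⟩ := hu.lipschitzWith_of_hasCompactSupport hus one_ne_zero
      refine ⟨C, fun x hx => ?_⟩
      have h1 := hC.norm_sub_le x 0
      have hx1 : ‖x‖ ≤ 1 := by linarith [mem_ball_zero_iff.1 hx]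
      rw [(heq x hx).1, (heq 0 (Metric.mem_ball_self (half_pos hρ))).1, hφ0, sub_zero,
        sub_zero] at h1
      refine h1.trans ?_
      gcongr
      rw [Nat.cast_zero, zero_add]
      rcases eq_or_ne x 0 with rfl | hx0
      · simp [Real.zero_rpow hδ.1.ne']
      · conv_lhs => rw [← Real.rpow_one ‖x‖]
        exact Real.rpow_le_rpow_of_exponent_ge (norm_pos_iff.2 hx0) hx1 hδ.2.le
    | succ m ih =>
      obtain ⟨w, hw⟩ := exists_homForm_approx (b := b) hc hu hus (m + 1) fun δ hδ => by
        have := hext ((m : ℝ) + δ) (by linarith [hδ.1, m.cast_nonneg (α := ℝ)]) (ih δ hδ)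
        rwa [Nat.cast_succ, add_sub_cancel_right]
      have hφw : ∀ δ ∈ Set.Ioo (0 : ℝ) 1, ∃ A, ∀ x ∈ Metric.ball (0 : E) (ρ / 2),
          ‖φ x - homForm b w x‖ ≤ A * ‖x‖ ^ (((m + 1 : ℕ) : ℝ) + δ) := by
        intro δ hδ
        obtain ⟨A, hA⟩ := hw δ hδ
        exact ⟨A, fun x hx => (heq x hx).1 ▸ hA x⟩
      by_cases hwz : homForm b w = 0
      · simpa [hwz] using hφw
      · exact absurd ⟨m + 1, by omega, ρ / 2, half_pos hρ, hsubU, w, hwz, hφw⟩ hcon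
  obtain ⟨x, hxU, hx⟩ := hne
  refine hx (strong_unique_continuation hn hc hU hUc hφ hD h0 (half_pos hρ) (fun k => ?_) x hxU)
  obtain ⟨A, hA⟩ := hall k (1 / 2) (by norm_num)
  refine ⟨|A|, fun x hx => (hA x hx).trans ?_⟩
  have hx1 : ‖x‖ ≤ 1 := by linarith [mem_ball_zero_iff.1 hx]
  gcongr ?_ * ?_
  · exact le_abs_self A
  · rcases eq_or_ne x 0 with rfl | hx0
    · rw [norm_zero, Real.zero_rpow (by positivity)]
      positivity
    · rw [← Real.rpow_natCast]
      exact Real.rpow_le_rpow_of_exponent_ge (norm_pos_iff.2 hx0) hx1 (by linarith)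

end LeadingTerm

section LeadingForm
variable {ι E F : Type*} [Fintype ι] [NormedAddCommGroup E] [InnerProductSpace ℝ E]
  [NormedAddCommGroup F] [NormedSpace ℝ F] {c : E →L[ℝ] F →L[ℝ] F} {b : OrthonormalBasis ι ℝ E}

lemma diracOp_sub {u v : E → F} {x : E} (hu : DifferentiableAt ℝ u x)
    (hv : DifferentiableAt ℝ v x) :
    diracOp c b (fun y => u y - v y) x = diracOp c b u x - diracOp c b v x := by
  simp only [diracOp, cliffordContract]
  rw [fderiv_fun_sub hu hv]
  simp

lemma diracOp_const_smul_comp_smul {u : E → F} {x : E} (s t : ℝ)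
    (hu : DifferentiableAt ℝ u (t • x)) :
    diracOp c b (fun y => s • u (t • y)) x = (s * t) • diracOp c b u (t • x) := by
  have h : HasFDerivAt (fun y => s • u (t • y)) (s • (fderiv ℝ u (t • x)).comp
      (t • ContinuousLinearMap.id ℝ E)) x :=
    (hu.hasFDerivAt.comp x ((hasFDerivAt_id x).const_smul t)).const_smul s
  simp only [diracOp, cliffordContract]
  rw [h.fderiv]
  simp [Finset.smul_sum, smul_smul]

variable [FiniteDimensional ℝ E]

lemma integral_diracOp_eq_zero [MeasurableSpace E] [BorelSpace E] (μ : Measure E)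
    [μ.IsAddHaarMeasure] {u : E → F} (hu : ContDiff ℝ 1 u) (hs : HasCompactSupport u) :
    ∫ x, diracOp c b u x ∂μ = 0 := by
  have hfd : Continuous (fderiv ℝ u) := hu.continuous_fderiv one_ne_zero
  have hi : ∀ i, Integrable (fun y => c (b i) (fderiv ℝ u y (b i))) μ := fun i =>
    Continuous.integrable_of_hasCompactSupport (by fun_prop)
      ((hs.fderiv ℝ).mono' (fun y hy => subset_tsupport _ (by
        contrapose! hy
        simp only [Function.mem_support, ne_eq, not_not] at hy ⊢
        simp [hy])))
  simp only [diracOp, cliffordContract]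
  rw [integral_finsetSum _ (fun i _ => hi i)]
  refine Finset.sum_eq_zero fun i _ => ?_
  have h := integral_bilinear_fderiv_right_eq_neg_left_of_integrable (μ := μ)
    (f := fun _ : E => c (b i)) (g := u) (v := b i) (B := ContinuousLinearMap.id ℝ (F →L[ℝ] F))
    ?_ ?_ ?_ ?_ ?_
  · simpa using h
  · simp
  · exact hi i
  · exact Continuous.integrable_of_hasCompactSupport (by fun_prop)
      (hs.mono fun y hy => by
        contrapose! hy
        simp only [Function.mem_support, ne_eq, not_not] at hy ⊢
        simp [hy])
  · exact fun y _ => differentiableAt_const _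
  · exact fun y _ => hu.differentiable one_ne_zero y

/-- The leading homogeneous part of a function whose Dirac derivative is of higher order lies in
the kernel of the Dirac operator. -/
lemma diracOp_eq_zero_of_leading [CompleteSpace F] {u P : E → F} {m : ℕ} {r δ A : ℝ}
    (hu : ContDiff ℝ 1 u) (hP : ContDiff ℝ 1 P) (hPs : ∀ (t : ℝ) x, P (t • x) = t ^ m • P x)
    (hm : 1 ≤ m) (hr : 0 < r) (hδ : 0 < δ)
    (happ : ∀ x ∈ Metric.ball (0 : E) r, ‖u x - P x‖ ≤ A * ‖x‖ ^ ((m : ℝ) + δ))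
    (hDu : ∀ x ∈ Metric.ball (0 : E) r, ‖diracOp c b u x‖ ≤ A * ‖x‖ ^ ((m : ℝ) - 1 + δ)) (x : E) :
    diracOp c b P x = 0 := by
  let _ : MeasurableSpace E := borel E
  have _ : BorelSpace E := ⟨rfl⟩
  set μ : Measure E := volume
  have hA : ∀ {p : ℝ} (x : E), A * ‖x‖ ^ p ≤ |A| * ‖x‖ ^ p := fun x =>
    mul_le_mul_of_nonneg_right (le_abs_self A) (Real.rpow_nonneg (norm_nonneg x) _)
  have hmR : (1 : ℝ) ≤ m := by exact_mod_cast hm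
  have hPc := continuous_diracOp (c := c) (b := b) hP
  suffices h : ∀ᵐ x ∂μ, diracOp c b P x = 0 from
    congrFun ((hPc.ae_eq_iff_eq μ continuous_const).1 h) x
  refine ae_eq_zero_of_integral_contDiff_smul_eq_zero hPc.locallyIntegrable fun ζ hζ hζs => ?_
  have hζ1 : ContDiff ℝ 1 ζ := hζ.of_le (by exact_mod_cast le_top)
  obtain ⟨M, hM0, hM⟩ := hζs.isCompact.isBounded.exists_pos_norm_lt
  obtain ⟨C₁, hC₁0, hC₁⟩ := exists_norm_cliffordContract_le c b
  have hζb : ∃ B, ∀ x, ‖ζ x‖ ≤ B := hζs.exists_bound_of_continuous hζ1.continuous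
  obtain ⟨B, hB⟩ := hζb
  obtain ⟨B', hB'⟩ := (hζs.fderiv ℝ).exists_bound_of_continuous
    (hζ1.continuous_fderiv one_ne_zero)
  have hB0 : 0 ≤ B := (norm_nonneg _).trans (hB 0)
  have hB'0 : 0 ≤ B' := (norm_nonneg _).trans (hB' 0)
  set V := μ.real (Metric.ball (0 : E) M)
  set T := B * (|A| * M ^ ((m : ℝ) - 1 + δ)) + C₁ * (B' * (|A| * M ^ ((m : ℝ) + δ)))
  have key : ∀ t > 0, t * M < r → ‖∫ x, ζ x • diracOp c b P x ∂μ‖ ≤ T * V * t ^ δ := by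
    intro t ht htr
    set v : E → F := fun x => (t ^ m)⁻¹ • u (t • x) - P x with hv
    have hut : ContDiff ℝ 1 fun x => (t ^ m)⁻¹ • u (t • x) := by fun_prop
    have hv1 : ContDiff ℝ 1 v := hut.sub hP
    have hmem : ∀ x ∈ Metric.ball (0 : E) M, t • x ∈ Metric.ball (0 : E) r := fun x hx => by
      rw [mem_ball_zero_iff] at hx ⊢
      rw [norm_smul, Real.norm_of_nonneg ht.le]
      exact (mul_le_mul_of_nonneg_left hx.le ht.le).trans_lt htr
    have hnt : ∀ x : E, ‖t • x‖ = t * ‖x‖ := fun x => by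
      rw [norm_smul, Real.norm_of_nonneg ht.le]
    have hvb : ∀ x ∈ Metric.ball (0 : E) M, ‖v x‖ ≤ |A| * M ^ ((m : ℝ) + δ) * t ^ δ := by
      intro x hx
      have e : v x = (t ^ m)⁻¹ • (u (t • x) - P (t • x)) := by
        rw [smul_sub, hPs, inv_smul_smul₀ (pow_pos ht m).ne']
      rw [e, norm_smul, norm_inv, norm_pow, Real.norm_of_nonneg ht.le,
        inv_mul_le_iff₀ (by positivity)]
      refine ((happ _ (hmem x hx)).trans (hA _)).trans ?_
      rw [hnt, Real.mul_rpow ht.le (norm_nonneg x), Real.rpow_add ht, Real.rpow_natCast]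
      rw [mem_ball_zero_iff] at hx
      calc |A| * (t ^ m * t ^ δ * ‖x‖ ^ ((m : ℝ) + δ))
          ≤ |A| * (t ^ m * t ^ δ * M ^ ((m : ℝ) + δ)) := by gcongr
        _ = _ := by ring
    have hDb : ∀ x ∈ Metric.ball (0 : E) M, ‖diracOp c b (fun x => (t ^ m)⁻¹ • u (t • x)) x‖
        ≤ |A| * M ^ ((m : ℝ) - 1 + δ) * t ^ δ := by
      intro x hx
      rw [diracOp_const_smul_comp_smul _ _ (hu.differentiable one_ne_zero _), norm_smul, norm_mul,
        norm_inv, norm_pow, Real.norm_of_nonneg ht.le, mul_assoc, inv_mul_le_iff₀ (by positivity)]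
      refine (mul_le_mul_of_nonneg_left ((hDu _ (hmem x hx)).trans (hA _)) ht.le).trans ?_
      rw [hnt, Real.mul_rpow ht.le (norm_nonneg x), Real.rpow_add ht, Real.rpow_sub_one ht.ne',
        Real.rpow_natCast]
      rw [mem_ball_zero_iff] at hx
      have hp : 0 ≤ (m : ℝ) - 1 + δ := by linarith
      calc t * (|A| * (t ^ m / t * t ^ δ * ‖x‖ ^ ((m : ℝ) - 1 + δ)))
          ≤ t * (|A| * (t ^ m / t * t ^ δ * M ^ ((m : ℝ) - 1 + δ))) := by gcongr
        _ = _ := by field_simp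
    have hint := integral_diracOp_eq_zero (c := c) (b := b) μ (hζ1.smul hv1)
      (hζs.smul_right (f' := v))
    have hsplit : ∀ x, ζ x • diracOp c b P x =
        (ζ x • diracOp c b (fun x => (t ^ m)⁻¹ • u (t • x)) x +
          cliffordContract c b ((fderiv ℝ ζ x).smulRight (v x))) -
          diracOp c b (fun y => ζ y • v y) x := by
      intro x
      rw [diracOp_smul (hζ1.differentiable one_ne_zero x) (hv1.differentiable one_ne_zero x), hv,
        diracOp_sub (hut.differentiable one_ne_zero x) (hP.differentiable one_ne_zero x), smul_sub]
      abel
    have hc1 : Continuous fun x => diracOp c b (fun y => ζ y • v y) x :=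
      continuous_diracOp (hζ1.smul hv1)
    have hi1 : Integrable (fun x => diracOp c b (fun y => ζ y • v y) x) μ :=
      hc1.integrable_of_hasCompactSupport (HasCompactSupport.diracOp (hζs.smul_right (f' := v)))
    have hi2 : Integrable (fun x => ζ x • diracOp c b P x) μ :=
      (hζ1.continuous.smul hPc).integrable_of_hasCompactSupport hζs.smul_right
    have hz : ∀ x ∉ Metric.ball (0 : E) M,
        (fun x => ζ x • diracOp c b P x + diracOp c b (fun y => ζ y • v y) x) x = 0 := by
      intro x hx
      have hxt : x ∉ tsupport ζ := fun h => hx (mem_ball_zero_iff.2 (hM x h))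
      have h1 : fderiv ℝ ζ x = 0 :=
        image_eq_zero_of_notMem_tsupport fun h' => hxt (tsupport_fderiv_subset ℝ h')
      have h2 := hsplit x
      rw [eq_sub_iff_add_eq] at h2
      refine h2.trans ?_
      simp [image_eq_zero_of_notMem_tsupport hxt, h1, cliffordContract]
    have hsum : ∫ x, ζ x • diracOp c b P x ∂μ =
        ∫ x in Metric.ball (0 : E) M,
          (ζ x • diracOp c b P x + diracOp c b (fun y => ζ y • v y) x) ∂μ := by
      rw [setIntegral_eq_integral_of_forall_compl_eq_zero hz, integral_add hi2 hi1]
      rw [show ∫ x, diracOp c b (fun y => ζ y • v y) x ∂μ = 0 from hint, add_zero]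
    rw [hsum]
    have := norm_setIntegral_le_of_norm_le_const (μ := μ) (s := Metric.ball (0 : E) M)
      (f := fun x => ζ x • diracOp c b P x + diracOp c b (fun y => ζ y • v y) x)
      (C := T * t ^ δ) measure_ball_lt_top fun x hx => by
        rw [hsplit x, sub_add_cancel]
        refine (norm_add_le _ _).trans ?_
        have e : T * t ^ δ = B * (|A| * M ^ ((m : ℝ) - 1 + δ) * t ^ δ) +
          C₁ * (B' * (|A| * M ^ ((m : ℝ) + δ) * t ^ δ)) := by ring
        rw [e, norm_smul]
        refine add_le_add (mul_le_mul (hB x) (hDb x hx) (norm_nonneg _) hB0)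
          ((hC₁ _).trans (mul_le_mul_of_nonneg_left ?_ hC₁0))
        rw [ContinuousLinearMap.norm_smulRight_apply]
        exact mul_le_mul (hB' x) (hvb x hx) (norm_nonneg _) hB'0
    exact this.trans_eq (by ring)
  refine norm_le_zero_iff.1 (ge_of_tendsto (x := nhdsWithin (0 : ℝ) (Set.Ioi 0))
    (f := fun t : ℝ => T * V * t ^ δ) ?_ ?_)
  · have := ((Real.continuousAt_rpow_const 0 _ (Or.inr hδ.le)).tendsto.const_mul (T * V))
    rw [Real.zero_rpow hδ.ne', mul_zero] at this
    exact this.mono_left nhdsWithin_le_nhds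
  · filter_upwards [Ioo_mem_nhdsGT (div_pos hr hM0)] with t ht
    exact key t ht.1 ((lt_div_iff₀ hM0).1 ht.2)

end LeadingForm

section Decomposition
variable {ι E F : Type*} [Fintype ι] [NormedAddCommGroup E] [InnerProductSpace ℝ E]
  [NormedAddCommGroup F] {b : OrthonormalBasis ι ℝ E}

/-- Solutions of the homogeneous Dirac equation are harmonic. -/
lemma sum_fderiv_fderiv_eq_zero [NormedSpace ℝ F] {c : E →L[ℝ] F →L[ℝ] F}
    (hc : ∀ x v, c x (c x v) = -(‖x‖ ^ 2) • v) {P : E → F} (hP : ContDiff ℝ 2 P)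
    (h : ∀ x, diracOp c b P x = 0) (x : E) :
    ∑ i, fderiv ℝ (fun y => fderiv ℝ P y (b i)) x (b i) = 0 := by
  have hd : Differentiable ℝ (fderiv ℝ P) :=
    (hP.fderiv_right (m := 1) (by norm_num)).differentiable one_ne_zero
  set T := fderiv ℝ (fderiv ℝ P) x with hT
  have hsym : ∀ v w, T v w = T w v :=
    (hP.contDiffAt (x := x)).isSymmSndFDerivAt (by simp)
  have hTe : ∀ j v, fderiv ℝ (fun y => fderiv ℝ P y (b j)) x v = T v (b j) := fun j v => by
    rw [fderiv_clm_apply (hd x) (differentiableAt_const _)]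
    simp [hT]
  have hrow : ∀ v, ∑ j, c (b j) (T v (b j)) = 0 := by
    intro v
    have h1 : HasFDerivAt (diracOp c b P)
        (∑ j, (c (b j)).comp ((ContinuousLinearMap.apply ℝ F (b j)).comp T)) x := by
      refine HasFDerivAt.fun_sum fun j _ => ?_
      exact (c (b j)).hasFDerivAt.comp x
        ((ContinuousLinearMap.apply ℝ F (b j)).hasFDerivAt.comp x (hd x).hasFDerivAt)
    have h2 : HasFDerivAt (diracOp c b P) (0 : E →L[ℝ] F) x := by
      rw [show diracOp c b P = fun _ => 0 from funext h]
      exact hasFDerivAt_const _ _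
    simpa using congrArg (fun L : E →L[ℝ] F => L v) (h1.unique h2)
  have h0 : ∑ i, ∑ j, c (b i) (c (b j) (T (b i) (b j))) = 0 :=
    Finset.sum_eq_zero fun i _ => by rw [← map_sum, hrow, map_zero]
  have h0' : ∑ i, ∑ j, c (b j) (c (b i) (T (b i) (b j))) = 0 := by
    rw [Finset.sum_comm, ← h0]
    exact Finset.sum_congr rfl fun i _ => Finset.sum_congr rfl fun j _ => by rw [hsym]
  have h1 : ∑ i, ∑ j, -(2 * inner ℝ (b i) (b j)) • T (b i) (b j) = 0 := by
    simp_rw [← clifford_anticomm hc, Finset.sum_add_distrib, h0, h0', add_zero]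
  have h2 : ∀ i, ∑ j, -(2 * inner ℝ (b i) (b j)) • T (b i) (b j) = (-2 : ℝ) • T (b i) (b i) := by
    intro i
    rw [Finset.sum_eq_single i (fun j _ hj => by rw [b.orthonormal.inner_eq_zero hj.symm]; simp)
      (by simp), real_inner_self_eq_norm_sq, b.norm_eq_one]
    norm_num
  simp_rw [h2, ← Finset.smul_sum] at h1
  simp_rw [hTe]
  exact (smul_eq_zero.1 h1).resolve_left (by norm_num)

variable [InnerProductSpace ℝ F] [CompleteSpace F] [FiniteDimensional ℝ E]
  {c : E →L[ℝ] F →L[ℝ] F}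

/-- A nontrivial `C^{1,α}` solution of a Dirac inequality is, near a zero, the sum of a nonzero
homogeneous solution of the Dirac equation and a remainder of higher order in `C¹`. -/
theorem exists_leading_decomposition (hn : 2 ≤ Module.finrank ℝ E)
    (hc : ∀ x v, c x (c x v) = -(‖x‖ ^ 2) • v) {φ : E → F} {U : Set E} (hU : IsOpen U)
    (hUc : IsConnected U) (hφ : ContDiffOn ℝ 1 φ U) {α H : ℝ} (hα : α ∈ Set.Ioo (0 : ℝ) 1)
    (hH : 0 ≤ H)
    (hHol : ∀ x ∈ U, ∀ y ∈ U, ‖fderiv ℝ φ y - fderiv ℝ φ x‖ ≤ H * ‖y - x‖ ^ α)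
    (hD : ∀ K ⊆ U, IsCompact K → ∃ L, ∀ x ∈ K, ‖diracOp c b φ x‖ ≤ L * ‖φ x‖)
    (h0 : (0 : E) ∈ U) (hφ0 : φ 0 = 0) (hne : ∃ x ∈ U, φ x ≠ 0) :
    ∃ m : ℕ, 1 ≤ m ∧ ∃ R ∈ Set.Ioo (0 : ℝ) 1, Metric.ball (0 : E) R ⊆ U ∧
      ∃ w : (Fin m → ι) → F, homForm b w ≠ 0 ∧ (∀ x, diracOp c b (homForm b w) x = 0) ∧
        ∀ δ ∈ Set.Ioo (0 : ℝ) 1, ∃ A > 0, ∀ x ∈ Metric.ball (0 : E) R,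
          ‖φ x - homForm b w x‖ ≤ A * ‖x‖ ^ ((m : ℝ) + δ) ∧
          ‖fderiv ℝ (fun y => φ y - homForm b w y) x‖ ≤ A * ‖x‖ ^ ((m : ℝ) + δ - 1) := by
  have _ : Nontrivial E := Module.nontrivial_of_finrank_pos (R := ℝ) (by omega)
  obtain ⟨m, hm, r, hr, hrU, w, hw, happ⟩ :=
    exists_leading_term (b := b) hn hc hU hUc hφ hD h0 hφ0 hne
  have hmR : (1 : ℝ) ≤ m := by exact_mod_cast hm
  set P := homForm b w with hPdef
  have hP : ∀ {k : WithTop ℕ∞}, ContDiff ℝ k P := contDiff_homForm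
  set R := min r 1 / 4 with hR
  have hR0 : 0 < R := by positivity
  have hR1 : R ≤ 1 / 4 := by rw [hR]; linarith [min_le_right r 1]
  have hRr : 2 * R < r := by rw [hR]; linarith [min_le_left r 1]
  have hsub : Metric.closedBall (0 : E) (2 * R) ⊆ U :=
    (Metric.closedBall_subset_ball hRr).trans hrU
  have hball : Metric.ball (0 : E) (2 * R) ⊆ U := Metric.ball_subset_closedBall.trans hsub
  have hballR : Metric.ball (0 : E) R ⊆ Metric.ball 0 (2 * R) :=
    Metric.ball_subset_ball (by linarith)
  obtain ⟨L, hL⟩ := hD _ hsub (isCompact_closedBall _ _)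
  obtain ⟨A₀, hA₀0, hA₀⟩ := exists_norm_homForm_le b w
  have hdec : ∀ δ ∈ Set.Ioo (0 : ℝ) 1, ∃ A, ∀ x ∈ Metric.ball (0 : E) (2 * R),
      ‖φ x - P x‖ ≤ A * ‖x‖ ^ ((m : ℝ) + δ) ∧
      ‖diracOp c b φ x‖ ≤ A * ‖x‖ ^ ((m : ℝ) - 1 + δ) := by
    intro δ hδ
    obtain ⟨A, hA⟩ := happ δ hδ
    refine ⟨max |A| (|L| * (|A| + A₀)), fun x hx => ?_⟩
    have hx1 : ‖x‖ ≤ 1 := by linarith [mem_ball_zero_iff.1 hx]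
    have hxr : x ∈ Metric.ball (0 : E) r := Metric.ball_subset_ball hRr.le hx
    have hQ : ‖φ x - P x‖ ≤ |A| * ‖x‖ ^ ((m : ℝ) + δ) := by
      refine (hA x hxr).trans ?_
      gcongr
      exact le_abs_self A
    refine ⟨hQ.trans (by gcongr; exact le_max_left _ _), ?_⟩
    have hpow : ∀ p : ℝ, (m : ℝ) - 1 + δ ≤ p → ‖x‖ ^ p ≤ ‖x‖ ^ ((m : ℝ) - 1 + δ) := fun p hp =>
      Real.rpow_le_rpow_of_exponent_ge' (norm_nonneg x) hx1 (by linarith [hδ.1]) hp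
    have hφx : ‖φ x‖ ≤ (|A| + A₀) * ‖x‖ ^ ((m : ℝ) - 1 + δ) := by
      have h1 : ‖φ x‖ ≤ ‖φ x - P x‖ + ‖P x‖ := by
        simpa using norm_add_le (φ x - P x) (P x)
      refine h1.trans ?_
      rw [add_mul]
      refine add_le_add (hQ.trans ?_) ((hA₀ x).trans ?_)
      · gcongr ?_ * ?_
        exact hpow _ (by linarith)
      · rw [← Real.rpow_natCast]
        gcongr ?_ * ?_
        exact hpow _ (by linarith [hδ.2])
    calc ‖diracOp c b φ x‖ ≤ L * ‖φ x‖ := hL x (Metric.ball_subset_closedBall hx)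
      _ ≤ |L| * ((|A| + A₀) * ‖x‖ ^ ((m : ℝ) - 1 + δ)) := by
        gcongr
        exact le_abs_self L
      _ ≤ _ := by
        rw [← mul_assoc]
        gcongr
        exact le_max_right _ _
  have hDP : ∀ x, diracOp c b P x = 0 := by
    obtain ⟨u, K, -, hu, -, heq, -⟩ := exists_localization hU hφ (by positivity) hsub hL
    rw [mul_div_cancel_left₀ R two_ne_zero] at heq
    obtain ⟨A, hA⟩ := hdec (1 / 2) (by norm_num)
    refine diracOp_eq_zero_of_leading (δ := 1 / 2) (A := A) hu hP homForm_smul hm hR0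
      (by norm_num) (fun x hx => ?_) (fun x hx => ?_)
    · rw [(heq x hx).1]
      exact (hA x (hballR hx)).1
    · rw [(heq x hx).2]
      exact (hA x (hballR hx)).2
  have hφd : ∀ x ∈ Metric.ball (0 : E) (2 * R), DifferentiableAt ℝ φ x := fun x hx =>
    (hφ.contDiffAt (hU.mem_nhds (hball hx))).differentiableAt one_ne_zero
  have hPd : Differentiable ℝ P := (hP (k := 1)).differentiable one_ne_zero
  have hP' : ContDiff ℝ 1 (fderiv ℝ P) := (hP (k := 2)).fderiv_right (by norm_num)
  obtain ⟨H', hH'⟩ := (isCompact_closedBall (0 : E) (2 * R)).exists_bound_of_continuousOn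
    (hP'.continuous_fderiv one_ne_zero).continuousOn
  have hH'0 : 0 ≤ H' := (norm_nonneg _).trans (hH' 0 (by simp [hR0.le]))
  have hQHol : ∀ x ∈ Metric.ball (0 : E) (2 * R), ∀ y ∈ Metric.ball (0 : E) (2 * R),
      ‖fderiv ℝ (fun z => φ z - P z) y - fderiv ℝ (fun z => φ z - P z) x‖
        ≤ (H + H') * ‖y - x‖ ^ α := by
    intro x hx y hy
    rw [fderiv_fun_sub (hφd x hx) (hPd x), fderiv_fun_sub (hφd y hy) (hPd y),
      sub_sub_sub_comm, add_mul]
    refine norm_sub_le_of_le (hHol x (hball hx) y (hball hy)) ?_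
    have h1 := (convex_closedBall (0 : E) (2 * R)).norm_image_sub_le_of_norm_fderiv_le
      (fun z _ => hP'.differentiable one_ne_zero z) hH' (Metric.ball_subset_closedBall hx)
      (Metric.ball_subset_closedBall hy)
    refine h1.trans (mul_le_mul_of_nonneg_left ?_ hH'0)
    have h2 : ‖y - x‖ ≤ 1 := by
      have := norm_sub_le y x
      linarith [mem_ball_zero_iff.1 hx, mem_ball_zero_iff.1 hy]
    simpa using Real.rpow_le_rpow_of_exponent_ge' (norm_nonneg (y - x)) h2 hα.1.le hα.2.le
  refine ⟨m, hm, R, ⟨hR0, by linarith⟩, hballR.trans hball, w, hw, hDP, fun δ hδ => ?_⟩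
  obtain ⟨A, hA⟩ := hdec δ hδ
  obtain ⟨B, hB0, hB⟩ := exists_norm_fderiv_le_rpow (b := b) (Q := fun z => φ z - P z) hc
    (by linarith : R ≤ 1) hα.1 hα.2.le (by positivity : 0 ≤ H + H')
    ((hφ.mono hball).sub hP.contDiffOn) hQHol hm (fun δ hδ => by
      obtain ⟨A, hA⟩ := hdec δ hδ
      refine ⟨A, fun y hy => ⟨(hA y hy).1, ?_⟩⟩
      rw [diracOp_sub (hφd y hy) (hPd y), hDP, sub_zero]
      exact (hA y hy).2) hδ
  refine ⟨|A| + B + 1, by positivity, fun x hx => ⟨?_, ?_⟩⟩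
  · refine (hA x (hballR hx)).1.trans ?_
    gcongr
    linarith [le_abs_self A]
  · refine (hB x hx).trans ?_
    gcongr
    linarith [abs_nonneg A]

end Decomposition

section EuclideanDirac
variable {n N : ℕ}

/-- Clifford multiplication by the matrices `γ`, as a bilinear map. -/
noncomputable def matrixClifford (γ : Fin n → Matrix (Fin N) (Fin N) ℂ) :
    EuclideanSpace ℝ (Fin n) →L[ℝ] EuclideanSpace ℂ (Fin N) →L[ℝ] EuclideanSpace ℂ (Fin N) :=
  ∑ j, (EuclideanSpace.proj j : EuclideanSpace ℝ (Fin n) →L[ℝ] ℝ).smulRight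
    ((Matrix.toEuclideanCLM (𝕜 := ℂ) (γ j)).restrictScalars ℝ)

variable {γ : Fin n → Matrix (Fin N) (Fin N) ℂ}

lemma matrixClifford_apply (x : EuclideanSpace ℝ (Fin n)) (v : EuclideanSpace ℂ (Fin N)) :
    matrixClifford γ x v = ∑ j, x j • Matrix.toEuclideanCLM (𝕜 := ℂ) (γ j) v := by
  simp [matrixClifford]

lemma matrixClifford_single (j : Fin n) (v : EuclideanSpace ℂ (Fin N)) :
    matrixClifford γ (EuclideanSpace.single j 1) v
      = Matrix.toEuclideanCLM (𝕜 := ℂ) (γ j) v := by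
  rw [matrixClifford_apply, Finset.sum_eq_single j] <;> simp +contextual

lemma matrixClifford_sq
    (hγ : ∀ i j, γ i * γ j + γ j * γ i = if i = j then (-2 : ℂ) • 1 else 0)
    (x : EuclideanSpace ℝ (Fin n)) (v : EuclideanSpace ℂ (Fin N)) :
    matrixClifford γ x (matrixClifford γ x v) = -(‖x‖ ^ 2) • v := by
  have hmul : ∀ i j, Matrix.toEuclideanCLM (𝕜 := ℂ) (γ i) (Matrix.toEuclideanCLM (𝕜 := ℂ) (γ j) v)
      + Matrix.toEuclideanCLM (𝕜 := ℂ) (γ j) (Matrix.toEuclideanCLM (𝕜 := ℂ) (γ i) v)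
      = if i = j then (-2 : ℝ) • v else 0 := by
    intro i j
    have h := congrArg (fun A => Matrix.toEuclideanCLM (𝕜 := ℂ) A v) (hγ i j)
    simp only [map_add, map_mul, add_apply] at h
    refine h.trans ?_
    split_ifs
    · rw [map_smul, map_one]
      ext l
      simp
    · simp
  have h1 : matrixClifford γ x (matrixClifford γ x v) = ∑ i, ∑ j, (x i * x j) •
      Matrix.toEuclideanCLM (𝕜 := ℂ) (γ i) (Matrix.toEuclideanCLM (𝕜 := ℂ) (γ j) v) := by
    rw [matrixClifford_apply]
    refine Finset.sum_congr rfl fun i _ => ?_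
    rw [matrixClifford_apply, map_sum, Finset.smul_sum]
    refine Finset.sum_congr rfl fun j _ => ?_
    rw [ContinuousLinearMap.map_smul_of_tower, smul_smul]
  have h2 : (2 : ℝ) • matrixClifford γ x (matrixClifford γ x v) = (2 : ℝ) • -(‖x‖ ^ 2) • v := by
    rw [two_smul]
    nth_rw 2 [h1]
    rw [Finset.sum_comm, h1, ← Finset.sum_add_distrib]
    simp_rw [← Finset.sum_add_distrib, mul_comm (x _) (x _), ← smul_add]
    have h3 : ∀ i j, (x i * x j) •
        (Matrix.toEuclideanCLM (𝕜 := ℂ) (γ i) (Matrix.toEuclideanCLM (𝕜 := ℂ) (γ j) v)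
          + Matrix.toEuclideanCLM (𝕜 := ℂ) (γ j) (Matrix.toEuclideanCLM (𝕜 := ℂ) (γ i) v))
        = if i = j then (x i ^ 2 * -2) • v else 0 := by
      intro i j
      rw [hmul]
      split_ifs with hij
      · rw [smul_smul, ← hij, sq]
      · simp
    simp [h3, EuclideanSpace.norm_sq_eq, ← Finset.sum_smul, ← Finset.sum_mul]
    rw [smul_smul, mul_comm]
  exact (smul_right_injective _ (two_ne_zero (α := ℝ))) h2

lemma dirac_eq_diracOp (φ : EuclideanSpace ℝ (Fin n) → EuclideanSpace ℂ (Fin N))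
    (x : EuclideanSpace ℝ (Fin n)) :
    dirac γ φ x = diracOp (matrixClifford γ) (EuclideanSpace.basisFun (Fin n) ℝ) φ x := by
  simp only [dirac, diracOp, cliffordContract, EuclideanSpace.basisFun_apply,
    matrixClifford_single]
  ext l
  simp

/-- A real component of a homogeneous harmonic form is a homogeneous harmonic polynomial. -/
lemma isHomHarmonicPoly_homForm {m : ℕ} {w : (Fin m → Fin n) → EuclideanSpace ℂ (Fin N)}
    (hΔ : ∀ x, ∑ i, fderiv ℝ (fun y => fderiv ℝ (homForm (EuclideanSpace.basisFun (Fin n) ℝ) w) y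
      (EuclideanSpace.basisFun (Fin n) ℝ i)) x (EuclideanSpace.basisFun (Fin n) ℝ i) = 0)
    (l : EuclideanSpace ℂ (Fin N) →L[ℝ] ℝ) :
    IsHomHarmonicPoly m fun x => l (homForm (EuclideanSpace.basisFun (Fin n) ℝ) w x) := by
  set P := homForm (EuclideanSpace.basisFun (Fin n) ℝ) w with hPdef
  have hP : ContDiff ℝ 2 P := contDiff_homForm
  refine ⟨⟨∑ f, (∏ i, MvPolynomial.X (f i)) * MvPolynomial.C (l (w f)), fun x => ?_⟩,
    fun t _ x => ?_, fun x => ?_⟩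
  · simp [hPdef, homForm, -EuclideanSpace.basisFun_apply,
      EuclideanSpace.basisFun_inner]
  · simp only [hPdef]
    rw [homForm_smul, map_smul, smul_eq_mul]
  · have h1 : ∀ y v, fderiv ℝ (fun x => l (P x)) y v = l (fderiv ℝ P y v) := fun y v => by
      have h := l.hasFDerivAt.comp y (hP.differentiable two_ne_zero y).hasFDerivAt
      exact congrArg (fun L : EuclideanSpace ℝ (Fin n) →L[ℝ] ℝ => L v) h.fderiv
    have hd : Differentiable ℝ (fderiv ℝ P) :=
      (hP.fderiv_right (m := 1) (by norm_num)).differentiable one_ne_zero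
    have h2 : ∀ j v, fderiv ℝ (fun y => l (fderiv ℝ P y (EuclideanSpace.single j 1))) x v
        = l (fderiv ℝ (fun y => fderiv ℝ P y (EuclideanSpace.single j 1)) x v) := fun j v => by
      have h := l.hasFDerivAt.comp x
        ((hd x).clm_apply (differentiableAt_const (EuclideanSpace.single j 1))).hasFDerivAt
      exact congrArg (fun L : EuclideanSpace ℝ (Fin n) →L[ℝ] ℝ => L v) h.fderiv
    have h3 := hΔ x
    simp only [EuclideanSpace.basisFun_apply] at h3
    simp only [lapl, h1, h2]
    rw [← map_sum, h3, map_zero]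

end EuclideanDirac

/-- Local decomposition of a nontrivial `C^{1,α}` spinor with `|Dφ| ≤ C|φ|^σ̄`, `σ̄ ≥ 1`,
into a nonzero homogeneous Dirac-harmonic polynomial of some degree `k ≥ 1` plus a
higher-order remainder. -/
theorem local_decomposition_homogeneous {n N : ℕ} (hn : 2 ≤ n) (hN : 1 ≤ N)
    (γ : Fin n → Matrix (Fin N) (Fin N) ℂ)
    (hγ : ∀ i j, γ i * γ j + γ j * γ i = if i = j then (-2 : ℂ) • 1 else 0)
    (U : Set (EuclideanSpace ℝ (Fin n))) (hUo : IsOpen U) (hUc : IsConnected U)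
    (hU0 : (0 : EuclideanSpace ℝ (Fin n)) ∈ U)
    (α : ℝ) (hα : α ∈ Set.Ioo (0 : ℝ) 1)
    (φ : EuclideanSpace ℝ (Fin n) → EuclideanSpace ℂ (Fin N))
    (hφ : IsC1Holder α φ U) (hφ0 : φ 0 = 0)
    (hφne : ∃ x ∈ U, φ x ≠ 0)
    (C : ℝ) (hC : 0 ≤ C) (σ' : ℝ) (hσ' : 1 ≤ σ')
    (hgrowth : ∀ x ∈ U, ‖dirac γ φ x‖ ≤ C * ‖φ x‖ ^ σ') :
    ∃ k : ℕ, 1 ≤ k ∧ ∃ R ∈ Set.Ioo (0 : ℝ) 1,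
      Metric.ball (0 : EuclideanSpace ℝ (Fin n)) R ⊆ U ∧
      ∃ P Q : EuclideanSpace ℝ (Fin n) → EuclideanSpace ℂ (Fin N),
        (∀ x ∈ Metric.ball (0 : EuclideanSpace ℝ (Fin n)) R, φ x = P x + Q x) ∧
        P ≠ 0 ∧ (∀ x, dirac γ P x = 0) ∧
        (∀ j : Fin N,
          ((fun x => (P x j).re) = 0 ∨ IsHomHarmonicPoly k (fun x => (P x j).re)) ∧
          ((fun x => (P x j).im) = 0 ∨ IsHomHarmonicPoly k (fun x => (P x j).im))) ∧
        ContinuousOn Q (Metric.ball (0 : EuclideanSpace ℝ (Fin n)) R) ∧ Q 0 = 0 ∧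
        ∀ δ ∈ Set.Ioo (0 : ℝ) 1, ∃ Cδ > (0 : ℝ),
          ∀ x ∈ Metric.ball (0 : EuclideanSpace ℝ (Fin n)) R,
            ‖Q x‖ ≤ Cδ * ‖x‖ ^ ((k : ℝ) + δ) ∧
            ‖fderiv ℝ Q x‖ ≤ Cδ * ‖x‖ ^ ((k : ℝ) + δ - 1) := by
  obtain ⟨hφ1, H, hH⟩ := hφ
  have hHol : ∀ x ∈ U, ∀ y ∈ U, ‖fderiv ℝ φ y - fderiv ℝ φ x‖ ≤ H * ‖y - x‖ ^ α := by
    intro x hx y hy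
    have h := hH.dist_le hy hx
    rwa [dist_eq_norm, dist_eq_norm, Real.coe_toNNReal α hα.1.le] at h
  have hD : ∀ K ⊆ U, IsCompact K → ∃ L, ∀ x ∈ K,
      ‖diracOp (matrixClifford γ) (EuclideanSpace.basisFun (Fin n) ℝ) φ x‖ ≤ L * ‖φ x‖ := by
    intro K hK hKc
    obtain ⟨M, hM⟩ := hKc.exists_bound_of_continuousOn (hφ1.continuousOn.mono hK)
    refine ⟨C * M ^ (σ' - 1), fun x hx => ?_⟩
    rw [← dirac_eq_diracOp]
    refine (hgrowth x (hK hx)).trans ?_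
    have e : ‖φ x‖ ^ σ' = ‖φ x‖ ^ (σ' - 1) * ‖φ x‖ := by
      conv_lhs => rw [← sub_add_cancel σ' 1]
      rw [Real.rpow_add_one' (norm_nonneg _) (by linarith)]
    rw [e, mul_assoc]
    gcongr ?_ * (?_ * ?_)
    exact Real.rpow_le_rpow (norm_nonneg _) (hM x hx) (by linarith)
  obtain ⟨k, hk, R, hR, hRU, w, hw, hDP, hest⟩ := exists_leading_decomposition
    (b := EuclideanSpace.basisFun (Fin n) ℝ) (by simpa using hn) (matrixClifford_sq hγ) hUo hUc
    hφ1 hα H.coe_nonneg hHol hD hU0 hφ0 hφne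
  set P := homForm (EuclideanSpace.basisFun (Fin n) ℝ) w with hPdef
  have hP : ContDiff ℝ 2 P := contDiff_homForm
  have hΔ := sum_fderiv_fderiv_eq_zero (matrixClifford_sq hγ) hP hDP
  have hP0 : P 0 = 0 := by
    have h := homForm_smul (b := EuclideanSpace.basisFun (Fin n) ℝ) (w := w) 0 0
    rwa [smul_zero, zero_pow (by omega), zero_smul] at h
  refine ⟨k, hk, R, hR, hRU, P, fun x => φ x - P x, fun x _ => by simp, hw,
    fun x => by rw [dirac_eq_diracOp, hDP], fun j => ⟨Or.inr ?_, Or.inr ?_⟩,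
    (hφ1.continuousOn.mono hRU).sub hP.continuous.continuousOn, by simp [hφ0, hP0], hest⟩
  · exact isHomHarmonicPoly_homForm hΔ (Complex.reCLM.comp
      ((EuclideanSpace.proj j : EuclideanSpace ℂ (Fin N) →L[ℂ] ℂ).restrictScalars ℝ))
  · exact isHomHarmonicPoly_homForm hΔ (Complex.imCLM.comp
      ((EuclideanSpace.proj j : EuclideanSpace ℂ (Fin N) →L[ℂ] ℂ).restrictScalars ℝ))
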